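/- If f ∈ Diff^∞(ℝ/ℤ) is recurrent, then f is a distortion element of Diff^∞(ℝ/ℤ): there exists a finite subset S ⊆ Diff^∞(ℝ/ℤ) such that f lies in the subgroup generated by S and d_S(f^n, id)/n → 0 as n → ∞. -/

import Mathlib

open Filter Topology Set

noncomputable section

/-- The circle ℝ/ℤ. -/
abbrev S1 := AddCircle (1 : ℝ)

/-- `F : ℝ → ℝ` is a lift of the circle map `f`: it is C^∞, commutes with the unit
translation, has everywhere positive derivative, and descends to `f` on ℝ/ℤ. -/
def IsLift (f : Equiv.Perm S1) (F : ℝ → ℝ) : Prop :=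
  ContDiff ℝ (⊤ : ℕ∞) F ∧ (∀ x, F (x + 1) = F x + 1) ∧ (∀ x, 0 < deriv F x) ∧
    ∀ x : ℝ, f (x : S1) = ((F x : ℝ) : S1)

/-- `f` is an orientation preserving C^∞ diffeomorphism of ℝ/ℤ. -/
def HasLift (f : Equiv.Perm S1) : Prop := ∃ F, IsLift f F

/-- max over 0 ≤ j ≤ k of sup over x of |F^(j)(x) - G^(j)(x)|. -/
noncomputable def liftDist (k : ℕ) (F G : ℝ → ℝ) : ℝ :=
  ⨆ j : Fin (k + 1), ⨆ x : ℝ, |iteratedDeriv (j : ℕ) F x - iteratedDeriv (j : ℕ) G x|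

/-- The C^k distance between two smooth circle diffeomorphisms: infimum over lifts. -/
noncomputable def distC (k : ℕ) (f g : Equiv.Perm S1) : ℝ :=
  sInf {d | ∃ F G, IsLift f F ∧ IsLift g G ∧ d = liftDist k F G}

/-- `f` is recurrent: for every k and ε > 0 there are arbitrarily large n ≥ 1 with
‖f^n − id‖_{C^k} < ε. -/
def Recurrent (f : Equiv.Perm S1) : Prop :=
  ∀ k : ℕ, ∀ ε : ℝ, 0 < ε → ∀ N : ℕ, ∃ n : ℕ, N ≤ n ∧ 1 ≤ n ∧ distC k (f ^ n) 1 < ε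

/-- The word length of `g` with respect to the generating set `S`: the least `k` such that
`g` is a product of `k` elements of `S ∪ S⁻¹`. -/
noncomputable def wordLength (S : Set (Equiv.Perm S1)) (g : Equiv.Perm S1) : ℕ :=
  sInf {k | ∃ l : List (Equiv.Perm S1),
    l.length = k ∧ (∀ x ∈ l, x ∈ S ∨ x⁻¹ ∈ S) ∧ l.prod = g}

/-- The rotation by `t` on ℝ/ℤ, `x ↦ x + t`. -/
def rot (t : S1) : Equiv.Perm S1 := Equiv.addRight t

/-- `f` is a distortion element of Diff^∞(ℝ/ℤ). -/
def IsDistortion (f : Equiv.Perm S1) : Prop :=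
  ∃ S : Finset (Equiv.Perm S1), (∀ g ∈ S, HasLift g) ∧
    f ∈ Subgroup.closure (S : Set (Equiv.Perm S1)) ∧
    Tendsto (fun n : ℕ => (wordLength (S : Set (Equiv.Perm S1)) (f ^ n) : ℝ) / n)
      atTop (nhds 0)

/-- The open arc in ℝ/ℤ which is the image of the interval `(a,b)`. -/
def arcOO (a b : ℝ) : Set S1 := (fun x : ℝ => (x : S1)) '' Set.Ioo a b

/-- The closed arc in ℝ/ℤ which is the image of the interval `[a,b]`. -/
def arcCC (a b : ℝ) : Set S1 := (fun x : ℝ => (x : S1)) '' Set.Icc a b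

/-- `f` is supported on `U`: it is the identity outside `U`. -/
def SupportedOn (f : Equiv.Perm S1) (U : Set S1) : Prop := ∀ x : S1, x ∉ U → f x = x

/-- `f` has rotation number `t ∈ ℝ/ℤ`. -/
def HasRotNum (f : Equiv.Perm S1) (t : S1) : Prop :=
  ∃ F : ℝ → ℝ, ∃ τ : ℝ, IsLift f F ∧ ((τ : ℝ) : S1) = t ∧
    Tendsto (fun n : ℕ => F^[n] 0 / n) atTop (nhds τ)

/-- A real number is Diophantine. -/
def DiophantineReal (t : ℝ) : Prop :=
  ∃ C : ℝ, 0 < C ∧ ∃ n : ℕ, 0 < n ∧ ∀ p q : ℤ, q ≠ 0 →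
    C / |(q : ℝ)| ^ n < |(q : ℝ) * t - (p : ℝ)|

/-- An element of ℝ/ℤ is Diophantine if some (equivalently, every) lift is. -/
def Diophantine (t : S1) : Prop := ∃ τ : ℝ, (τ : S1) = t ∧ DiophantineReal τ


structure SP (f : ℝ → ℝ) : Prop where
  smooth : ContDiff ℝ (⊤ : ℕ∞) f
  per : ∀ x, f (x + 1) = f x

def nrm (k : ℕ) (f : ℝ → ℝ) : ℝ := ⨆ x : ℝ, |iteratedDeriv k f x|

def NN (k : ℕ) (f : ℝ → ℝ) : ℝ := ∑ j ∈ Finset.range (k + 1), nrm j f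

namespace SP
variable {f g a b : ℝ → ℝ}

lemma diff (hf : SP f) : Differentiable ℝ f := hf.smooth.differentiable (by simp)

lemma diffAt (hf : SP f) (x : ℝ) : DifferentiableAt ℝ f x := hf.diff x

lemma hda (hf : SP f) (x : ℝ) : HasDerivAt f (deriv f x) x := (hf.diff x).hasDerivAt

lemma deriv (hf : SP f) : SP (deriv f) := by
  refine ⟨(contDiff_infty_iff_deriv.1 hf.smooth).2, fun x => ?_⟩
  have h : (fun y => f (y + 1)) = f := funext hf.per
  have h2 := deriv_comp_add_const f 1 x
  rw [h] at h2
  exact h2.symm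

lemma iter (hf : SP f) (k : ℕ) : SP (iteratedDeriv k f) := by
  induction k generalizing f with
  | zero => simpa using hf
  | succ k ih => rw [iteratedDeriv_succ']; exact ih hf.deriv

lemma per_int (hf : SP f) (x : ℝ) (n : ℤ) : f (x + n) = f x := by
  have : Function.Periodic f 1 := hf.per
  simpa using this.int_mul n x

lemma bdd0 (hf : SP f) : ∃ C, ∀ x, |f x| ≤ C := by
  obtain ⟨C, hC⟩ := (isCompact_Icc (a := (0:ℝ)) (b := 1)).exists_bound_of_continuousOn
    hf.smooth.continuous.continuousOn
  refine ⟨C, fun x => ?_⟩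
  have h := hC (Int.fract x) ⟨Int.fract_nonneg x, (Int.fract_lt_one x).le⟩
  have h2 := hf.per_int (Int.fract x) ⌊x⌋
  rw [Int.fract_add_floor] at h2
  rw [h2]; simpa using h

lemma add (hf : SP f) (hg : SP g) : SP (fun x => f x + g x) :=
  ⟨hf.smooth.add hg.smooth, fun x => by simp [hf.per, hg.per]⟩
lemma sub (hf : SP f) (hg : SP g) : SP (fun x => f x - g x) :=
  ⟨hf.smooth.sub hg.smooth, fun x => by simp [hf.per, hg.per]⟩
lemma mul (hf : SP f) (hg : SP g) : SP (fun x => f x * g x) :=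
  ⟨hf.smooth.mul hg.smooth, fun x => by simp [hf.per, hg.per]⟩
lemma neg (hf : SP f) : SP (fun x => - f x) :=
  ⟨hf.smooth.neg, fun x => by simp [hf.per]⟩
lemma const (c : ℝ) : SP (fun _ => c) := ⟨contDiff_const, fun _ => rfl⟩
lemma comp (ha : SP a) (hb : SP b) : SP (fun x => a (x + b x)) :=
  ⟨ha.smooth.comp (contDiff_id.add hb.smooth), fun x => by
    simp only [hb.per]; rw [show x + 1 + b x = x + b x + 1 by ring, ha.per]⟩

lemma le (hf : SP f) (k : ℕ) (x : ℝ) : |iteratedDeriv k f x| ≤ nrm k f := by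
  obtain ⟨C, hC⟩ := (hf.iter k).bdd0
  exact le_ciSup (f := fun x => |iteratedDeriv k f x|) ⟨C, by rintro _ ⟨y, rfl⟩; exact hC y⟩ x

lemma le0 (hf : SP f) (x : ℝ) : |f x| ≤ nrm 0 f := by simpa using hf.le 0 x
lemma le1 (hf : SP f) (x : ℝ) : |_root_.deriv f x| ≤ nrm 1 f := by simpa using hf.le 1 x
end SP

lemma nrm_nonneg (k : ℕ) (f : ℝ → ℝ) : 0 ≤ nrm k f := Real.iSup_nonneg fun _ => abs_nonneg _
lemma NN_nonneg (k : ℕ) (f : ℝ → ℝ) : 0 ≤ NN k f := Finset.sum_nonneg fun _ _ => nrm_nonneg _ _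
lemma nrm_le {k : ℕ} {f : ℝ → ℝ} {c : ℝ} (h : ∀ x, |iteratedDeriv k f x| ≤ c) : nrm k f ≤ c :=
  ciSup_le h
lemma nrm0_le {f : ℝ → ℝ} {c : ℝ} (h : ∀ x, |f x| ≤ c) : nrm 0 f ≤ c :=
  nrm_le (by simpa using h)
lemma nrm_succ (k : ℕ) (f : ℝ → ℝ) : nrm (k + 1) f = nrm k (deriv f) := by
  simp [nrm, iteratedDeriv_succ']
lemma NN_zero (f : ℝ → ℝ) : NN 0 f = nrm 0 f := by simp [NN]
lemma NN_succ (k : ℕ) (f : ℝ → ℝ) : NN (k + 1) f = NN k f + nrm (k + 1) f := by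
  simp [NN, Finset.sum_range_succ]
lemma NN_succ' (k : ℕ) (f : ℝ → ℝ) : NN (k + 1) f = nrm 0 f + NN k (deriv f) := by
  unfold NN; rw [Finset.sum_range_succ', add_comm]; simp [nrm_succ]
lemma nrm_le_NN {j k : ℕ} (h : j ≤ k) (f : ℝ → ℝ) : nrm j f ≤ NN k f :=
  Finset.single_le_sum (f := fun j => nrm j f) (fun _ _ => nrm_nonneg _ _)
    (Finset.mem_range.2 (by omega))
lemma NN_mono {j k : ℕ} (h : j ≤ k) (f : ℝ → ℝ) : NN j f ≤ NN k f :=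
  Finset.sum_le_sum_of_subset_of_nonneg (Finset.range_mono (by omega)) fun _ _ _ => nrm_nonneg _ _
lemma NN_deriv_le (k : ℕ) (f : ℝ → ℝ) : NN k (deriv f) ≤ NN (k + 1) f := by
  rw [NN_succ']; linarith [nrm_nonneg 0 f]

section
variable {f g a b : ℝ → ℝ}
lemma deriv_addf (hf : SP f) (hg : SP g) :
    deriv (fun x => f x + g x) = fun x => deriv f x + deriv g x :=
  funext fun x => ((hf.hda x).add (hg.hda x)).deriv
lemma deriv_subf (hf : SP f) (hg : SP g) :
    deriv (fun x => f x - g x) = fun x => deriv f x - deriv g x :=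
  funext fun x => ((hf.hda x).sub (hg.hda x)).deriv
lemma deriv_negf (hf : SP f) :
    deriv (fun x => - f x) = fun x => - deriv f x :=
  funext fun x => (hf.hda x).neg.deriv
lemma deriv_mulf (hf : SP f) (hg : SP g) :
    deriv (fun x => f x * g x) = fun x => deriv f x * g x + f x * deriv g x :=
  funext fun x => ((hf.hda x).mul (hg.hda x)).deriv
lemma deriv_compf (ha : SP a) (hb : SP b) :
    deriv (fun x => a (x + b x)) = fun x => deriv a (x + b x) * (1 + deriv b x) :=
  funext fun x => ((ha.hda (x + b x)).comp x ((hasDerivAt_id x).add (hb.hda x))).deriv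

lemma nrm_add (k : ℕ) (hf : SP f) (hg : SP g) : nrm k (fun x => f x + g x) ≤ nrm k f + nrm k g := by
  induction k generalizing f g with
  | zero => exact nrm0_le fun x => (abs_add_le _ _).trans (add_le_add (hf.le0 x) (hg.le0 x))
  | succ k ih => simp only [nrm_succ, deriv_addf hf hg]; exact ih hf.deriv hg.deriv
lemma nrm_neg (k : ℕ) (hf : SP f) : nrm k (fun x => - f x) = nrm k f := by
  induction k generalizing f with
  | zero => simp [nrm]
  | succ k ih => simp only [nrm_succ, deriv_negf hf]; exact ih hf.deriv
lemma nrm_sub (k : ℕ) (hf : SP f) (hg : SP g) : nrm k (fun x => f x - g x) ≤ nrm k f + nrm k g := by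
  have := nrm_add k hf hg.neg
  rw [nrm_neg k hg] at this
  simpa [sub_eq_add_neg] using this
lemma nrm_const (c : ℝ) (k : ℕ) : nrm (k + 1) (fun _ => c) = 0 := by
  have h0 : ∀ k, nrm k (fun _ : ℝ => (0:ℝ)) = 0 := by
    intro k
    induction k with
    | zero => simp [nrm]
    | succ k ih =>
      have : deriv (fun _ : ℝ => (0:ℝ)) = fun _ => 0 := by funext x; simp
      rw [nrm_succ, this, ih]
  have : deriv (fun _ : ℝ => c) = fun _ => 0 := by funext x; simp
  rw [nrm_succ, this, h0]
lemma nrm0_const (c : ℝ) : nrm 0 (fun _ => c) = |c| := by simp [nrm]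
lemma NN_const (c : ℝ) (k : ℕ) : NN k (fun _ => c) = |c| := by
  induction k with
  | zero => rw [NN_zero, nrm0_const]
  | succ k ih => rw [NN_succ, ih, nrm_const, add_zero]
lemma NN_add (k : ℕ) (hf : SP f) (hg : SP g) : NN k (fun x => f x + g x) ≤ NN k f + NN k g := by
  unfold NN; rw [← Finset.sum_add_distrib]; exact Finset.sum_le_sum fun j _ => nrm_add j hf hg
lemma NN_sub (k : ℕ) (hf : SP f) (hg : SP g) : NN k (fun x => f x - g x) ≤ NN k f + NN k g := by
  unfold NN; rw [← Finset.sum_add_distrib]; exact Finset.sum_le_sum fun j _ => nrm_sub j hf hg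
lemma NN_neg (k : ℕ) (hf : SP f) : NN k (fun x => - f x) = NN k f := by
  unfold NN; exact Finset.sum_congr rfl fun j _ => nrm_neg j hf

lemma nrm0_mul (hf : SP f) (hg : SP g) : nrm 0 (fun x => f x * g x) ≤ nrm 0 f * nrm 0 g :=
  nrm0_le fun x => by
    rw [abs_mul]; exact mul_le_mul (hf.le0 x) (hg.le0 x) (abs_nonneg _) (nrm_nonneg _ _)

lemma NN_mul (k : ℕ) : ∃ C, 0 ≤ C ∧ ∀ f g : ℝ → ℝ, SP f → SP g →
    NN k (fun x => f x * g x) ≤ C * (NN k f * NN k g) := by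
  induction k with
  | zero => exact ⟨1, zero_le_one, fun f g hf hg => by
      simp only [NN_zero, one_mul]; exact nrm0_mul hf hg⟩
  | succ k ih =>
    obtain ⟨C, hC, h⟩ := ih
    refine ⟨1 + 2 * C, by positivity, fun f g hf hg => ?_⟩
    rw [NN_succ', deriv_mulf hf hg]
    have h0 := nrm0_mul hf hg
    have h1 := NN_add k (hf.deriv.mul hg) (hf.mul hg.deriv)
    have h2 := h _ _ hf.deriv hg
    have h3 := h _ _ hf hg.deriv
    have e1 : nrm 0 f * nrm 0 g ≤ NN (k+1) f * NN (k+1) g :=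
      mul_le_mul (nrm_le_NN (by omega) f) (nrm_le_NN (by omega) g) (nrm_nonneg _ _) (NN_nonneg _ _)
    have e2 : NN k (deriv f) * NN k g ≤ NN (k+1) f * NN (k+1) g :=
      mul_le_mul (NN_deriv_le k f) (NN_mono (by omega) g) (NN_nonneg _ _) (NN_nonneg _ _)
    have e3 : NN k f * NN k (deriv g) ≤ NN (k+1) f * NN (k+1) g :=
      mul_le_mul (NN_mono (by omega) f) (NN_deriv_le k g) (NN_nonneg _ _) (NN_nonneg _ _)
    nlinarith [mul_le_mul_of_nonneg_left e2 hC, mul_le_mul_of_nonneg_left e3 hC]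

/-- Leibniz with the two extreme terms separated. -/
lemma nrm_mul (k : ℕ) : ∃ C, 0 ≤ C ∧ ∀ f g : ℝ → ℝ, SP f → SP g →
    nrm (k + 1) (fun x => f x * g x) ≤ nrm (k + 1) f * nrm 0 g + nrm 0 f * nrm (k + 1) g
      + C * (NN k f * NN k g) := by
  induction k with
  | zero =>
    refine ⟨0, le_rfl, fun f g hf hg => ?_⟩
    simp only [nrm_succ, deriv_mulf hf hg]
    have h1 := nrm_add 0 (hf.deriv.mul hg) (hf.mul hg.deriv)
    have h2 := nrm0_mul hf.deriv hg
    have h3 := nrm0_mul hf hg.deriv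
    linarith
  | succ k ih =>
    obtain ⟨C, hC, h⟩ := ih
    refine ⟨2 + 2 * C, by positivity, fun f g hf hg => ?_⟩
    rw [nrm_succ, deriv_mulf hf hg]
    have h1 := nrm_add (k+1) (hf.deriv.mul hg) (hf.mul hg.deriv)
    have h2 := h _ _ hf.deriv hg
    have h3 := h _ _ hf hg.deriv
    have e2 : NN k (deriv f) * NN k g ≤ NN (k+1) f * NN (k+1) g :=
      mul_le_mul (NN_deriv_le k f) (NN_mono (by omega) g) (NN_nonneg _ _) (NN_nonneg _ _)
    have e3 : NN k f * NN k (deriv g) ≤ NN (k+1) f * NN (k+1) g :=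
      mul_le_mul (NN_mono (by omega) f) (NN_deriv_le k g) (NN_nonneg _ _) (NN_nonneg _ _)
    have e4 : nrm 0 (deriv f) * nrm (k+1) g ≤ NN (k+1) f * NN (k+1) g :=
      mul_le_mul (by rw [← nrm_succ]; exact nrm_le_NN (by omega) f) (nrm_le_NN le_rfl g)
        (nrm_nonneg _ _) (NN_nonneg _ _)
    have e5 : nrm (k+1) f * nrm 0 (deriv g) ≤ NN (k+1) f * NN (k+1) g :=
      mul_le_mul (nrm_le_NN le_rfl f) (by rw [← nrm_succ]; exact nrm_le_NN (by omega) g)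
        (nrm_nonneg _ _) (NN_nonneg _ _)
    rw [nrm_succ (k+1) f, nrm_succ (k+1) g]
    nlinarith [mul_le_mul_of_nonneg_left e2 hC, mul_le_mul_of_nonneg_left e3 hC]

lemma nrm0_comp (ha : SP a) : nrm 0 (fun x => a (x + b x)) ≤ nrm 0 a :=
  nrm0_le fun x => ha.le0 _

lemma NN_one_add (k : ℕ) (hb : SP b) : NN k (fun x => 1 + deriv b x) ≤ 1 + NN (k + 1) b := by
  have h1 := NN_add k (SP.const 1) hb.deriv
  rw [NN_const] at h1
  have := NN_deriv_le k b
  simp only [abs_one] at h1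
  linarith

lemma NN_comp (k : ℕ) (B : ℝ) : ∃ C, 0 ≤ C ∧ ∀ a b : ℝ → ℝ, SP a → SP b → NN k b ≤ B →
    NN k (fun x => a (x + b x)) ≤ C * NN k a := by
  induction k with
  | zero => exact ⟨1, zero_le_one, fun a b ha hb _ => by
      simp only [NN_zero, one_mul]; exact nrm0_comp ha⟩
  | succ k ih =>
    obtain ⟨C, hC, h⟩ := ih
    obtain ⟨D, hD, hm⟩ := NN_mul k
    refine ⟨1 + D * (C * (1 + |B|)), by positivity, fun a b ha hb hB => ?_⟩
    rw [NN_succ', deriv_compf ha hb]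
    have h0 := nrm0_comp (b := b) ha
    have h1 := hm _ _ (ha.deriv.comp hb) ((SP.const 1).add hb.deriv)
    have h2 := h _ _ ha.deriv hb ((NN_mono (Nat.le_succ k) b).trans hB)
    have h3 := NN_one_add k hb
    have h4 : NN k (fun x => 1 + deriv b x) ≤ 1 + |B| := h3.trans (by linarith [le_abs_self B])
    have h5 : NN k (fun x => deriv a (x + b x)) * NN k (fun x => 1 + deriv b x)
        ≤ (C * NN (k+1) a) * (1 + |B|) := by
      refine mul_le_mul (h2.trans ?_) h4 (NN_nonneg _ _) (mul_nonneg hC (NN_nonneg _ _))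
      exact mul_le_mul_of_nonneg_left (NN_deriv_le k a) hC
    have h6 := mul_le_mul_of_nonneg_left h5 hD
    have h7 := nrm_le_NN (Nat.zero_le (k+1)) a
    nlinarith

lemma NN_comp_sub (k : ℕ) (B : ℝ) : ∃ C, 0 ≤ C ∧ ∀ a b c : ℝ → ℝ, SP a → SP b → SP c →
    NN k b ≤ B → NN k c ≤ B →
    NN k (fun x => a (x + b x) - a (x + c x)) ≤ C * (NN (k + 1) a * NN k (fun x => b x - c x)) := by
  induction k with
  | zero =>
    refine ⟨1, zero_le_one, fun a b c ha hb hc _ _ => ?_⟩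
    simp only [NN_zero, one_mul]
    refine nrm0_le fun x => ?_
    have hl : LipschitzWith (nrm 1 a).toNNReal a :=
      lipschitzWith_of_nnnorm_deriv_le ha.diff fun y => by
        rw [← NNReal.coe_le_coe, Real.coe_toNNReal _ (nrm_nonneg _ _)]
        simpa using ha.le1 y
    have h1 := hl.dist_le_mul (x + b x) (x + c x)
    rw [Real.dist_eq, Real.dist_eq, Real.coe_toNNReal _ (nrm_nonneg _ _)] at h1
    refine h1.trans (mul_le_mul (nrm_le_NN le_rfl a) ?_ (abs_nonneg _) (NN_nonneg _ _))
    rw [show x + b x - (x + c x) = b x - c x by ring]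
    exact (hb.sub hc).le0 x
  | succ k ih =>
    obtain ⟨C, hC, h⟩ := ih
    obtain ⟨D, hD, hm⟩ := NN_mul k
    obtain ⟨E, hE, hc'⟩ := NN_comp k B
    refine ⟨1 + D * (C * (1 + |B|)) + D * E, by positivity, fun a b c ha hb hc hB hB' => ?_⟩
    have hBk := (NN_mono (Nat.le_succ k) b).trans hB
    have hBk' := (NN_mono (Nat.le_succ k) c).trans hB'
    set d : ℝ → ℝ := fun x => b x - c x with hd
    have hdS : SP d := hb.sub hc
    have hdd : deriv d = fun x => deriv b x - deriv c x := deriv_subf hb hc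
    have key : deriv (fun x => a (x + b x) - a (x + c x)) = fun x =>
        (deriv a (x + b x) - deriv a (x + c x)) * (1 + deriv b x)
          + deriv a (x + c x) * deriv d x := by
      rw [deriv_subf (ha.comp hb) (ha.comp hc), deriv_compf ha hb, deriv_compf ha hc, hdd]
      funext x; ring
    rw [NN_succ', key]
    have z0 : nrm 0 (fun x => a (x + b x) - a (x + c x)) ≤ NN (k+2) a * NN (k+1) d := by
      refine nrm0_le fun x => ?_
      have hl : LipschitzWith (nrm 1 a).toNNReal a :=
        lipschitzWith_of_nnnorm_deriv_le ha.diff fun y => by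
          rw [← NNReal.coe_le_coe, Real.coe_toNNReal _ (nrm_nonneg _ _)]
          simpa using ha.le1 y
      have h1 := hl.dist_le_mul (x + b x) (x + c x)
      rw [Real.dist_eq, Real.dist_eq, Real.coe_toNNReal _ (nrm_nonneg _ _)] at h1
      refine h1.trans (mul_le_mul (nrm_le_NN (by omega) a) ?_ (abs_nonneg _) (NN_nonneg _ _))
      rw [show x + b x - (x + c x) = b x - c x by ring]
      exact (hdS.le0 x).trans (nrm_le_NN (by omega) d)
    have s1 : SP (fun x => (deriv a (x + b x) - deriv a (x + c x))) :=
      (ha.deriv.comp hb).sub (ha.deriv.comp hc)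
    have s2 : SP (fun x => 1 + deriv b x) := (SP.const 1).add hb.deriv
    have z1 := NN_add k (s1.mul s2) ((ha.deriv.comp hc).mul hdS.deriv)
    have z2 := hm _ _ s1 s2
    have z3 := hm _ _ (ha.deriv.comp hc) hdS.deriv
    have z4 := h _ _ _ ha.deriv hb hc hBk hBk'
    have z5 := hc' _ _ ha.deriv hc hBk'
    have z6 : NN k (fun x => 1 + deriv b x) ≤ 1 + |B| :=
      (NN_one_add k hb).trans (by linarith [le_abs_self B])
    have z7 : NN (k+1) (deriv a) * NN k d ≤ NN (k+2) a * NN (k+1) d :=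
      mul_le_mul (NN_deriv_le _ _) (NN_mono (by omega) _) (NN_nonneg _ _) (NN_nonneg _ _)
    have z8 : NN k (deriv a) * NN k (deriv d) ≤ NN (k+2) a * NN (k+1) d :=
      mul_le_mul ((NN_deriv_le _ _).trans (NN_mono (by omega) _)) (NN_deriv_le _ _)
        (NN_nonneg _ _) (NN_nonneg _ _)
    have X0 : 0 ≤ NN (k+2) a * NN (k+1) d := mul_nonneg (NN_nonneg _ _) (NN_nonneg _ _)
    have z9 : NN k (fun x => deriv a (x + b x) - deriv a (x + c x)) * NN k (fun x => 1 + deriv b x)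
        ≤ (C * (NN (k+2) a * NN (k+1) d)) * (1 + |B|) :=
      mul_le_mul (z4.trans (mul_le_mul_of_nonneg_left z7 hC)) z6 (NN_nonneg _ _) (mul_nonneg hC X0)
    have z10 : NN k (fun x => deriv a (x + c x)) * NN k (deriv d)
        ≤ E * (NN (k+2) a * NN (k+1) d) := by
      calc _ ≤ (E * NN k (deriv a)) * NN k (deriv d) :=
            mul_le_mul_of_nonneg_right z5 (NN_nonneg _ _)
        _ = E * (NN k (deriv a) * NN k (deriv d)) := by ring
        _ ≤ _ := mul_le_mul_of_nonneg_left z8 hE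
    have z11 := mul_le_mul_of_nonneg_left z9 hD
    have z12 := mul_le_mul_of_nonneg_left z10 hD
    calc _ ≤ NN (k+2) a * NN (k+1) d + (D * (C * (NN (k+2) a * NN (k+1) d) * (1 + |B|))
          + D * (E * (NN (k+2) a * NN (k+1) d))) := by linarith
      _ = _ := by ring

/-- top order estimate of a composition -/
lemma nrm_comp (k : ℕ) : (∀ B : ℝ, ∃ C, 0 ≤ C ∧ ∀ a b : ℝ → ℝ, SP a → SP b → NN k b ≤ B →
    nrm (k + 1) (fun x => a (x + b x)) ≤ nrm (k + 1) a * (1 + nrm 1 b) ^ (k + 1)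
      + nrm 1 a * nrm (k + 1) b + C * NN k a) ∧
    (∀ B : ℝ, ∃ C, 0 ≤ C ∧ ∀ a b : ℝ → ℝ, SP a → SP b → NN (k + 1) b ≤ B →
    nrm (k + 1) (fun x => a (x + b x)) ≤ nrm (k + 1) a * (1 + nrm 1 b) ^ (k + 1) + C * NN k a) := by
  have n1 : ∀ b : ℝ → ℝ, SP b → nrm 0 (fun x => 1 + deriv b x) ≤ 1 + nrm 1 b := fun b hb => by
    have := nrm_add 0 (SP.const 1) hb.deriv
    rw [nrm0_const, ← nrm_succ] at this; simpa using this
  induction k with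
  | zero =>
    have base : ∀ a b : ℝ → ℝ, SP a → SP b →
        nrm 1 (fun x => a (x + b x)) ≤ nrm 1 a * (1 + nrm 1 b) := fun a b ha hb => by
      rw [nrm_succ, deriv_compf ha hb]
      refine (nrm0_mul (ha.deriv.comp hb) ((SP.const 1).add hb.deriv)).trans ?_
      refine mul_le_mul ?_ (n1 b hb) (nrm_nonneg _ _) (nrm_nonneg _ _)
      rw [nrm_succ]; exact nrm0_comp ha.deriv
    refine ⟨fun B => ⟨0, le_rfl, fun a b ha hb _ => ?_⟩, fun B => ⟨0, le_rfl, fun a b ha hb _ => ?_⟩⟩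
    · have := base a b ha hb
      have := mul_nonneg (nrm_nonneg 1 a) (nrm_nonneg 1 b)
      simp only [zero_add, pow_one, zero_mul, add_zero]; linarith
    · have := base a b ha hb
      simpa using this
  | succ k ih =>
    obtain ⟨_, H⟩ := ih
    have L8 : ∀ B : ℝ, ∃ C, 0 ≤ C ∧ ∀ a b : ℝ → ℝ, SP a → SP b → NN (k+1) b ≤ B →
      nrm (k + 2) (fun x => a (x + b x)) ≤ nrm (k + 2) a * (1 + nrm 1 b) ^ (k + 2)
        + nrm 1 a * nrm (k + 2) b + C * NN (k+1) a := by
      intro B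
      obtain ⟨C, hC, h⟩ := H B
      obtain ⟨D, hD, hm⟩ := nrm_mul k
      obtain ⟨E, hE, hc⟩ := NN_comp k B
      refine ⟨C * (1 + |B|) + D * (E * (1 + |B|)), by positivity, fun a b ha hb hB => ?_⟩
      rw [nrm_succ, deriv_compf ha hb]
      have s2 : SP (fun x => 1 + deriv b x) := (SP.const 1).add hb.deriv
      have z1 := hm _ _ (ha.deriv.comp hb) s2
      have z2 := h _ _ ha.deriv hb hB
      have z3 := hc _ _ ha.deriv hb ((NN_mono (Nat.le_succ k) b).trans hB)
      have z4 := n1 b hb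
      have z5 : nrm (k+1) (fun x => 1 + deriv b x) ≤ nrm (k+2) b := by
        have := nrm_add (k+1) (SP.const 1) hb.deriv
        rw [nrm_const, ← nrm_succ] at this; simpa using this
      have z6 : NN k (fun x => 1 + deriv b x) ≤ 1 + |B| :=
        (NN_one_add k hb).trans (by linarith [le_abs_self B])
      have z7 : nrm 0 (fun x => deriv a (x + b x)) ≤ nrm 1 a := by
        rw [nrm_succ]; exact nrm0_comp ha.deriv
      have hb1 : nrm 1 b ≤ |B| := (nrm_le_NN (by omega) b).trans (hB.trans (le_abs_self B))
      have b0 := nrm_nonneg 1 b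
      have w1 : nrm (k+1) (fun x => deriv a (x + b x)) * nrm 0 (fun x => 1 + deriv b x) ≤
          (nrm (k+2) a * (1 + nrm 1 b)^(k+1) + C * NN k (deriv a)) * (1 + nrm 1 b) := by
        rw [nrm_succ (k+1) a]
        exact mul_le_mul z2 z4 (nrm_nonneg _ _) ((nrm_nonneg _ _).trans z2)
      have w2 : C * NN k (deriv a) * (1 + nrm 1 b) ≤ C * NN (k+1) a * (1 + |B|) :=
        mul_le_mul (mul_le_mul_of_nonneg_left (NN_deriv_le _ _) hC) (by linarith) (by linarith)
          (mul_nonneg hC (NN_nonneg _ _))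
      have w3 : nrm 0 (fun x => deriv a (x + b x)) * nrm (k+1) (fun x => 1 + deriv b x)
          ≤ nrm 1 a * nrm (k+2) b :=
        mul_le_mul z7 z5 (nrm_nonneg _ _) (nrm_nonneg _ _)
      have w4 : NN k (fun x => deriv a (x + b x)) * NN k (fun x => 1 + deriv b x)
          ≤ E * NN (k+1) a * (1 + |B|) :=
        mul_le_mul (z3.trans (mul_le_mul_of_nonneg_left (NN_deriv_le _ _) hE)) z6 (NN_nonneg _ _)
          (mul_nonneg hE (NN_nonneg _ _))
      have w5 := mul_le_mul_of_nonneg_left w4 hD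
      calc _ ≤ nrm (k+2) a * (1 + nrm 1 b)^(k+1) * (1 + nrm 1 b) + C * NN (k+1) a * (1 + |B|)
            + nrm 1 a * nrm (k+2) b + D * (E * NN (k+1) a * (1 + |B|)) := by linarith
        _ = _ := by ring
    refine ⟨L8, fun B => ?_⟩
    obtain ⟨C, hC, h⟩ := L8 B
    refine ⟨C + |B|, by positivity, fun a b ha hb hB => ?_⟩
    have z1 := h a b ha hb ((NN_mono (Nat.le_succ _) b).trans hB)
    have z2 : nrm 1 a * nrm (k+2) b ≤ NN (k+1) a * |B| :=
      mul_le_mul (nrm_le_NN (by omega) a)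
        ((nrm_le_NN le_rfl b).trans (hB.trans (le_abs_self B))) (nrm_nonneg _ _) (NN_nonneg _ _)
    nlinarith
end

structure LF (F : ℝ → ℝ) : Prop where
  smooth : ContDiff ℝ (⊤ : ℕ∞) F
  per : ∀ x, F (x + 1) = F x + 1
  pos : ∀ x, 0 < deriv F x

namespace LF
variable {F G : ℝ → ℝ}
lemma mono (h : LF F) : StrictMono F := strictMono_of_deriv_pos h.pos
lemma diffAt (h : LF F) (x : ℝ) : DifferentiableAt ℝ F x := h.smooth.differentiable (by simp) x
lemma per_int (h : LF F) (x : ℝ) (n : ℤ) : F (x + n) = F x + n := by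
  have : Function.Periodic (fun x => F x - x) 1 := fun x => by simp [h.per]
  have := this.int_mul n x
  simp only [mul_one] at this; linarith
lemma surj (h : LF F) : Function.Surjective F := by
  intro y
  have hc := h.smooth.continuous
  have h1 : F (0 + (⌊y - F 0⌋ : ℤ)) ≤ y := by
    rw [h.per_int]; linarith [Int.floor_le (y - F 0)]
  have h2 : y ≤ F (0 + (⌈y - F 0⌉ : ℤ)) := by
    rw [h.per_int]; linarith [Int.le_ceil (y - F 0)]
  exact mem_range_of_exists_le_of_exists_ge hc ⟨_, h1⟩ ⟨_, h2⟩
lemma comp (hF : LF F) (hG : LF G) : LF (F ∘ G) :=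
  ⟨hF.smooth.comp hG.smooth, fun x => by simp [hF.per, hG.per], fun x => by
    rw [deriv_comp x (hF.diffAt _) (hG.diffAt _)]; exact mul_pos (hF.pos _) (hG.pos _)⟩
lemma exists_inv (h : LF F) : ∃ G, LF G ∧ (∀ x, F (G x) = x) ∧ ∀ x, G (F x) = x := by
  let e : ℝ ≃o ℝ := StrictMono.orderIsoOfSurjective F h.mono h.surj
  let H : ℝ ≃ₜ ℝ := e.toHomeomorph
  have hF : ∀ x, H x = F x := fun x => rfl
  have h1 : ∀ x, F (H.symm x) = x := fun x => by rw [← hF]; simp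
  have h2 : ∀ x, H.symm (F x) = x := fun x => by rw [← hF]; simp
  have hs : ContDiff ℝ (⊤ : ℕ∞) (H.symm : ℝ → ℝ) :=
    H.contDiff_symm_deriv (f' := deriv F) (fun x => (h.pos x).ne')
      (fun x => (h.diffAt x).hasDerivAt) h.smooth
  refine ⟨H.symm, ⟨hs, fun x => ?_, fun x => ?_⟩, h1, h2⟩
  · apply h.mono.injective; rw [h1, h.per, h1]
  · have hd : HasDerivAt H.symm (deriv F (H.symm x))⁻¹ x :=
      HasDerivAt.of_local_left_inverse (f := F) (H.symm.continuous.continuousAt)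
        (h.diffAt _).hasDerivAt (h.pos _).ne' (Eventually.of_forall h1)
    rw [hd.deriv]; exact inv_pos.2 (h.pos _)
lemma id : LF (fun x => x) := ⟨contDiff_id, fun _ => rfl, fun x => by simp⟩
lemma sp (h : LF F) : SP (fun x => F x - x) := ⟨h.smooth.sub contDiff_id, fun x => by rw [h.per]; ring⟩
end LF

lemma LF_of_SP {a : ℝ → ℝ} (ha : SP a) (h : ∀ x, -1 < deriv a x) : LF (fun x => x + a x) :=
  ⟨contDiff_id.add ha.smooth, fun x => by simp only [ha.per]; ring, fun x => by
    have := ((hasDerivAt_id x).add (ha.hda x)).deriv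
    have h2 : deriv (fun x => x + a x) x = 1 + deriv a x := this
    rw [h2]; linarith [h x]⟩

lemma LF_of_nrm {a : ℝ → ℝ} (ha : SP a) (h : nrm 1 a ≤ 1/2) : LF (fun x => x + a x) :=
  LF_of_SP ha fun x => by have := abs_le.1 (ha.le1 x); linarith

open Classical in
def inv (a : ℝ → ℝ) : ℝ → ℝ :=
  if h : ∃ c, SP c ∧ ∀ x, c x = - a (x + c x) then h.choose else 0

lemma inv_ex {a : ℝ → ℝ} (ha : SP a) (h : ∀ x, -1 < deriv a x) :
    SP (inv a) ∧ ∀ x, inv a x = - a (x + inv a x) := by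
  have h : ∃ c, SP c ∧ ∀ x, c x = - a (x + c x) := by
    obtain ⟨G, hG, h1, h2⟩ := (LF_of_SP ha h).exists_inv
    refine ⟨fun x => G x - x, hG.sp, fun x => ?_⟩
    have := h1 x
    simp only [add_sub_cancel]; linarith
  unfold inv; rw [dif_pos h]; exact h.choose_spec

lemma gt_neg_one {a : ℝ → ℝ} (ha : SP a) (h : nrm 1 a ≤ 1/2) : ∀ x, -1 < deriv a x :=
  fun x => by have := abs_le.1 (ha.le1 x); linarith

/-- displacement of `(id+a)⁻¹ ∘ (id+b)` -/
def frag (a b : ℝ → ℝ) : ℝ → ℝ := fun x => b x + inv a (x + b x)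

lemma frag_spec {a b : ℝ → ℝ} (ha : SP a) (h : nrm 1 a ≤ 1/2) (hb : SP b) :
    SP (frag a b) ∧ ∀ x, frag a b x = b x - a (x + frag a b x) := by
  obtain ⟨h1, h2⟩ := inv_ex ha (gt_neg_one ha h)
  refine ⟨hb.add (h1.comp hb), fun x => ?_⟩
  unfold frag
  rw [← add_assoc]
  linarith [h2 (x + b x)]

def Sop (q : ℝ → ℝ) : ℝ → ℝ := fun x => 2 * (q (x / 2) + q ((x + 1) / 2))

lemma Sop_sp {q : ℝ → ℝ} (hq : SP q) : SP (Sop q) := by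
  refine ⟨?_, fun x => ?_⟩
  · have := hq.smooth
    unfold Sop; fun_prop
  · unfold Sop
    rw [show (x + 1 + 1) / 2 = x / 2 + 1 by ring, hq.per]; ring

lemma Sop_deriv {q : ℝ → ℝ} (hq : SP q) : deriv (Sop q) = fun x => (1/2) * Sop (deriv q) x := by
  funext x
  unfold Sop
  have h1 := (hq.hda (x/2)).comp x ((hasDerivAt_id x).div_const 2)
  have h2 := (hq.hda ((x+1)/2)).comp x (((hasDerivAt_id x).add_const 1).div_const 2)
  have := ((h1.add h2).const_mul 2).deriv
  refine Eq.trans this ?_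
  simp; ring

lemma nrm_cmul (c : ℝ) (k : ℕ) {f : ℝ → ℝ} (hf : SP f) : nrm k (fun x => c * f x) ≤ |c| * nrm k f := by
  apply nrm_le; intro x
  rw [iteratedDeriv_const_mul_field, abs_mul]
  exact mul_le_mul_of_nonneg_left (hf.le k x) (abs_nonneg _)

lemma SP.cmul (c : ℝ) {f : ℝ → ℝ} (hf : SP f) : SP (fun x => c * f x) := (SP.const c).mul hf

lemma Sop_nrm (k : ℕ) {q : ℝ → ℝ} (hq : SP q) : nrm k (Sop q) ≤ 4 * (1/2)^k * nrm k q := by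
  induction k generalizing q with
  | zero =>
    apply nrm0_le; intro x
    have h1 := abs_le.1 (hq.le0 (x/2)); have h2 := abs_le.1 (hq.le0 ((x+1)/2))
    unfold Sop; rw [abs_le]; constructor <;> simp <;> linarith
  | succ k ih =>
    rw [nrm_succ, Sop_deriv hq]
    have h1 := nrm_cmul (1/2) k (Sop_sp hq.deriv)
    have h2 := ih hq.deriv
    rw [nrm_succ k q, pow_succ]
    rw [abs_of_pos (by norm_num)] at h1
    linarith

lemma Sop_NN (k : ℕ) {q : ℝ → ℝ} (hq : SP q) : NN k (Sop q) ≤ 4 * NN k q := by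
  unfold NN; rw [Finset.mul_sum]
  refine Finset.sum_le_sum fun j _ => (Sop_nrm j hq).trans ?_
  have : (1/2:ℝ)^j ≤ 1 := pow_le_one₀ (by norm_num) (by norm_num)
  nlinarith [nrm_nonneg j q]

structure Tame (d0 : ℝ) (Q L : (ℝ → ℝ) → (ℝ → ℝ)) (M ρ : ℝ) : Prop where
  sp : ∀ u, SP u → NN 1 u ≤ d0 → SP (Q u)
  Lsp : ∀ u, SP u → SP (L u)
  A0 : ∀ k (B : ℝ), ∃ C, 0 ≤ C ∧ ∀ u, SP u → NN 1 u ≤ d0 → NN k u ≤ B → NN k (Q u) ≤ C * NN k u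
  A2 : ∀ k (B : ℝ), ∃ C, 0 ≤ C ∧ ∀ u, SP u → NN 1 u ≤ d0 → NN k u ≤ B →
    nrm (k + 1) (Q u) ≤ M * ρ ^ (k + 1) * nrm (k + 1) u + C * NN k u
  B0 : ∀ k, ∃ d C, 0 < d ∧ 0 ≤ C ∧ ∀ u v, SP u → SP v → NN 1 u ≤ d0 → NN 1 v ≤ d0 →
    NN (k + 1) u ≤ d → NN (k + 1) v ≤ d →
    NN k (fun x => Q u x - Q v x) ≤ C * NN k (fun x => u x - v x)
  B1 : ∀ k, ∃ d C, 0 < d ∧ 0 ≤ C ∧ ∀ u v, SP u → SP v → NN 1 u ≤ d0 → NN 1 v ≤ d0 →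
    NN (k + 2) u ≤ d → NN (k + 2) v ≤ d →
    NN k (fun x => Q u x - Q v x - L (fun y => u y - v y) x)
      ≤ C * (NN (k + 1) u + NN (k + 1) v) * NN (k + 1) (fun x => u x - v x)
  B2 : ∀ k, ∃ d C, 0 < d ∧ 0 ≤ C ∧ ∀ u v, SP u → SP v → NN 1 u ≤ d0 → NN 1 v ≤ d0 →
    NN (k + 2) u ≤ d → NN (k + 2) v ≤ d →
    nrm (k + 1) (fun x => Q u x - Q v x)
      ≤ M * ρ ^ (k + 1) * nrm (k + 1) (fun x => u x - v x) + C * NN k (fun x => u x - v x)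

lemma Tame.shrink {d0 d1 : ℝ} {Q L : (ℝ → ℝ) → (ℝ → ℝ)} {M ρ : ℝ} (h : Tame d0 Q L M ρ)
    (hd : d1 ≤ d0) : Tame d1 Q L M ρ where
  sp u hu h1 := h.sp u hu (h1.trans hd)
  Lsp := h.Lsp
  A0 k B := by
    obtain ⟨C, hC, H⟩ := h.A0 k B
    exact ⟨C, hC, fun u hu h1 => H u hu (h1.trans hd)⟩
  A2 k B := by
    obtain ⟨C, hC, H⟩ := h.A2 k B
    exact ⟨C, hC, fun u hu h1 => H u hu (h1.trans hd)⟩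
  B0 k := by
    obtain ⟨d, C, hd', hC, H⟩ := h.B0 k
    exact ⟨d, C, hd', hC, fun u v hu hv h1 h2 => H u v hu hv (h1.trans hd) (h2.trans hd)⟩
  B1 k := by
    obtain ⟨d, C, hd', hC, H⟩ := h.B1 k
    exact ⟨d, C, hd', hC, fun u v hu hv h1 h2 => H u v hu hv (h1.trans hd) (h2.trans hd)⟩
  B2 k := by
    obtain ⟨d, C, hd', hC, H⟩ := h.B2 k
    exact ⟨d, C, hd', hC, fun u v hu hv h1 h2 => H u v hu hv (h1.trans hd) (h2.trans hd)⟩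

lemma Tame.congrL {d0 : ℝ} {Q L L' : (ℝ → ℝ) → (ℝ → ℝ)} {M ρ : ℝ} (h : Tame d0 Q L M ρ)
    (hL : ∀ u x, L u x = L' u x) : Tame d0 Q L' M ρ := by
  have : L = L' := by funext u x; exact hL u x
  exact this ▸ h

/-- multiplication by a cutoff -/
lemma tame_mul {η : ℝ → ℝ} (hη : SP η) (d0 : ℝ) :
    Tame d0 (fun u x => η x * u x) (fun u x => η x * u x) (nrm 0 η) 1 where
  sp u hu _ := hη.mul hu
  Lsp u hu := hη.mul hu
  A0 k B := by
    obtain ⟨C, hC, H⟩ := NN_mul k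
    refine ⟨C * NN k η, mul_nonneg hC (NN_nonneg _ _), fun u hu _ _ => ?_⟩
    rw [mul_assoc]; exact H _ _ hη hu
  A2 k B := by
    obtain ⟨C, hC, H⟩ := nrm_mul k
    refine ⟨nrm (k+1) η + C * NN k η, add_nonneg (nrm_nonneg _ _) (mul_nonneg hC (NN_nonneg _ _)),
      fun u hu _ _ => ?_⟩
    have h1 := H _ _ hη hu
    have h2 : nrm (k+1) η * nrm 0 u ≤ nrm (k+1) η * NN k u :=
      mul_le_mul_of_nonneg_left (nrm_le_NN (Nat.zero_le _) _) (nrm_nonneg _ _)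
    simp only [one_pow, mul_one]; linarith
  B0 k := by
    obtain ⟨C, hC, H⟩ := NN_mul k
    refine ⟨1, C * NN k η, one_pos, mul_nonneg hC (NN_nonneg _ _), fun u v hu hv _ _ _ _ => ?_⟩
    rw [mul_assoc]
    have := H _ _ hη (hu.sub hv)
    simpa only [mul_sub] using this
  B1 k := by
    refine ⟨1, 0, one_pos, le_rfl, fun u v hu hv _ _ _ _ => ?_⟩
    simp only [mul_sub, sub_self, NN_const]; simp
  B2 k := by
    obtain ⟨C, hC, H⟩ := nrm_mul k
    refine ⟨1, nrm (k+1) η + C * NN k η, one_pos,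
      add_nonneg (nrm_nonneg _ _) (mul_nonneg hC (NN_nonneg _ _)), fun u v hu hv _ _ _ _ => ?_⟩
    have h1 := H _ _ hη (hu.sub hv)
    have h2 : nrm (k+1) η * nrm 0 (fun x => u x - v x) ≤ nrm (k+1) η * NN k (fun x => u x - v x) :=
      mul_le_mul_of_nonneg_left (nrm_le_NN (Nat.zero_le _) _) (nrm_nonneg _ _)
    simp only [mul_sub] at h1
    simp only [one_pow, mul_one]; linarith

lemma Sop_sub (f g : ℝ → ℝ) : (fun x => Sop f x - Sop g x) = Sop (fun x => f x - g x) := by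
  funext x; simp only [Sop]; ring

lemma Tame.Sop {d0 : ℝ} {Q L : (ℝ → ℝ) → (ℝ → ℝ)} {M ρ : ℝ} (h : Tame d0 Q L M ρ) :
    Tame d0 (fun u => Sop (Q u)) (fun u => Sop (L u)) (4 * M) (ρ / 2) where
  sp u hu h1 := Sop_sp (h.sp u hu h1)
  Lsp u hu := Sop_sp (h.Lsp u hu)
  A0 k B := by
    obtain ⟨C, hC, H⟩ := h.A0 k B
    refine ⟨4 * C, by positivity, fun u hu h1 h2 => ?_⟩
    have := Sop_NN k (h.sp u hu h1); have := H u hu h1 h2; linarith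
  A2 k B := by
    obtain ⟨C, hC, H⟩ := h.A2 k B
    refine ⟨4 * C, by positivity, fun u hu h1 h2 => ?_⟩
    have e1 := Sop_nrm (k+1) (h.sp u hu h1); have e2 := H u hu h1 h2
    have e3 : (1/2:ℝ)^(k+1) ≤ 1 := pow_le_one₀ (by norm_num) (by norm_num)
    have e4 : (0:ℝ) ≤ (1/2:ℝ)^(k+1) := by positivity
    have e5 := mul_le_mul_of_nonneg_left e2 e4
    have e6 : (1/2:ℝ)^(k+1) * (C * NN k u) ≤ 1 * (C * NN k u) :=
      mul_le_mul_of_nonneg_right e3 (mul_nonneg hC (NN_nonneg _ _))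
    rw [show ρ / 2 = (1/2) * ρ by ring, mul_pow]
    nlinarith
  B0 k := by
    obtain ⟨d, C, hd', hC, H⟩ := h.B0 k
    refine ⟨d, 4 * C, hd', by positivity, fun u v hu hv h1 h2 h3 h4 => ?_⟩
    rw [Sop_sub]
    have := Sop_NN k ((h.sp u hu h1).sub (h.sp v hv h2))
    have := H u v hu hv h1 h2 h3 h4; linarith
  B1 k := by
    obtain ⟨d, C, hd', hC, H⟩ := h.B1 k
    refine ⟨d, 4 * C, hd', by positivity, fun u v hu hv h1 h2 h3 h4 => ?_⟩
    have e : (fun x => _root_.Sop (Q u) x - _root_.Sop (Q v) x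
        - _root_.Sop (L fun y => u y - v y) x) =
        _root_.Sop (fun x => Q u x - Q v x - L (fun y => u y - v y) x) := by
      funext x; simp only [_root_.Sop]; ring
    rw [e]
    have := Sop_NN k (((h.sp u hu h1).sub (h.sp v hv h2)).sub (h.Lsp _ (hu.sub hv)))
    have := H u v hu hv h1 h2 h3 h4; linarith
  B2 k := by
    obtain ⟨d, C, hd', hC, H⟩ := h.B2 k
    refine ⟨d, 4 * C, hd', by positivity, fun u v hu hv h1 h2 h3 h4 => ?_⟩
    rw [Sop_sub]
    have e1 := Sop_nrm (k+1) ((h.sp u hu h1).sub (h.sp v hv h2))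
    have e2 := H u v hu hv h1 h2 h3 h4
    have e3 : (1/2:ℝ)^(k+1) ≤ 1 := pow_le_one₀ (by norm_num) (by norm_num)
    have e4 : (0:ℝ) ≤ (1/2:ℝ)^(k+1) := by positivity
    have e5 := mul_le_mul_of_nonneg_left e2 e4
    have e6 : (1/2:ℝ)^(k+1) * (C * NN k (fun x => u x - v x)) ≤ 1 * (C * NN k (fun x => u x - v x)) :=
      mul_le_mul_of_nonneg_right e3 (mul_nonneg hC (NN_nonneg _ _))
    rw [show ρ / 2 = (1/2) * ρ by ring, mul_pow]
    nlinarith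

structure FR (a b R : ℝ → ℝ) : Prop where
  ha : SP a
  hb : SP b
  hR : SP R
  eq : ∀ x, R x = b x - a (x + R x)
  na : nrm 1 a ≤ 1 / 18
  nb : nrm 1 b ≤ 1 / 18

lemma FR.eqf {a b R : ℝ → ℝ} (h : FR a b R) : R = fun x => b x - a (x + R x) := funext h.eq

lemma FR.n1 {a b R : ℝ → ℝ} (h : FR a b R) : nrm 1 R ≤ 1 / 8 := by
  have h1 : nrm 1 R ≤ nrm 1 b + nrm 1 (fun x => a (x + R x)) := by
    conv_lhs => rw [h.eqf]
    exact nrm_sub 1 h.hb (h.ha.comp h.hR)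
  have h2 : nrm 1 (fun x => a (x + R x)) ≤ nrm 1 a * (1 + nrm 1 R) := by
    apply nrm_le; intro x
    rw [iteratedDeriv_one, deriv_compf h.ha h.hR, abs_mul]
    apply mul_le_mul (h.ha.le1 _) _ (abs_nonneg _) (nrm_nonneg _ _)
    have := abs_le.1 (h.hR.le1 x)
    rw [abs_le]; constructor <;> linarith
  have h3 := h.na; have h4 := h.nb
  nlinarith [nrm_nonneg 1 R, nrm_nonneg 1 a]

lemma FR.top (k : ℕ) (B : ℝ) : ∃ C, 0 ≤ C ∧ ∀ a b R, FR a b R → NN k R ≤ B →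
    nrm (k + 1) R ≤ (9/8) * (nrm (k + 1) b + (9/8)^(k+1) * nrm (k + 1) a + C * NN k a) := by
  obtain ⟨C, hC, H⟩ := (nrm_comp k).1 B
  refine ⟨C, hC, fun a b R h hB => ?_⟩
  have h1 : nrm (k+1) R ≤ nrm (k+1) b + nrm (k+1) (fun x => a (x + R x)) := by
    conv_lhs => rw [h.eqf]
    exact nrm_sub _ h.hb (h.ha.comp h.hR)
  have h2 := H a R h.ha h.hR hB
  have h3 : (1 + nrm 1 R)^(k+1) ≤ (9/8:ℝ)^(k+1) :=
    pow_le_pow_left₀ (by linarith [nrm_nonneg 1 R]) (by linarith [h.n1]) _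
  have h4 := mul_le_mul_of_nonneg_left h3 (nrm_nonneg (k+1) a)
  have h5 : nrm 1 a * nrm (k+1) R ≤ (1/18) * nrm (k+1) R :=
    mul_le_mul_of_nonneg_right h.na (nrm_nonneg _ _)
  have h6 := mul_nonneg hC (NN_nonneg k a)
  have h7 := nrm_nonneg (k+1) b
  have h8 : 0 ≤ nrm (k+1) a * (9/8)^(k+1) := mul_nonneg (nrm_nonneg _ _) (by positivity)
  linarith

lemma FR.diff {a b R a' b' R' : ℝ → ℝ} (h : FR a b R) (h' : FR a' b' R') :
    (fun x => R x - R' x) = fun x => (b x - b' x) - (a (x + R x) - a' (x + R x))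
      - (a' (x + R x) - a' (x + R' x)) := by
  funext x; have h1 := h.eq x; have h2 := h'.eq x; linarith

section
variable {d : ℝ} {A La B Lb R : (ℝ → ℝ) → (ℝ → ℝ)} {Ma ρa Mb ρb ρ : ℝ}

lemma frag_A0 (ha : Tame d A La Ma ρa) (hb : Tame d B Lb Mb ρb)
    (hR : ∀ u, SP u → NN 1 u ≤ d → FR (A u) (B u) (R u)) (k : ℕ) :
    ∀ B', ∃ C, 0 ≤ C ∧ ∀ u, SP u → NN 1 u ≤ d → NN k u ≤ B' → NN k (R u) ≤ C * NN k u := by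
  induction k with
  | zero =>
    intro B'
    obtain ⟨Ca, hCa, Ha⟩ := ha.A0 0 B'
    obtain ⟨Cb, hCb, Hb⟩ := hb.A0 0 B'
    refine ⟨Cb + Ca, by positivity, fun u hu h1 h2 => ?_⟩
    have f := hR u hu h1
    have e1 := Ha u hu h1 h2; have e2 := Hb u hu h1 h2
    have : nrm 0 (R u) ≤ nrm 0 (B u) + nrm 0 (A u) := by
      conv_lhs => rw [f.eqf]
      exact (nrm_sub 0 f.hb (f.ha.comp f.hR)).trans (add_le_add_right (nrm0_comp f.ha) _)
    simp only [NN_zero] at *; linarith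
  | succ k ih =>
    intro B'
    obtain ⟨C, hC, H⟩ := ih B'
    obtain ⟨C1, hC1, H1⟩ := FR.top k (C * B')
    obtain ⟨Ca, hCa, Ha⟩ := ha.A0 (k+1) B'
    obtain ⟨Cb, hCb, Hb⟩ := hb.A0 (k+1) B'
    refine ⟨C + (9/8) * (Cb + (9/8)^(k+1) * Ca + C1 * Ca), by positivity, fun u hu h1 h2 => ?_⟩
    have f := hR u hu h1
    have h3 : NN k u ≤ NN (k+1) u := NN_mono (by omega) u
    have e0 := H u hu h1 (h3.trans h2)
    have e1 := H1 _ _ _ f (e0.trans (mul_le_mul_of_nonneg_left (h3.trans h2) hC))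
    have e2 := Ha u hu h1 h2; have e3 := Hb u hu h1 h2
    have e9 := NN_succ k (R u)
    have g1 : nrm (k+1) (B u) ≤ Cb * NN (k+1) u := (nrm_le_NN le_rfl _).trans e3
    have g2 : nrm (k+1) (A u) ≤ Ca * NN (k+1) u := (nrm_le_NN le_rfl _).trans e2
    have g3 : NN k (A u) ≤ Ca * NN (k+1) u := (NN_mono (by omega) _).trans e2
    have g4 := mul_le_mul_of_nonneg_left g2 (show (0:ℝ) ≤ (9/8)^(k+1) by positivity)
    have g5 := mul_le_mul_of_nonneg_left g3 hC1
    have g6 := mul_le_mul_of_nonneg_left h3 hC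
    linarith

lemma frag_B0 (ha : Tame d A La Ma ρa) (hb : Tame d B Lb Mb ρb)
    (hR : ∀ u, SP u → NN 1 u ≤ d → FR (A u) (B u) (R u)) (k : ℕ) :
    ∃ d' C, 0 < d' ∧ 0 ≤ C ∧ ∀ u v, SP u → SP v → NN 1 u ≤ d → NN 1 v ≤ d →
    NN (k + 1) u ≤ d' → NN (k + 1) v ≤ d' →
    NN k (fun x => R u x - R v x) ≤ C * NN k (fun x => u x - v x) := by
  obtain ⟨CR, hCR, HR⟩ := frag_A0 ha hb hR k 1
  obtain ⟨Ca, hCa, Ha⟩ := ha.A0 (k+1) 1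
  obtain ⟨da, Ca', hda, hCa', Ha'⟩ := ha.B0 k
  obtain ⟨db, Cb', hdb, hCb', Hb'⟩ := hb.B0 k
  obtain ⟨C1, hC1, H1⟩ := NN_comp k CR
  obtain ⟨C2, hC2, H2⟩ := NN_comp_sub k CR
  refine ⟨min (min da db) (min 1 (1 / (2 * (C2 * Ca + 1)))), 2 * (Cb' + C1 * Ca'), by positivity,
    by positivity, fun u v hu hv hu1 hv1 hu2 hv2 => ?_⟩
  simp only [le_min_iff] at hu2 hv2
  obtain ⟨⟨u1, u2⟩, u3, u4⟩ := hu2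
  obtain ⟨⟨v1, v2⟩, v3, v4⟩ := hv2
  have f := hR u hu hu1; have f' := hR v hv hv1
  have bd : ∀ u, SP u → NN 1 u ≤ d → NN (k+1) u ≤ 1 → NN k (R u) ≤ CR := fun u hu h1 h2 => by
    have h3 : NN k u ≤ 1 := (NN_mono (by omega) u).trans h2
    have := HR u hu h1 h3
    nlinarith
  have e1 := Ha' u v hu hv hu1 hv1 u1 v1
  have e2 := Hb' u v hu hv hu1 hv1 u2 v2
  have e3 := H1 _ _ (f.ha.sub f'.ha) f.hR (bd u hu hu1 u3)
  have e4 := H2 _ _ _ f'.ha f.hR f'.hR (bd u hu hu1 u3) (bd v hv hv1 v3)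
  have e5 := Ha v hv hv1 v3
  have e6 : NN k (fun x => R u x - R v x) ≤ NN k (fun x => B u x - B v x)
      + NN k (fun x => A u (x + R u x) - A v (x + R u x))
      + NN k (fun x => A v (x + R u x) - A v (x + R v x)) := by
    conv_lhs => rw [f.diff f']
    refine (NN_sub k ((f.hb.sub f'.hb).sub ((f.ha.comp f.hR).sub (f'.ha.comp f.hR)))
      ((f'.ha.comp f.hR).sub (f'.ha.comp f'.hR))).trans (add_le_add_left ?_ _)
    exact NN_sub k (f.hb.sub f'.hb) ((f.ha.comp f.hR).sub (f'.ha.comp f.hR))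
  have e7 : C2 * NN (k+1) (A v) ≤ 1/2 := by
    have g : C2 * NN (k+1) (A v) ≤ C2 * (Ca * (1 / (2 * (C2 * Ca + 1)))) :=
      mul_le_mul_of_nonneg_left (e5.trans (mul_le_mul_of_nonneg_left v4 hCa)) hC2
    refine g.trans ?_
    rw [show C2 * (Ca * (1 / (2 * (C2 * Ca + 1)))) = (C2 * Ca) / (2 * (C2 * Ca + 1)) by ring]
    rw [div_le_iff₀ (by positivity)]; nlinarith [mul_nonneg hC2 hCa]
  have e8 := mul_le_mul_of_nonneg_right e7 (NN_nonneg k (fun x => R u x - R v x))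
  have e9 := mul_le_mul_of_nonneg_left e1 hC1
  linarith

lemma frag_tame (hd : 0 < d) (ha : Tame d A La Ma ρa) (hb : Tame d B Lb Mb ρb)
    (hMa : 0 ≤ Ma) (hMb : 0 ≤ Mb) (hρa : 0 ≤ ρa) (hρb : 0 ≤ ρb)
    (h1 : 9/8 * ρa ≤ ρ) (h2 : ρb ≤ ρ) :
    ∃ d', 0 < d' ∧ d' ≤ d ∧ Tame d' (fun u => frag (A u) (B u)) (fun w x => Lb w x - La w x)
      (2 * (Ma + Mb)) ρ ∧ ∀ u, SP u → NN 1 u ≤ d' → FR (A u) (B u) (frag (A u) (B u)) := by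
  obtain ⟨Ca, hCa, Ha⟩ := ha.A0 1 d
  obtain ⟨Cb, hCb, Hb⟩ := hb.A0 1 d
  set d' := min d (1 / (18 * (Ca + Cb + 1))) with hd'
  have hd'd : d' ≤ d := min_le_left _ _
  have hd0 : 0 < d' := by positivity
  have hR : ∀ u, SP u → NN 1 u ≤ d' → FR (A u) (B u) (frag (A u) (B u)) := fun u hu hu1 => by
    have hu2 := hu1.trans hd'd
    have key : (Ca + Cb) * NN 1 u ≤ 1/18 := by
      have : (Ca + Cb) * NN 1 u ≤ (Ca + Cb) * (1 / (18 * (Ca + Cb + 1))) :=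
        mul_le_mul_of_nonneg_left (hu1.trans (min_le_right _ _)) (by positivity)
      refine this.trans ?_
      rw [← mul_div_assoc, div_le_iff₀ (by positivity)]; linarith
    have n0 := NN_nonneg 1 u
    have na : nrm 1 (A u) ≤ 1/18 := (nrm_le_NN le_rfl _).trans ((Ha u hu hu2 hu2).trans
      (by nlinarith))
    have nb : nrm 1 (B u) ≤ 1/18 := (nrm_le_NN le_rfl _).trans ((Hb u hu hu2 hu2).trans
      (by nlinarith))
    have sa := ha.sp u hu hu2; have sb := hb.sp u hu hu2
    obtain ⟨s1, s2⟩ := frag_spec sa (by linarith) sb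
    exact ⟨sa, sb, s1, s2, na, nb⟩
  clear_value d'
  clear Ha Hb
  replace ha := ha.shrink hd'd
  replace hb := hb.shrink hd'd
  refine ⟨d', hd0, hd'd, ?_, hR⟩
  have P1 : ∀ k : ℕ, (9/8:ℝ)^(k+1) * ρa^(k+1) ≤ ρ^(k+1) := fun k => by
    rw [← mul_pow]; exact pow_le_pow_left₀ (by positivity) h1 _
  have P2 : ∀ k : ℕ, ρb^(k+1) ≤ ρ^(k+1) := fun k => pow_le_pow_left₀ hρb h2 _
  have P3 : ∀ k : ℕ, 0 ≤ ρ^(k+1) := fun k => (pow_nonneg hρb _).trans (P2 k)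
  refine ⟨fun u hu h => (hR u hu h).hR, fun u hu => (hb.Lsp u hu).sub (ha.Lsp u hu),
    fun k B' => frag_A0 ha hb hR k B', fun k B' => ?_, fun k => frag_B0 ha hb hR k,
    fun k => ?_, fun k => ?_⟩
  · obtain ⟨C, hC, H⟩ := frag_A0 ha hb hR k B'
    obtain ⟨C1, hC1, H1⟩ := FR.top k (C * B')
    obtain ⟨Ca, hCa, Ha⟩ := ha.A2 k B'
    obtain ⟨Cb, hCb, Hb⟩ := hb.A2 k B'
    obtain ⟨Ca', hCa', Ha'⟩ := ha.A0 k B'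
    refine ⟨(9/8) * (Cb + (9/8)^(k+1) * Ca + C1 * Ca'), by positivity, fun u hu hu1 hu2 => ?_⟩
    have f := hR u hu hu1
    have e1 := H1 _ _ _ f ((H u hu hu1 hu2).trans (mul_le_mul_of_nonneg_left hu2 hC))
    have e2 := Ha u hu hu1 hu2; have e3 := Hb u hu hu1 hu2
    have e4 := mul_le_mul_of_nonneg_left (Ha' u hu hu1 hu2) hC1
    have e5 := mul_le_mul_of_nonneg_left e2 (show (0:ℝ) ≤ (9/8)^(k+1) by positivity)
    have n0 := nrm_nonneg (k+1) u
    have e6 : (9/8)^(k+1) * (Ma * ρa^(k+1) * nrm (k+1) u) ≤ Ma * ρ^(k+1) * nrm (k+1) u := by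
      have := mul_le_mul_of_nonneg_right (mul_le_mul_of_nonneg_left (P1 k) hMa) n0
      linarith
    have e7 : Mb * ρb^(k+1) * nrm (k+1) u ≤ Mb * ρ^(k+1) * nrm (k+1) u :=
      mul_le_mul_of_nonneg_right (mul_le_mul_of_nonneg_left (P2 k) hMb) n0
    have e8 : 0 ≤ Ma * ρ^(k+1) * nrm (k+1) u := mul_nonneg (mul_nonneg hMa (P3 k)) n0
    have e9 : 0 ≤ Mb * ρ^(k+1) * nrm (k+1) u := mul_nonneg (mul_nonneg hMb (P3 k)) n0
    linarith
  · obtain ⟨CR, hCR, HR⟩ := frag_A0 ha hb hR k 1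
    obtain ⟨dR, CR', hdR, hCR', HR'⟩ := frag_B0 ha hb hR k
    obtain ⟨Ca, hCa, Ha⟩ := ha.A0 (k+1) 1
    obtain ⟨da, Ca', hda, hCa', Ha'⟩ := ha.B0 (k+1)
    obtain ⟨da1, Ca1, hda1, hCa1, Ha1⟩ := ha.B1 k
    obtain ⟨db1, Cb1, hdb1, hCb1, Hb1⟩ := hb.B1 k
    obtain ⟨C2, hC2, H2⟩ := NN_comp_sub k CR
    refine ⟨min (min da1 db1) (min (min da dR) 1), Cb1 + Ca1 + C2 * Ca' * CR + C2 * Ca * CR',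
      by positivity, by positivity, fun u v hu hv hu1 hv1 hu2 hv2 => ?_⟩
    simp only [le_min_iff] at hu2 hv2
    obtain ⟨⟨u1, u2⟩, ⟨u3, u4⟩, u5⟩ := hu2
    obtain ⟨⟨v1, v2⟩, ⟨v3, v4⟩, v5⟩ := hv2
    have f := hR u hu hu1; have f' := hR v hv hv1
    have m1 : ∀ u, NN (k+1) u ≤ NN (k+2) u := fun u => NN_mono (by omega) u
    have m0 : ∀ u, NN k u ≤ NN (k+1) u := fun u => NN_mono (by omega) u
    have bd : ∀ u, SP u → NN 1 u ≤ d' → NN (k+2) u ≤ 1 →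
        NN k (frag (A u) (B u)) ≤ CR * NN (k+1) u := fun u hu h1 h2 => by
      have := HR u hu h1 ((m0 u).trans ((m1 u).trans h2))
      exact this.trans (mul_le_mul_of_nonneg_left (m0 u) hCR)
    have bd1 : ∀ u, SP u → NN 1 u ≤ d' → NN (k+2) u ≤ 1 →
        NN k (frag (A u) (B u)) ≤ CR := fun u hu h1 h2 => by
      have := bd u hu h1 h2; have := (m1 u).trans h2; nlinarith
    have e1 := Ha1 u v hu hv hu1 hv1 u1 v1
    have e2 := Hb1 u v hu hv hu1 hv1 u2 v2
    have e3 := H2 _ _ _ (f.ha.sub f'.ha) f.hR (SP.const 0) (bd1 u hu hu1 u5)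
      (by rw [NN_const]; simpa using hCR)
    have e4 := H2 _ _ _ f'.ha f.hR f'.hR (bd1 u hu hu1 u5) (bd1 v hv hv1 v5)
    have e5 := Ha v hv hv1 ((m1 v).trans v5)
    have e6 := Ha' u v hu hv hu1 hv1 u3 v3
    have e7 := HR' u v hu hv hu1 hv1 ((m1 u).trans u4) ((m1 v).trans v4)
    have e8 := bd u hu hu1 u5
    simp only [add_zero, sub_zero] at e3
    have eq : (fun x => frag (A u) (B u) x - frag (A v) (B v) x
          - (Lb (fun y => u y - v y) x - La (fun y => u y - v y) x))
        = fun x => ((B u x - B v x - Lb (fun y => u y - v y) x)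
          - (A u x - A v x - La (fun y => u y - v y) x))
          - ((A u (x + frag (A u) (B u) x) - A v (x + frag (A u) (B u) x) - (A u x - A v x))
          + (A v (x + frag (A u) (B u) x) - A v (x + frag (A v) (B v) x))) := by
      funext x; have := congrFun (f.diff f') x; rw [this]; ring
    rw [eq]
    have sL := hb.Lsp _ (hu.sub hv); have sL' := ha.Lsp _ (hu.sub hv)
    have s1 := ((f.ha.comp f.hR).sub (f'.ha.comp f.hR)).sub (f.ha.sub f'.ha)
    have s2 := (f'.ha.comp f.hR).sub (f'.ha.comp f'.hR)
    have s3 := (f.hb.sub f'.hb).sub sL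
    have s4 := (f.ha.sub f'.ha).sub sL'
    refine (NN_sub k (s3.sub s4) (s1.add s2)).trans ?_
    have t1 := NN_sub k s3 s4
    have t2 := NN_add k s1 s2
    set D := NN (k+1) (fun x => u x - v x) with hD
    have hD0 : 0 ≤ D := NN_nonneg _ _
    have t3 : NN (k+1) (fun x => A u x - A v x) * NN k (frag (A u) (B u))
        ≤ (Ca' * D) * (CR * NN (k+1) u) :=
      mul_le_mul e6 e8 (NN_nonneg _ _) (by positivity)
    have t4 : NN (k+1) (A v) * NN k (fun x => frag (A u) (B u) x - frag (A v) (B v) x)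
        ≤ (Ca * NN (k+1) v) * (CR' * D) :=
      mul_le_mul e5 (e7.trans (mul_le_mul_of_nonneg_left (m0 _) hCR')) (NN_nonneg _ _)
        (mul_nonneg hCa (NN_nonneg _ _))
    have t5 := mul_le_mul_of_nonneg_left t3 hC2
    have t6 := mul_le_mul_of_nonneg_left t4 hC2
    have nu := NN_nonneg (k+1) u; have nv := NN_nonneg (k+1) v
    have t7 : 0 ≤ C2 * Ca' * CR * NN (k+1) v * D := by positivity
    have t8 : 0 ≤ C2 * Ca * CR' * NN (k+1) u * D := by positivity
    linarith
  · obtain ⟨CR, hCR, HR⟩ := frag_A0 ha hb hR (k+1) 1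
    obtain ⟨dR, CR', hdR, hCR', HR'⟩ := frag_B0 ha hb hR k
    obtain ⟨Ca, hCa, Ha⟩ := ha.A0 (k+2) 1
    obtain ⟨da, Ca', hda, hCa', Ha'⟩ := ha.B0 k
    obtain ⟨da1, Ca1, hda1, hCa1, Ha1⟩ := ha.B2 k
    obtain ⟨db1, Cb1, hdb1, hCb1, Hb1⟩ := hb.B2 k
    obtain ⟨C1, hC1, H1⟩ := (nrm_comp k).2 CR
    obtain ⟨C2, hC2, H2⟩ := NN_comp_sub (k+1) CR
    refine ⟨min (min da1 db1) (min (min da dR) (min 1 (1 / (9 * (C2 * Ca + 1))))),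
      (9/8) * (Cb1 + (9/8)^(k+1) * Ca1 + C1 * Ca' + (1/9) * CR'),
      by positivity, by positivity, fun u v hu hv hu1 hv1 hu2 hv2 => ?_⟩
    simp only [le_min_iff] at hu2 hv2
    obtain ⟨⟨u1, u2⟩, ⟨u3, u4⟩, u5, u6⟩ := hu2
    obtain ⟨⟨v1, v2⟩, ⟨v3, v4⟩, v5, v6⟩ := hv2
    have f := hR u hu hu1; have f' := hR v hv hv1
    have m1 : ∀ u, NN (k+1) u ≤ NN (k+2) u := fun u => NN_mono (by omega) u
    have bd1 : ∀ u, SP u → NN 1 u ≤ d' → NN (k+2) u ≤ 1 →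
        NN (k+1) (frag (A u) (B u)) ≤ CR := fun u hu h1 h2 => by
      have h3 := (m1 u).trans h2
      have := HR u hu h1 h3; nlinarith
    have e1 := Ha1 u v hu hv hu1 hv1 u1 v1
    have e2 := Hb1 u v hu hv hu1 hv1 u2 v2
    have e3 := H1 _ _ (f.ha.sub f'.ha) f.hR (bd1 u hu hu1 u5)
    have e4 := H2 _ _ _ f'.ha f.hR f'.hR (bd1 u hu hu1 u5) (bd1 v hv hv1 v5)
    have e5 := Ha v hv hv1 v5
    have e6 := Ha' u v hu hv hu1 hv1 ((m1 u).trans u3) ((m1 v).trans v3)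
    have e7 := HR' u v hu hv hu1 hv1 ((m1 u).trans u4) ((m1 v).trans v4)
    have t6 : nrm (k+1) (fun x => frag (A u) (B u) x - frag (A v) (B v) x)
        ≤ nrm (k+1) (fun x => B u x - B v x)
        + nrm (k+1) (fun x => A u (x + frag (A u) (B u) x) - A v (x + frag (A u) (B u) x))
        + NN (k+1) (fun x => A v (x + frag (A u) (B u) x) - A v (x + frag (A v) (B v) x)) := by
      conv_lhs => rw [f.diff f']
      refine (nrm_sub _ ((f.hb.sub f'.hb).sub ((f.ha.comp f.hR).sub (f'.ha.comp f.hR)))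
        ((f'.ha.comp f.hR).sub (f'.ha.comp f'.hR))).trans (add_le_add ?_ (nrm_le_NN le_rfl _))
      exact nrm_sub _ (f.hb.sub f'.hb) ((f.ha.comp f.hR).sub (f'.ha.comp f.hR))
    have t7 : C2 * NN (k+2) (A v) ≤ 1/9 := by
      have g : C2 * NN (k+2) (A v) ≤ C2 * (Ca * (1 / (9 * (C2 * Ca + 1)))) :=
        mul_le_mul_of_nonneg_left (e5.trans (mul_le_mul_of_nonneg_left v6 hCa)) hC2
      refine g.trans ?_
      rw [show C2 * (Ca * (1 / (9 * (C2 * Ca + 1)))) = (C2 * Ca) / (9 * (C2 * Ca + 1)) by ring]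
      rw [div_le_iff₀ (by positivity)]; nlinarith [mul_nonneg hC2 hCa]
    have t8 := mul_le_mul_of_nonneg_right t7
      (NN_nonneg (k+1) (fun x => frag (A u) (B u) x - frag (A v) (B v) x))
    rw [NN_succ k (fun x => frag (A u) (B u) x - frag (A v) (B v) x)] at t8 e4
    have h3 : (1 + nrm 1 (frag (A u) (B u)))^(k+1) ≤ (9/8:ℝ)^(k+1) :=
      pow_le_pow_left₀ (by linarith [nrm_nonneg 1 (frag (A u) (B u))]) (by linarith [f.n1]) _
    have h4 := mul_le_mul_of_nonneg_left h3 (nrm_nonneg (k+1) (fun x => A u x - A v x))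
    have h5 := mul_le_mul_of_nonneg_right e1 (show (0:ℝ) ≤ (9/8)^(k+1) by positivity)
    have h6 := mul_le_mul_of_nonneg_left e6 hC1
    have n0 := nrm_nonneg (k+1) (fun x => u x - v x)
    set D := nrm (k+1) (fun x => u x - v x)
    set D0 := NN k (fun x => u x - v x)
    have g6 : (9/8)^(k+1) * (Ma * ρa^(k+1) * D) ≤ Ma * ρ^(k+1) * D := by
      have := mul_le_mul_of_nonneg_right (mul_le_mul_of_nonneg_left (P1 k) hMa) n0
      linarith
    have g7 : Mb * ρb^(k+1) * D ≤ Mb * ρ^(k+1) * D :=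
      mul_le_mul_of_nonneg_right (mul_le_mul_of_nonneg_left (P2 k) hMb) n0
    have g8 : 0 ≤ Ma * ρ^(k+1) * D := mul_nonneg (mul_nonneg hMa (P3 k)) n0
    have g9 : 0 ≤ Mb * ρ^(k+1) * D := mul_nonneg (mul_nonneg hMb (P3 k)) n0
    linarith
end

lemma SP_tsum {f : ℕ → ℝ → ℝ} (hf : ∀ i, SP (f i)) (hs : ∀ k, Summable fun i => nrm k (f i)) :
    SP (fun x => ∑' i, f i x) ∧ ∀ k, nrm k (fun x => ∑' i, f i x) ≤ ∑' i, nrm k (f i) := by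
  have hb : ∀ (k : ℕ) (i : ℕ) (x : ℝ), ‖iteratedFDeriv ℝ k (f i) x‖ ≤ nrm k (f i) := fun k i x => by
    rw [norm_iteratedFDeriv_eq_norm_iteratedDeriv]; exact (hf i).le k x
  refine ⟨⟨?_, fun x => by simp [(hf _).per]⟩, fun k => nrm_le fun x => ?_⟩
  · exact contDiff_tsum (N := ⊤) (v := fun k i => nrm k (f i)) (fun i => (hf i).smooth)
      (fun k _ => hs k) (fun k i x _ => hb k i x)
  · rw [← Real.norm_eq_abs, ← norm_iteratedFDeriv_eq_norm_iteratedDeriv,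
      iteratedFDeriv_tsum_apply (N := ⊤) (v := fun k i => nrm k (f i)) (fun i => (hf i).smooth)
      (fun k _ => hs k) (fun k i x _ => hb k i x) le_top]
    exact tsum_of_norm_bounded (hs k).hasSum fun i => hb k i x

lemma SP.sum {f : ℕ → ℝ → ℝ} (hf : ∀ i, SP (f i)) (n : ℕ) :
    SP (fun x => ∑ i ∈ Finset.range n, f i x) := by
  induction n with
  | zero => simpa using SP.const 0
  | succ n ih => simp only [Finset.sum_range_succ]; exact ih.add (hf n)

lemma SP_summable0 {f : ℕ → ℝ → ℝ} (hf : ∀ i, SP (f i)) (hs : Summable fun i => nrm 0 (f i)) (x : ℝ) :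
    Summable fun i => f i x :=
  Summable.of_norm_bounded hs fun i => (hf i).le0 x

lemma SP_tsum_tail {f : ℕ → ℝ → ℝ} (hf : ∀ i, SP (f i)) (hs : ∀ k, Summable fun i => nrm k (f i)) (k : ℕ) :
    Tendsto (fun n => NN k (fun x => (∑' i, f i x) - ∑ i ∈ Finset.range n, f i x)) atTop (𝓝 0) := by
  have h1 : ∀ n j, nrm j (fun x => (∑' i, f i x) - ∑ i ∈ Finset.range n, f i x)
      ≤ ∑' i, nrm j (f (i + n)) := fun n j => by
    have : (fun x => (∑' i, f i x) - ∑ i ∈ Finset.range n, f i x) = fun x => ∑' i, f (i + n) x := by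
      funext x; rw [← (SP_summable0 hf (hs 0) x).sum_add_tsum_nat_add n]; ring
    rw [this]
    exact (SP_tsum (fun i => hf (i + n)) fun k => (summable_nat_add_iff n).2 (hs k)).2 j
  have h2 : Tendsto (fun n => ∑ j ∈ Finset.range (k+1), ∑' i, nrm j (f (i + n))) atTop (𝓝 0) := by
    rw [show (0:ℝ) = ∑ j ∈ Finset.range (k+1), 0 by simp]
    exact tendsto_finsetSum _ fun j _ => tendsto_sum_nat_add (fun i => nrm j (f i))
  exact squeeze_zero (fun n => NN_nonneg _ _) (fun n => Finset.sum_le_sum fun j _ => h1 n j) h2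

lemma SP.lip {f : ℝ → ℝ} (hf : SP f) (x y : ℝ) : |f x - f y| ≤ nrm 1 f * |x - y| := by
  have := convex_univ.norm_image_sub_le_of_norm_deriv_le (f := f) (C := nrm 1 f) (s := univ)
    (fun z _ => hf.diffAt z) (fun z _ => hf.le1 z) (mem_univ y) (mem_univ x)
  simpa using this

lemma SP.lip_fract {f : ℝ → ℝ} (hf : SP f) (x y : ℝ) : |f x - f y| ≤ nrm 1 f := by
  have h1 : f x = f (y + Int.fract (x - y)) := by
    have := hf.per_int (y + Int.fract (x - y)) ⌊x - y⌋
    rw [← this]; congr 1; linarith [Int.fract_add_floor (x - y)]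
  rw [h1]
  refine (hf.lip _ _).trans ?_
  rw [add_sub_cancel_left, abs_of_nonneg (Int.fract_nonneg _)]
  exact mul_le_of_le_one_right (nrm_nonneg _ _) (Int.fract_lt_one _).le

lemma nrm_step {f : ℝ → ℝ} (hf : SP f) (k : ℕ) : nrm (k + 1) f ≤ nrm (k + 2) f := by
  obtain ⟨c, -, hc⟩ := exists_deriv_eq_zero (f := iteratedDeriv k f) (a := 0) (b := 1) one_pos
    (hf.iter k).smooth.continuous.continuousOn (by have := (hf.iter k).per 0; simp at this; exact this.symm)
  rw [← iteratedDeriv_succ] at hc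
  apply nrm_le; intro x
  have := (hf.iter (k+1)).lip_fract x c
  rw [hc, sub_zero] at this
  refine this.trans ?_
  simp only [nrm, iteratedDeriv_one, ← iteratedDeriv_succ]; exact le_rfl

lemma nrm0_le_zero {f : ℝ → ℝ} (hf : SP f) : nrm 0 f ≤ |f 0| + nrm 1 f :=
  nrm0_le fun x => by
    have h1 := hf.lip_fract x 0
    have h2 := abs_sub_abs_le_abs_sub (f x) (f 0); linarith

lemma nrm_mono {f : ℝ → ℝ} (hf : SP f) {j k : ℕ} (h1 : 1 ≤ j) (h : j ≤ k) : nrm j f ≤ nrm k f := by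
  induction k, h using Nat.le_induction with
  | base => exact le_rfl
  | succ k hk ih =>
    obtain ⟨m, rfl⟩ : ∃ m, k = m + 1 := ⟨k - 1, by omega⟩
    exact ih.trans (nrm_step hf m)

lemma NN_le_z {f : ℝ → ℝ} (hf : SP f) {s : ℕ} (h1 : 1 ≤ s) :
    NN s f ≤ (s + 1) * (|f 0| + nrm s f) := by
  have : ∀ j ∈ Finset.range (s+1), nrm j f ≤ |f 0| + nrm s f := fun j hj => by
    rcases Nat.eq_zero_or_pos j with rfl | h
    · exact (nrm0_le_zero hf).trans (add_le_add_right (nrm_mono hf le_rfl h1) _)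
    · have := nrm_mono hf h (Nat.lt_succ_iff.1 (Finset.mem_range.1 hj))
      linarith [abs_nonneg (f 0)]
  have := Finset.sum_le_card_nsmul _ _ _ this
  simpa [NN, mul_add] using this

lemma landau {f : ℝ → ℝ} (hf : SP f) (k : ℕ) {h : ℝ} (hh : 0 < h) :
    nrm (k + 1) f ≤ 2 * nrm k f / h + h * nrm (k + 2) f := by
  apply nrm_le; intro x
  have s0 := hf.iter k
  have s1 := hf.iter (k+1)
  obtain ⟨c, hc, he⟩ := exists_deriv_eq_slope (iteratedDeriv k f) (a := x) (b := x + h) (by linarith)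
    s0.smooth.continuous.continuousOn s0.diff.differentiableOn
  rw [← iteratedDeriv_succ, add_sub_cancel_left] at he
  have h1 := s1.lip x c
  have h2 : nrm 1 (iteratedDeriv (k+1) f) = nrm (k+2) f := by
    simp only [nrm, iteratedDeriv_one, ← iteratedDeriv_succ]
  rw [h2] at h1
  have h3 : |iteratedDeriv (k+1) f c| ≤ 2 * nrm k f / h := by
    rw [he, abs_div, abs_of_pos hh]
    gcongr
    have a1 := abs_le.1 (hf.le k (x+h)); have a2 := abs_le.1 (hf.le k x)
    rw [abs_le]; constructor <;> linarith
  have h4 : |x - c| ≤ h := by rw [abs_le]; constructor <;> linarith [hc.1, hc.2]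
  have h5 := mul_le_mul_of_nonneg_left h4 (nrm_nonneg (k+2) f)
  have h6 := abs_sub_abs_le_abs_sub (iteratedDeriv (k+1) f x) (iteratedDeriv (k+1) f c)
  linarith

/-- geometric decay of `C^0` norm and boundedness of all norms gives geometric decay of all norms -/
lemma geom_all {f : ℕ → ℝ → ℝ} (hf : ∀ i, SP (f i)) {C θ : ℝ} (hθ0 : 0 < θ) (hθ : θ < 1)
    (h0 : ∀ i, nrm 0 (f i) ≤ C * θ ^ i) (hB : ∀ k, ∃ B, ∀ i, nrm k (f i) ≤ B) (k : ℕ) :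
    ∃ C θ : ℝ, 0 < θ ∧ θ < 1 ∧ ∀ i, nrm k (f i) ≤ C * θ ^ i := by
  induction k with
  | zero => exact ⟨C, θ, hθ0, hθ, h0⟩
  | succ k ih =>
    obtain ⟨C, θ, hθ0, hθ, h⟩ := ih
    obtain ⟨B, hB⟩ := hB (k+2)
    refine ⟨2 * C + B, Real.sqrt θ, Real.sqrt_pos.2 hθ0, ?_, fun i => ?_⟩
    · rw [Real.sqrt_lt' one_pos]; simpa using hθ
    have hp : 0 < Real.sqrt θ ^ i := pow_pos (Real.sqrt_pos.2 hθ0) i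
    refine (landau (hf i) k hp).trans ?_
    have e : θ ^ i = Real.sqrt θ ^ i * Real.sqrt θ ^ i := by
      rw [← mul_pow, Real.mul_self_sqrt hθ0.le]
    have h1 := h i
    rw [e] at h1
    have h2 : 2 * nrm k (f i) / Real.sqrt θ ^ i ≤ 2 * C * Real.sqrt θ ^ i := by
      rw [div_le_iff₀ hp]; nlinarith
    have h3 := mul_le_mul_of_nonneg_left (hB i) hp.le
    linarith

def Gop (P : (ℝ → ℝ) → (ℝ → ℝ)) (w u : ℝ → ℝ) : ℝ → ℝ := fun x => P u x + w (x + P u x)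
def Tup (P : (ℝ → ℝ) → (ℝ → ℝ)) (w u : ℝ → ℝ) : ℝ → ℝ :=
  fun x => Gop P w u x + (4/3) * (u 0 - Gop P w u 0)

lemma nrm_add_const {f : ℝ → ℝ} (hf : SP f) (c : ℝ) (k : ℕ) :
    nrm (k+1) (fun x => f x + c) ≤ nrm (k+1) f := by
  have := nrm_add (k+1) hf (SP.const c)
  rwa [nrm_const, add_zero] at this

section
variable {d0 M ρ : ℝ} {P : (ℝ → ℝ) → (ℝ → ℝ)}

lemma Gop_sp (hP : Tame d0 P Sop M ρ) {w u : ℝ → ℝ} (hw : SP w) (hu : SP u) (h : NN 1 u ≤ d0) :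
    SP (Gop P w u) := (hP.sp u hu h).add (hw.comp (hP.sp u hu h))
lemma Tup_sp (hP : Tame d0 P Sop M ρ) {w u : ℝ → ℝ} (hw : SP w) (hu : SP u) (h : NN 1 u ≤ d0) :
    SP (Tup P w u) := (Gop_sp hP hw hu h).add (SP.const _)

/-- high norm estimate -/
lemma Tup_high (hP : Tame d0 P Sop M ρ) (k : ℕ) (hk : M * ρ ^ (k+1) ≤ 1/4) (B : ℝ) :
    ∃ C, 0 ≤ C ∧ ∀ w u, SP w → SP u → NN 1 u ≤ d0 → NN k u ≤ B → NN 1 w ≤ 1 →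
    nrm (k+1) (Tup P w u) ≤ (1/2) * nrm (k+1) u + C * (NN k u + NN (k+1) w) := by
  obtain ⟨C0, hC0, H0⟩ := hP.A0 k B
  obtain ⟨C0', hC0', H0'⟩ := hP.A0 1 d0
  obtain ⟨C2, hC2, H2⟩ := hP.A2 k B
  obtain ⟨C1, hC1, H1⟩ := (nrm_comp k).1 (C0 * B)
  set E := (1 + C0' * |d0|) ^ (k+1) with hE
  have hE0 : 0 ≤ E := by positivity
  refine ⟨2 * C2 + E + C1, by positivity, fun w u hw hu hu1 hu2 hw1 => ?_⟩
  have sP := hP.sp u hu hu1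
  have e0 : nrm (k+1) (Tup P w u) ≤ nrm (k+1) (P u) + nrm (k+1) (fun x => w (x + P u x)) :=
    (nrm_add_const (Gop_sp hP hw hu hu1) _ k).trans (nrm_add _ sP (hw.comp sP))
  have e1 := H1 w (P u) hw sP ((H0 u hu hu1 hu2).trans (mul_le_mul_of_nonneg_left hu2 hC0))
  have e2 := H2 u hu hu1 hu2
  have e3 : (1 + nrm 1 (P u)) ^ (k+1) ≤ E := by
    apply pow_le_pow_left₀ (by linarith [nrm_nonneg 1 (P u)])
    have a := (nrm_le_NN le_rfl (P u)).trans (H0' u hu hu1 hu1)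
    have b := mul_le_mul_of_nonneg_left (hu1.trans (le_abs_self d0)) hC0'
    linarith
  have e4 := mul_le_mul_of_nonneg_left e3 (nrm_nonneg (k+1) w)
  have n1 := nrm_nonneg (k+1) (P u)
  have e5 : nrm 1 w * nrm (k+1) (P u) ≤ 1 * nrm (k+1) (P u) :=
    mul_le_mul_of_nonneg_right ((nrm_le_NN le_rfl w).trans hw1) n1
  have e6 := mul_le_mul_of_nonneg_right hk (nrm_nonneg (k+1) u)
  have e7 : nrm (k+1) w * E ≤ NN (k+1) w * E := mul_le_mul_of_nonneg_right (nrm_le_NN le_rfl w) hE0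
  have e8 := mul_le_mul_of_nonneg_left (NN_mono (Nat.le_succ k) w) hC1
  have e9 : 0 ≤ (E + C1) * NN k u := mul_nonneg (by positivity) (NN_nonneg _ _)
  have e10 : 0 ≤ C2 * NN (k+1) w := mul_nonneg hC2 (NN_nonneg _ _)
  simp only [Nat.succ_eq_add_one] at e8
  linarith

def zz (s : ℕ) (f : ℝ → ℝ) : ℝ := |f 0| + nrm s f
lemma zz_nonneg (s : ℕ) (f : ℝ → ℝ) : 0 ≤ zz s f := add_nonneg (abs_nonneg _) (nrm_nonneg _ _)

set_option maxHeartbeats 1000000 in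
/-- contraction -/
lemma Tup_contr (hd0 : 0 < d0) (hP : Tame d0 P Sop M ρ) (s : ℕ) (hs : 4 ≤ s)
    (hM : M * ρ ^ (s+1) ≤ 1/4) :
    ∃ δ ε W : ℝ, 0 < δ ∧ 0 < ε ∧ 1 ≤ W ∧ δ ≤ d0 ∧ ∀ w u v, SP w → SP u → SP v →
      NN (s+2) w ≤ ε → NN (s+2) u ≤ δ → NN (s+2) v ≤ δ →
      W * zz s (fun x => Tup P w u x - Tup P w v x) + nrm (s+1) (fun x => Tup P w u x - Tup P w v x)
      ≤ 5/6 * (W * zz s (fun x => u x - v x) + nrm (s+1) (fun x => u x - v x)) := by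
  obtain ⟨dB1, CB1, hdB1, hCB1, HB1⟩ := hP.B1 s
  obtain ⟨dB2, CB2, hdB2, hCB2, HB2⟩ := hP.B2 s
  obtain ⟨dB0, CB0, hdB0, hCB0, HB0⟩ := hP.B0 (s+1)
  obtain ⟨CA, hCA, HA⟩ := hP.A0 (s+1) d0
  obtain ⟨C3, hC3, H3⟩ := NN_comp_sub (s+1) (CA * d0)
  set K : ℝ := s + 2 with hK
  have hK0 : 0 < K := by positivity
  set W : ℝ := 8 * (CB2 * K + 1) with hW
  have hW1 : 1 ≤ W := by have : 0 ≤ CB2 * K := by positivity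
                         linarith
  -- smallness parameter
  set κ : ℝ := 1 / (16 * W * K) with hκ
  have hκ0 : 0 < κ := by positivity
  refine ⟨min (min dB1 dB2) (min dB0 (min d0 (κ / (4 * (CB1 + 1))))), κ / (2 * (C3 * CB0 + 1)), W,
    by positivity, by positivity, hW1, (min_le_right _ _).trans ((min_le_right _ _).trans
      (min_le_left _ _)), fun w u v hw hu hv hwε hu2 hv2 => ?_⟩
  simp only [le_min_iff] at hu2 hv2
  obtain ⟨⟨u1, u2⟩, u3, u4, u5⟩ := hu2
  obtain ⟨⟨v1, v2⟩, v3, v4, v5⟩ := hv2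
  have m1 : ∀ u, NN 1 u ≤ NN (s+2) u := fun u => NN_mono (by omega) u
  have m2 : ∀ u, NN (s+1) u ≤ NN (s+2) u := fun u => NN_mono (by omega) u
  have hu1 := (m1 u).trans u4; have hv1 := (m1 v).trans v4
  have sPu := hP.sp u hu hu1; have sPv := hP.sp v hv hv1
  have bd : ∀ u, SP u → NN (s+2) u ≤ d0 → NN (s+1) (P u) ≤ CA * d0 := fun u hu h =>
    (HA u hu ((m1 u).trans h) ((m2 u).trans h)).trans
      (mul_le_mul_of_nonneg_left ((m2 u).trans h) hCA)
  have e1 := HB1 u v hu hv hu1 hv1 u1 v1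
  have e2 := HB2 u v hu hv hu1 hv1 u2 v2
  have e3 := HB0 u v hu hv hu1 hv1 u3 v3
  have e4 := H3 w (P u) (P v) hw sPu sPv (bd u hu u4) (bd v hv v4)
  set e : ℝ → ℝ := fun x => u x - v x with he
  have se : SP e := hu.sub hv
  set Ew : ℝ → ℝ := fun x => w (x + P u x) - w (x + P v x) with hEw
  have sEw : SP Ew := (hw.comp sPu).sub (hw.comp sPv)
  set E1 : ℝ → ℝ := fun x => P u x - P v x - Sop e x with hE1
  have sE1 : SP E1 := (sPu.sub sPv).sub (Sop_sp se)
  set N := NN (s+1) e with hN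
  have hN0 : 0 ≤ N := NN_nonneg _ _
  -- bounds on errors
  have b1 : NN (s+1) Ew ≤ κ/2 * N := by
    have a1 : NN (s+2) w * NN (s+1) (fun x => P u x - P v x)
        ≤ (κ / (2 * (C3 * CB0 + 1))) * (CB0 * N) :=
      mul_le_mul hwε e3 (NN_nonneg _ _) (by positivity)
    have a2 := mul_le_mul_of_nonneg_left a1 hC3
    have a3 : C3 * ((κ / (2 * (C3 * CB0 + 1))) * (CB0 * N)) ≤ κ/2 * N := by
      have : C3 * ((κ / (2 * (C3 * CB0 + 1))) * (CB0 * N)) =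
        (κ/2 * N) * ((C3 * CB0) / (C3 * CB0 + 1)) := by field_simp
      rw [this]
      apply mul_le_of_le_one_right (by positivity)
      rw [div_le_one (by positivity)]; linarith
    exact e4.trans (a2.trans a3)
  have b2 : NN s E1 ≤ κ/2 * N := by
    have a1 : CB1 * (NN (s+1) u + NN (s+1) v) ≤ κ/2 := by
      have : CB1 * (NN (s+1) u + NN (s+1) v) ≤ CB1 * (κ / (4 * (CB1+1)) + κ / (4 * (CB1+1))) :=
        mul_le_mul_of_nonneg_left (add_le_add ((m2 u).trans u5) ((m2 v).trans v5)) hCB1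
      refine this.trans ?_
      have : CB1 * (κ / (4 * (CB1+1)) + κ / (4 * (CB1+1))) = κ/2 * (CB1 / (CB1+1)) := by
        field_simp; ring
      rw [this]
      apply mul_le_of_le_one_right (by positivity)
      rw [div_le_one (by positivity)]; linarith
    exact e1.trans (mul_le_mul_of_nonneg_right a1 hN0)
  have b3 : NN s Ew ≤ κ/2 * N := (NN_mono (Nat.le_succ s) _).trans b1
  have gsub : ∀ x, Gop P w u x - Gop P w v x = (Sop e x + E1 x) + Ew x := fun x => by
    simp only [Gop, hE1, hEw]; ring
  set c : ℝ := (4/3) * (u 0 - Gop P w u 0) - (4/3) * (v 0 - Gop P w v 0) with hc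
  have teq : (fun x => Tup P w u x - Tup P w v x) = fun x => ((Sop e x + E1 x) + Ew x) + c := by
    funext x; simp only [Tup, hc]; linarith [gsub x]
  have sS := Sop_sp se
  have sG := (sS.add sE1).add sEw
  obtain ⟨s', rfl⟩ : ∃ s', s = s' + 1 := ⟨s - 1, by omega⟩
  rw [teq]
  -- value at zero
  have z0 : |Sop e 0 + E1 0 + Ew 0 + c| ≤ (1/3) * nrm 1 e + κ/2 * N := by
    have a0 : Sop e 0 + E1 0 + Ew 0 + c = (2/3) * (e 0 - e (1/2)) - (1/3) * (E1 0 + Ew 0) := by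
      have := gsub 0
      have h5 : Sop e 0 = 2 * (e 0 + e (1/2)) := by simp [Sop]
      rw [h5] at this
      rw [hc, h5]; simp only [he] at this ⊢; linarith
    rw [a0]
    have a1 := abs_le.1 (se.lip 0 (1/2))
    rw [show |(0:ℝ) - 1/2| = 1/2 by rw [abs_of_nonpos] <;> norm_num] at a1
    have a2 := abs_le.1 ((sE1.le0 0).trans ((nrm_le_NN (Nat.zero_le _) _).trans b2))
    have a3 := abs_le.1 ((sEw.le0 0).trans ((nrm_le_NN (Nat.zero_le _) _).trans b3))
    have : 0 ≤ κ * N := by positivity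
    rw [abs_le]; constructor <;> linarith
  have z1 : nrm (s'+1) (fun x => Sop e x + E1 x + Ew x + c) ≤ (1/4) * nrm (s'+1) e + κ * N := by
    refine (nrm_add_const sG c s').trans ?_
    refine (nrm_add _ (sS.add sE1) sEw).trans ?_
    have a1 := nrm_add (s'+1) sS sE1
    have a2 := Sop_nrm (s'+1) se
    have a3 : (1/2:ℝ)^(s'+1) ≤ (1/2)^4 := pow_le_pow_of_le_one (by norm_num) (by norm_num) hs
    have a4 := mul_le_mul_of_nonneg_right a3 (nrm_nonneg (s'+1) e)
    have a5 := (nrm_le_NN le_rfl E1).trans b2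
    have a6 := (nrm_le_NN le_rfl Ew).trans b3
    norm_num at a4
    linarith
  have z2 : nrm (s'+1+1) (fun x => Sop e x + E1 x + Ew x + c) ≤
      (1/4) * nrm (s'+1+1) e + CB2 * NN (s'+1) e + κ/2 * N := by
    refine (nrm_add_const sG c (s'+1)).trans ?_
    refine (nrm_add _ (sS.add sE1) sEw).trans ?_
    have a1 : (fun x => Sop e x + E1 x) = fun x => P u x - P v x := by
      funext x; simp only [hE1]; ring
    rw [a1]
    have a2 := (nrm_le_NN le_rfl Ew).trans b1
    have a3 := mul_le_mul_of_nonneg_right hM (nrm_nonneg (s'+1+1) e)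
    linarith
  have z3 : NN (s'+1) e ≤ K * zz (s'+1) e := by
    have := NN_le_z se (s := s'+1) (by omega)
    refine this.trans (mul_le_mul_of_nonneg_right ?_ (zz_nonneg _ _))
    rw [hK]; push_cast; linarith
  have z4 : N ≤ K * (zz (s'+1) e + nrm (s'+1+1) e) := by
    have := NN_le_z se (s := s'+1+1) (by omega)
    refine this.trans ?_
    rw [hK]; push_cast
    have e5 : |e 0| ≤ zz (s'+1) e := by unfold zz; linarith [nrm_nonneg (s'+1) e]
    have e6 : (0:ℝ) ≤ (s':ℝ) := by positivity
    have e8 : |e 0| + nrm (s'+1+1) e ≤ zz (s'+1) e + nrm (s'+1+1) e := by linarith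
    refine le_trans (le_of_eq ?_) (mul_le_mul_of_nonneg_left e8 (by linarith))
    ring
  have z5 : nrm 1 e ≤ nrm (s'+1) e := nrm_mono se le_rfl (by omega)
  set z := zz (s'+1) e with hz
  set n := nrm (s'+1+1) e with hn
  have hz0 : 0 ≤ z := zz_nonneg _ _
  have hn0 : 0 ≤ n := nrm_nonneg _ _
  have z6 : zz (s'+1) (fun x => Sop e x + E1 x + Ew x + c) ≤ (7/12) * z + (3/2) * (κ * N) := by
    have : nrm (s'+1) e ≤ z := by rw [hz]; unfold zz; linarith [abs_nonneg (e 0)]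
    unfold zz; linarith
  have z7 : W * (κ * N) ≤ (1/16) * (z + n) := by
    have : W * (κ * N) ≤ W * (κ * (K * (z + n))) := by gcongr
    refine this.trans (le_of_eq ?_)
    rw [hκ]; field_simp
  have z8 : κ * N ≤ W * (κ * N) := le_mul_of_one_le_left (by positivity) hW1
  have z9 := mul_le_mul_of_nonneg_left z6 (show 0 ≤ W by linarith)
  have z10 : CB2 * NN (s'+1) e ≤ (W/8) * z := by
    have : CB2 * NN (s'+1) e ≤ CB2 * (K * z) := mul_le_mul_of_nonneg_left z3 hCB2
    rw [hW]; linarith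
  have z11 : z ≤ W * z := le_mul_of_one_le_left hz0 hW1
  linarith
end

def YY (W : ℝ) (s : ℕ) (f : ℝ → ℝ) : ℝ := W * zz s f + nrm (s+1) f

lemma YY_add {W : ℝ} (hW : 0 ≤ W) (s : ℕ) {f g : ℝ → ℝ} (hf : SP f) (hg : SP g) :
    YY W s (fun x => f x + g x) ≤ YY W s f + YY W s g := by
  unfold YY zz
  have h1 := nrm_add s hf hg; have h2 := nrm_add (s+1) hf hg; have h3 := abs_add_le (f 0) (g 0)
  nlinarith
lemma YY_le_NN {W : ℝ} (hW : 0 ≤ W) (s : ℕ) {f : ℝ → ℝ} (hf : SP f) :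
    YY W s f ≤ (2 * W + 1) * NN (s+1) f := by
  unfold YY zz
  have h1 := nrm_le_NN (Nat.le_succ s) f; have h2 := nrm_le_NN (le_refl (s+1)) f
  have h3 := (hf.le0 0).trans (nrm_le_NN (Nat.zero_le (s+1)) f)
  simp only [Nat.succ_eq_add_one] at h1
  nlinarith
lemma NN_le_YY {W : ℝ} (hW : 1 ≤ W) (s : ℕ) {f : ℝ → ℝ} (hf : SP f) :
    NN (s+1) f ≤ (s + 2) * YY W s f := by
  have := NN_le_z hf (s := s+1) (by omega)
  refine this.trans ?_
  push_cast
  rw [show (s:ℝ)+1+1 = s+2 by ring]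
  apply mul_le_mul_of_nonneg_left _ (by positivity)
  unfold YY
  have h1 : |f 0| ≤ zz s f := by unfold zz; linarith [nrm_nonneg s f]
  have h2 : zz s f ≤ W * zz s f := le_mul_of_one_le_left (zz_nonneg _ _) hW
  linarith

lemma geom_bound {a : ℕ → ℝ} {K : ℝ} (hK : 0 ≤ K) (h0 : a 0 ≤ 0)
    (h : ∀ l, a (l+1) ≤ (1/2) * a l + K) (l : ℕ) : a l ≤ 2 * K := by
  induction l with
  | zero => linarith
  | succ l ih => linarith [h l]

set_option maxHeartbeats 1000000 in
theorem FP {d0 M ρ : ℝ} {P : (ℝ → ℝ) → (ℝ → ℝ)} (hd0 : 0 < d0) (hP : Tame d0 P Sop M ρ)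
    (hρ0 : 0 ≤ ρ) (hρ : ρ < 1) :
    ∃ (r : ℕ) (ε : ℝ) (C : ℕ → ℝ), 0 < ε ∧ ∀ w, SP w → NN r w ≤ ε →
      ∃ u, SP u ∧ NN 1 u ≤ d0 ∧ (∀ x, u x = P u x + w (x + P u x)) ∧
        ∀ k, NN (r + k) w ≤ 1 → NN (r + k) u ≤ C k * NN (r + k) w := by
  obtain ⟨s, hs4, hs⟩ : ∃ s : ℕ, 4 ≤ s ∧ ∀ k, s ≤ k → M * ρ ^ k ≤ 1/4 := by
    have h1 : Tendsto (fun k : ℕ => M * ρ ^ k) atTop (𝓝 (M * 0)) :=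
      (tendsto_pow_atTop_nhds_zero_of_lt_one hρ0 hρ).const_mul M
    rw [mul_zero] at h1
    obtain ⟨N, hN⟩ := eventually_atTop.1 (h1.eventually (gt_mem_nhds (show (0:ℝ) < 1/4 by norm_num)))
    exact ⟨max 4 N, le_max_left _ _, fun k hk => (hN k ((le_max_right _ _).trans hk)).le⟩
  obtain ⟨δ, ε0, W, hδ, hε0, hW, hδd, hcon⟩ := Tup_contr hd0 hP s hs4 (hs _ (by omega))
  have hW0 : 0 ≤ W := by linarith
  obtain ⟨C1, hC1, H1⟩ := Tup_high hP (s+1) (hs _ (by omega)) δ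
  have hz1 : ∀ k, NN k (fun _ : ℝ => (0:ℝ)) = 0 := fun k => by rw [NN_const]; simp
  have hP0 : ∀ x, P (fun _ => 0) x = 0 := fun x => by
    obtain ⟨C, _, HC⟩ := hP.A0 0 0
    have h1 := HC _ (SP.const 0) (by rw [hz1]; exact hd0.le) (by rw [hz1])
    rw [hz1, mul_zero, NN_zero] at h1
    have h2 := (hP.sp _ (SP.const 0) (by rw [hz1]; exact hd0.le)).le0 x
    exact abs_eq_zero.1 (le_antisymm (h2.trans h1) (abs_nonneg _))
  set C0 : ℝ := (2 * W + 1) * (7/3) with hC0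
  have hC00 : 0 ≤ C0 := by positivity
  have T0 : ∀ w, SP w → YY W s (Tup P w (fun _ => 0)) ≤ C0 * NN (s+2) w := fun w hw => by
    have e : Tup P w (fun _ => 0) = fun x => w x + (-(4/3) * w 0) := by
      funext x; simp only [Tup, Gop, hP0]; simp
    rw [e]
    refine (YY_le_NN hW0 s (hw.add (SP.const _))).trans ?_
    rw [hC0, mul_assoc]
    apply mul_le_mul_of_nonneg_left _ (by positivity)
    have h1 := NN_add (s+1) hw (SP.const (-(4/3) * w 0))
    rw [NN_const, abs_mul] at h1
    have h2 := (hw.le0 0).trans (nrm_le_NN (Nat.zero_le (s+1)) w)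
    have h3 : NN (s+1) w ≤ NN (s+2) w := NN_mono (by omega) w
    rw [show |(-(4/3:ℝ))| = 4/3 by rw [abs_neg]; exact abs_of_pos (by norm_num)] at h1
    linarith
  set cy : ℝ := 6 * C0
  set cn : ℝ := 2 * (C1 * ((s+2) * cy) + C1)
  set cN : ℝ := (s+2) * cy + cn
  have hcy : 0 ≤ cy := by positivity
  have hcn : 0 ≤ cn := by positivity
  have hcN : 0 ≤ cN := by positivity
  set ε : ℝ := min ε0 (min 1 (δ / (cN + 1))) with hε
  have hεp : 0 < ε := by positivity
  -- invariant set
  let Inv : (ℝ → ℝ) → (ℝ → ℝ) → Prop := fun w u =>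
    SP u ∧ YY W s u ≤ cy * NN (s+2) w ∧ nrm (s+2) u ≤ cn * NN (s+2) w
  have InvN : ∀ w u, NN (s+2) w ≤ ε → Inv w u → NN (s+2) u ≤ cN * NN (s+2) w ∧ NN (s+2) u ≤ δ := by
    rintro w u hw ⟨hu, h1, h2⟩
    have h3 := NN_le_YY hW s hu
    have h4 := mul_le_mul_of_nonneg_left h1 (show (0:ℝ) ≤ s+2 by positivity)
    have h5 : NN (s+2) u ≤ cN * NN (s+2) w := by rw [NN_succ]; simp only [cN]; linarith
    refine ⟨h5, h5.trans ?_⟩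
    have h6 : NN (s+2) w ≤ δ / (cN + 1) := hw.trans ((min_le_right _ _).trans (min_le_right _ _))
    have h7 := mul_le_mul_of_nonneg_left h6 hcN
    refine h7.trans ?_
    rw [← mul_div_assoc, div_le_iff₀ (by positivity)]; linarith
  have Inv0 : ∀ w, Inv w (fun _ => 0) := fun w => by
    have n0 := NN_nonneg (s+2) w
    refine ⟨SP.const 0, ?_, ?_⟩
    · have := YY_le_NN hW0 s (SP.const 0)
      rw [hz1, mul_zero] at this; exact this.trans (by positivity)
    · rw [nrm_const]; positivity
  have InvT : ∀ w u, SP w → NN (s+2) w ≤ ε → Inv w u → Inv w (Tup P w u) := by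
    rintro w u hw hwε hI
    obtain ⟨hN1, hNδ⟩ := InvN w u hwε hI
    obtain ⟨hu, h1, h2⟩ := hI
    have n0 := NN_nonneg (s+2) w
    have hu1 : NN 1 u ≤ d0 := (NN_mono (by omega) u).trans (hNδ.trans hδd)
    have sT := Tup_sp hP hw hu hu1
    have sT0 := Tup_sp hP hw (SP.const 0) (by rw [hz1]; exact hd0.le)
    refine ⟨sT, ?_, ?_⟩
    · have h3 := hcon w u (fun _ => 0) hw hu (SP.const 0) (hwε.trans (min_le_left _ _)) hNδ
        (by rw [hz1]; exact hδ.le)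
      simp only [sub_zero] at h3
      have h4 := YY_add hW0 s (sT.sub sT0) sT0
      simp only [sub_add_cancel] at h4
      have h5 := T0 w hw
      have h6 : YY W s (fun x => Tup P w u x - Tup P w (fun _ => 0) x) ≤ 5/6 * YY W s u := h3
      have h7 : YY W s (Tup P w u) ≤ 5/6 * YY W s u + C0 * NN (s+2) w := by
        refine le_trans h4 (add_le_add h6 h5)
      simp only [cy] at h1 ⊢; linarith
    · have h3 := H1 w u hw hu hu1 ((NN_mono (by omega) u).trans hNδ)
        ((NN_mono (by omega) w).trans (hwε.trans ((min_le_right _ _).trans (min_le_left _ _))))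
      have h4 := NN_le_YY hW s hu
      have h5 := mul_le_mul_of_nonneg_left (h4.trans
        (mul_le_mul_of_nonneg_left h1 (show (0:ℝ) ≤ s+2 by positivity))) hC1
      simp only [cn] at h2 ⊢
      linarith
  let U : (ℝ → ℝ) → ℕ → (ℝ → ℝ) := fun w l => (Tup P w)^[l] (fun _ => 0)
  have U0 : ∀ w, U w 0 = fun _ => 0 := fun w => rfl
  have US : ∀ w l, U w (l+1) = Tup P w (U w l) := fun w l => Function.iterate_succ_apply' _ _ _
  have UInv : ∀ w, SP w → NN (s+2) w ≤ ε → ∀ l, Inv w (U w l) := fun w hw hwε l => by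
    induction l with
    | zero => exact Inv0 w
    | succ l ih => rw [US]; exact InvT w _ hw hwε ih
  have high : ∀ k (B : ℝ), ∃ C, 0 ≤ C ∧ ∀ w, SP w → NN (s+2) w ≤ ε → NN (s+2+k) w ≤ B → ∀ l,
      NN (s+2+k) (U w l) ≤ C * NN (s+2+k) w := fun k => by
    induction k with
    | zero => exact fun B => ⟨cN, hcN, fun w hw hwε _ l => (InvN w _ hwε (UInv w hw hwε l)).1⟩
    | succ k ih =>
      intro B
      obtain ⟨C, hC, H⟩ := ih B
      obtain ⟨C', hC', H'⟩ := Tup_high hP (s+2+k) (hs _ (by omega)) (C * B)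
      refine ⟨C + 2 * (C' * (C + 1)), by positivity, fun w hw hwε hB l => ?_⟩
      have m1 : NN (s+2+k) w ≤ NN (s+2+(k+1)) w := NN_mono (by omega) w
      have n0 := NN_nonneg (s+2+(k+1)) w
      have g1 : ∀ l, NN (s+2+k) (U w l) ≤ C * NN (s+2+(k+1)) w := fun l =>
        (H w hw hwε (m1.trans hB) l).trans (mul_le_mul_of_nonneg_left m1 hC)
      have g2 : ∀ l, nrm (s+2+k+1) (U w l) ≤ 2 * (C' * (C * NN (s+2+(k+1)) w + NN (s+2+(k+1)) w)) := by
        apply geom_bound (by positivity)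
        · rw [U0, nrm_const]
        · intro l
          have hI := UInv w hw hwε l
          have hu1 : NN 1 (U w l) ≤ d0 := (NN_mono (by omega) _).trans ((InvN w _ hwε hI).2.trans hδd)
          have := H' w (U w l) hw hI.1 hu1 ((g1 l).trans (mul_le_mul_of_nonneg_left hB hC))
            ((NN_mono (by omega) w).trans (hwε.trans ((min_le_right _ _).trans (min_le_left _ _))))
          rw [US]
          refine this.trans (add_le_add_right (mul_le_mul_of_nonneg_left ?_ hC') _)
          exact add_le_add_left (g1 l) _
      have g3 := NN_succ (s+2+k) (U w l)
      have g4 := g1 l; have g5 := g2 l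
      rw [show s+2+(k+1) = s+2+k+1 by ring] at *
      rw [g3]; linarith
  choose! CC hCC0 hCC using fun k => high k 1
  refine ⟨s+2, ε, CC, hεp, fun w hw hwε => ?_⟩
  have hI := UInv w hw hwε
  have sU : ∀ l, SP (U w l) := fun l => (hI l).1
  let Δ : ℕ → ℝ → ℝ := fun l x => U w (l+1) x - U w l x
  have sΔ : ∀ l, SP (Δ l) := fun l => (sU _).sub (sU _)
  have hcon' : ∀ u v, SP u → SP v → NN (s+2) u ≤ δ → NN (s+2) v ≤ δ →
      YY W s (fun x => Tup P w u x - Tup P w v x) ≤ 5/6 * YY W s (fun x => u x - v x) :=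
    fun u v hu hv h1 h2 => hcon w u v hw hu hv (hwε.trans (min_le_left _ _)) h1 h2
  have Ub : ∀ l, NN (s+2) (U w l) ≤ δ := fun l => (InvN w _ hwε (hI l)).2
  have geo : ∀ l, YY W s (Δ l) ≤ YY W s (Δ 0) * (5/6)^l := fun l => by
    induction l with
    | zero => simp
    | succ l ih =>
      have := hcon' (U w (l+1)) (U w l) (sU _) (sU _) (Ub _) (Ub _)
      rw [← US, ← US] at this
      have h2 : YY W s (Δ (l+1)) ≤ 5/6 * YY W s (Δ l) := this
      rw [pow_succ]; linarith
  have bdd : ∀ k, ∃ B, ∀ i, nrm k (Δ i) ≤ B := fun k => by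
    obtain ⟨C, hC, H⟩ := high k (NN (s+2+k) w)
    refine ⟨C * NN (s+2+k) w + C * NN (s+2+k) w, fun i => ?_⟩
    have h1 := fun i => (nrm_le_NN (show k ≤ s+2+k by omega) _).trans (H w hw hwε le_rfl i)
    exact (nrm_sub k (sU _) (sU _)).trans (add_le_add (h1 _) (h1 _))
  have sumb : ∀ k, Summable fun i => nrm k (Δ i) := fun k => by
    obtain ⟨C, θ, hθ0, hθ, h⟩ := geom_all sΔ (C := (s+2) * YY W s (Δ 0)) (θ := 5/6) (by norm_num)
      (by norm_num) (fun i => by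
        have h1 := (nrm_le_NN (Nat.zero_le _) _).trans (NN_le_YY hW s (sΔ i))
        have h2 := mul_le_mul_of_nonneg_left (geo i) (show (0:ℝ) ≤ s+2 by positivity)
        linarith) bdd k
    exact Summable.of_nonneg_of_le (fun i => nrm_nonneg _ _) h
      ((summable_geometric_of_lt_one hθ0.le hθ).mul_left C)
  set u : ℝ → ℝ := fun x => ∑' i, Δ i x with hu
  have su : SP u := (SP_tsum sΔ sumb).1
  have tele : ∀ n x, ∑ i ∈ Finset.range n, Δ i x = U w n x := fun n x => by
    have := Finset.sum_range_sub (fun i => U w i x) n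
    simp only [U0, sub_zero] at this; exact this
  have conv : ∀ k, Tendsto (fun n => NN k (fun x => u x - U w n x)) atTop (𝓝 0) := fun k => by
    have := SP_tsum_tail sΔ sumb k
    simp only [tele] at this; exact this
  have lim : ∀ k b, (∀ l, NN k (U w l) ≤ b) → NN k u ≤ b := fun k b hb => by
    have h1 : ∀ n, NN k u - NN k (fun x => u x - U w n x) ≤ b := fun n => by
      have := NN_add k (su.sub (sU n)) (sU n)
      simp only [sub_add_cancel] at this
      linarith [hb n]
    have h2 := (conv k).const_sub (NN k u)
    rw [sub_zero] at h2
    exact le_of_tendsto h2 (Eventually.of_forall h1)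
  have ub : NN (s+2) u ≤ δ := lim _ _ Ub
  have ud : NN 1 u ≤ d0 := (NN_mono (by omega) u).trans (ub.trans hδd)
  have fix : ∀ x, Tup P w u x = u x := fun x => by
    have sT := Tup_sp hP hw su ud
    have h1 : ∀ n, |Tup P w u x - u x| ≤ (s+2) * (5/6 * ((2*W+1) * NN (s+1) (fun x => u x - U w n x)))
        + NN (s+1) (fun x => u x - U w (n+1) x) := fun n => by
      have a1 := hcon' u (U w n) su (sU n) ub (Ub n)
      rw [← US] at a1
      have s1 := sT.sub (sU (n+1))
      have a2 := (s1.le0 x).trans ((nrm_le_NN (Nat.zero_le _) _).trans (NN_le_YY hW s s1))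
      have a3 := ((su.sub (sU (n+1))).le0 x).trans (nrm_le_NN (Nat.zero_le (s+1)) _)
      have a4 := a1.trans (mul_le_mul_of_nonneg_left (YY_le_NN hW0 s (su.sub (sU n)))
        (show (0:ℝ) ≤ 5/6 by norm_num))
      have a5 := mul_le_mul_of_nonneg_left a4 (show (0:ℝ) ≤ s+2 by positivity)
      have a6 := abs_sub_le (Tup P w u x) (U w (n+1) x) (u x)
      rw [abs_sub_comm (U w (n+1) x)] at a6
      linarith
    have h2 : Tendsto (fun n => (s+2) * (5/6 * ((2*W+1) * NN (s+1) (fun x => u x - U w n x)))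
        + NN (s+1) (fun x => u x - U w (n+1) x)) atTop (𝓝 ((s+2) * (5/6 * ((2*W+1) * 0)) + 0)) :=
      ((((conv (s+1)).const_mul _).const_mul _).const_mul _).add
        ((conv (s+1)).comp (tendsto_add_atTop_nat 1))
    have h3 := ge_of_tendsto h2 (Eventually.of_forall h1)
    simp only [mul_zero, add_zero] at h3
    exact sub_eq_zero.1 (abs_eq_zero.1 (le_antisymm h3 (abs_nonneg _)))
  refine ⟨u, su, ud, fun x => ?_, fun k hk => lim _ _ (hCC k w hw hwε hk)⟩
  have f0 := fix 0; have fx := fix x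
  simp only [Tup] at f0 fx
  have : u 0 = Gop P w u 0 := by linarith
  rw [this] at fx
  simp only [Gop] at fx ⊢; linarith

lemma tame_zero (d0 : ℝ) {ρ : ℝ} : Tame d0 (fun _ _ => (0:ℝ)) (fun _ _ => (0:ℝ)) 0 ρ where
  sp u hu _ := SP.const 0
  Lsp u hu := SP.const 0
  A0 k B := ⟨0, le_rfl, fun u hu _ _ => by rw [NN_const]; simp⟩
  A2 k B := ⟨0, le_rfl, fun u hu _ _ => by
    have := nrm_le_NN (le_refl (k+1)) (fun _ : ℝ => (0:ℝ)); rw [NN_const] at this; simpa using this⟩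
  B0 k := ⟨1, 0, one_pos, le_rfl, fun u v hu hv _ _ _ _ => by simp only [sub_zero]; rw [NN_const]; simp⟩
  B1 k := ⟨1, 0, one_pos, le_rfl, fun u v hu hv _ _ _ _ => by simp only [sub_zero]; rw [NN_const]; simp⟩
  B2 k := ⟨1, 0, one_pos, le_rfl, fun u v hu hv _ _ _ _ => by
    have := nrm_le_NN (le_refl (k+1)) (fun _ : ℝ => (0:ℝ)); rw [NN_const] at this; simpa using this⟩

/-- the map `id + a` -/
def DD (a : ℝ → ℝ) : ℝ → ℝ := fun x => x + a x

lemma frag_ninv {p b m R : ℝ → ℝ} (h1 : FR p (fun _ => 0) m) (h2 : FR m b R) (x : ℝ) :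
    R x = b x + p (x + b x) := by
  have e1 := h1.eq (x + R x)
  have e2 := h2.eq x
  have e3 : x + R x + m (x + R x) = x + b x := by linarith
  rw [e3] at e1; linarith

theorem frag_main {η1 η2 : ℝ → ℝ} (h1 : SP η1) (h2 : SP η2) :
    ∃ (r : ℕ) (ε : ℝ) (C : ℕ → ℝ), 0 < ε ∧ ∀ w, SP w → NN r w ≤ ε → ∃ u q1 q2 q3 : ℝ → ℝ,
      SP u ∧ (SP q1 ∧ SP q2 ∧ SP q3) ∧ (nrm 1 q1 ≤ 1/8 ∧ nrm 1 q2 ≤ 1/8 ∧ nrm 1 q3 ≤ 1/8) ∧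
      nrm 1 (fun x => η1 x * u x) ≤ 1/8 ∧ nrm 1 (fun x => η2 x * u x) ≤ 1/8 ∧
      (∀ x, q1 x = η1 x * u x) ∧
      (∀ x, q2 x = η2 x * u x - η1 (x + q2 x) * u (x + q2 x)) ∧
      (∀ x, q3 x = u x - η2 (x + q3 x) * u (x + q3 x)) ∧
      (∀ x, DD u x = DD w (DD (Sop q1) (DD (Sop q2) (DD (Sop q3) x)))) ∧
      ∀ k, NN (r+k) w ≤ 1 → NN (r+k) q1 ≤ C k * NN (r+k) w ∧ NN (r+k) q2 ≤ C k * NN (r+k) w ∧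
        NN (r+k) q3 ≤ C k * NN (r+k) w := by
  have t1 := tame_mul h1 1
  have t2 := tame_mul h2 1
  have t3 := tame_mul (SP.const 1) 1
  have n1 := nrm_nonneg 0 η1
  have n2 := nrm_nonneg 0 η2
  have n3 := nrm_nonneg 0 (fun _ : ℝ => (1:ℝ))
  obtain ⟨d2, hd2, hd2', s2, F2⟩ := frag_tame (ρ := 9/8) one_pos t1 t2 n1 n2 (by norm_num) (by norm_num) (by norm_num) (by norm_num)
  obtain ⟨d3, hd3, hd3', s3, F3⟩ := frag_tame (ρ := 9/8) hd2 (t2.shrink hd2') (t3.shrink hd2') n2 n3 (by norm_num) (by norm_num) (by norm_num) (by norm_num)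
  have p1 := (t1.shrink (hd3'.trans hd2')).Sop
  have p2 := (s2.shrink hd3').Sop
  have p3 := s3.Sop
  obtain ⟨d4, hd4, hd4', i1, G1⟩ := frag_tame (ρ := 81/128) hd3 p1 (tame_zero d3 (ρ := 0)) (by positivity) le_rfl (by norm_num) (by norm_num) (by norm_num) (by norm_num)
  obtain ⟨d5, hd5, hd5', i2, G2⟩ := frag_tame (ρ := 81/128) hd4 (p2.shrink hd4') (tame_zero d4 (ρ := 0)) (by positivity) le_rfl (by norm_num) (by norm_num) (by norm_num) (by norm_num)
  obtain ⟨d6, hd6, hd6', j2, K2⟩ := frag_tame (ρ := 729/1024) hd5 i2 (p3.shrink (hd5'.trans hd4')) (by positivity) (by positivity) (by norm_num) (by norm_num) (by norm_num) (by norm_num)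
  obtain ⟨d7, hd7, hd7', j1, K1⟩ := frag_tame (ρ := 729/1024) hd6 (i1.shrink (hd6'.trans hd5')) j2 (by positivity) (by positivity) (by norm_num) (by norm_num) (by norm_num) (by norm_num)
  have j := j1.congrL (L' := Sop) (fun u x => by simp only [Sop]; ring)
  obtain ⟨r, ε, C, hε, H⟩ := FP hd7 j (by norm_num) (by norm_num)
  have A1 := fun k => (t1.A0 (r+k) |C k|)
  have A2 := fun k => (s2.A0 (r+k) |C k|)
  have A3 := fun k => (s3.A0 (r+k) |C k|)
  choose C1 hC1 A1 using A1
  choose C2 hC2 A2 using A2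
  choose C3 hC3 A3 using A3
  refine ⟨r, ε, fun k => (C1 k + C2 k + C3 k) * |C k|, hε, fun w hw hwε => ?_⟩
  obtain ⟨u, hu, hu1, hfix, hb⟩ := H w hw hwε
  have l6 := hu1.trans hd7'
  have l5 := l6.trans hd6'
  have l4 := l5.trans hd5'
  have l3 := l4.trans hd4'
  have l2 := l3.trans hd3'
  have f2 := F2 u hu l2
  have f3 := F3 u hu l3
  have g1 := G1 u hu l4
  have g2 := G2 u hu l5
  have k2 := K2 u hu l6
  have k1 := K1 u hu hu1
  refine ⟨u, _, _, _, hu, ⟨f2.ha, f2.hR, f3.hR⟩, ⟨f2.na.trans (by norm_num), f2.n1, f3.n1⟩,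
    f2.na.trans (by norm_num), f2.nb.trans (by norm_num), fun x => rfl, f2.eq, fun x => ?_, fun x => ?_, fun k hk => ?_⟩
  · have := f3.eq x; simpa using this
  · have e1 := frag_ninv g2 k2 x
    have e2 := frag_ninv g1 k1 x
    have e3 := hfix x
    simp only [DD]
    rw [e3, e2, e1]
    simp only [add_assoc]
  · have hn := NN_nonneg (r+k) w
    have hu' : NN (r+k) u ≤ |C k| * NN (r+k) w := (hb k hk).trans (mul_le_mul_of_nonneg_right (le_abs_self _) hn)
    have hB : NN (r+k) u ≤ |C k| := hu'.trans (mul_le_of_le_one_right (abs_nonneg _) hk)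
    have ha := mul_nonneg (abs_nonneg (C k)) hn
    have a1 := A1 k u hu (l2.trans hd2') hB
    have a2 := A2 k u hu l2 hB
    have a3 := A3 k u hu l3 hB
    have b1 := mul_le_mul_of_nonneg_left hu' (hC1 k)
    have b2 := mul_le_mul_of_nonneg_left hu' (hC2 k)
    have b3 := mul_le_mul_of_nonneg_left hu' (hC3 k)
    have c1 := mul_nonneg (hC1 k) ha
    have c2 := mul_nonneg (hC2 k) ha
    have c3 := mul_nonneg (hC3 k) ha
    have ee : (C1 k + C2 k + C3 k) * |C k| * NN (r+k) w = C1 k * (|C k| * NN (r+k) w) + C2 k * (|C k| * NN (r+k) w)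
      + C3 k * (|C k| * NN (r+k) w) := by ring
    simp only [ee]
    refine ⟨?_, ?_, ?_⟩ <;> linarith

/-- group of lifts -/
def LFG : Subgroup (Equiv.Perm ℝ) where
  carrier := {e | LF (e : ℝ → ℝ)}
  mul_mem' {a b} ha hb := by
    have := LF.comp (F := a) (G := b) ha hb
    exact this
  one_mem' := LF.id
  inv_mem' {a} ha := by
    obtain ⟨G, hG, h1, h2⟩ := LF.exists_inv (F := a) ha
    have : ((a⁻¹ : Equiv.Perm ℝ) : ℝ → ℝ) = G := by
      funext x
      apply a.injective
      rw [h1]; simp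
    show LF _
    rw [this]; exact hG

lemma mkL_ex {F : ℝ → ℝ} (h : LF F) : ∃ e : LFG, ∀ x, e.1 x = F x := by
  obtain ⟨G, hG, h1, h2⟩ := h.exists_inv
  exact ⟨⟨⟨F, G, h2, h1⟩, h⟩, fun x => rfl⟩

def mkL {F : ℝ → ℝ} (h : LF F) : LFG := (mkL_ex h).choose
lemma mkL_apply {F : ℝ → ℝ} (h : LF F) (x : ℝ) : (mkL h).1 x = F x := (mkL_ex h).choose_spec x

lemma lfg (e : LFG) : LF (fun x => e.1 x) := e.2
lemma lext {a b : LFG} (h : ∀ x, a.1 x = b.1 x) : a = b := Subtype.ext (Equiv.ext h)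
@[simp] lemma lmul (a b : LFG) (x : ℝ) : (a * b).1 x = a.1 (b.1 x) := rfl
@[simp] lemma lone (x : ℝ) : (1 : LFG).1 x = x := rfl
@[simp] lemma linv1 (a : LFG) (x : ℝ) : (a⁻¹).1 (a.1 x) = x := by
  show (a⁻¹ * a).1 x = x
  simp only [inv_mul_cancel]; rfl
@[simp] lemma linv2 (a : LFG) (x : ℝ) : a.1 ((a⁻¹).1 x) = x := by
  show (a * a⁻¹).1 x = x
  simp only [mul_inv_cancel]; rfl
lemma lint (a : LFG) (x : ℝ) (n : ℤ) : a.1 (x + n) = a.1 x + n := (lfg a).per_int x n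
lemma linj (a : LFG) {x y : ℝ} (h : a.1 x = a.1 y) : x = y := a.1.injective h

lemma toS_per (a : LFG) : Function.Periodic (fun x => ((a.1 x : ℝ) : S1)) 1 := fun x => by
  have := lint a x 1
  simp only [Int.cast_one] at this
  simp only [this]
  exact AddCircle.coe_add_period 1 _

def toS0 (a : LFG) : S1 → S1 := (toS_per a).lift
lemma toS0_coe (a : LFG) (x : ℝ) : toS0 a (x : S1) = ((a.1 x : ℝ) : S1) := rfl
lemma toS0_mul (a b : LFG) (z : S1) : toS0 (a * b) z = toS0 a (toS0 b z) := by
  induction z using QuotientAddGroup.induction_on with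
  | H x => rfl
lemma toS0_one (z : S1) : toS0 1 z = z := by
  induction z using QuotientAddGroup.induction_on with
  | H x => rfl

def toS : LFG →* Equiv.Perm S1 where
  toFun a := ⟨toS0 a, toS0 a⁻¹, fun z => by rw [← toS0_mul, inv_mul_cancel, toS0_one],
    fun z => by rw [← toS0_mul, mul_inv_cancel, toS0_one]⟩
  map_one' := Equiv.ext toS0_one
  map_mul' a b := Equiv.ext (toS0_mul a b)

lemma toS_coe (a : LFG) (x : ℝ) : toS a (x : S1) = ((a.1 x : ℝ) : S1) := rfl

lemma toS_HasLift (a : LFG) : HasLift (toS a) :=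
  ⟨fun x => a.1 x, (lfg a).smooth, (lfg a).per, (lfg a).pos, fun x => rfl⟩

lemma toS_of_lift {f : Equiv.Perm S1} {F : ℝ → ℝ} (h : IsLift f F) (hF : LF F) : toS (mkL hF) = f := by
  apply Equiv.ext
  intro z
  induction z using QuotientAddGroup.induction_on with
  | H x =>
    have h1 := toS_coe (mkL hF) x
    rw [mkL_apply] at h1
    exact h1.trans (h.2.2.2 x).symm

lemma IsLift.lf {f : Equiv.Perm S1} {F : ℝ → ℝ} (h : IsLift f F) : LF F := ⟨h.1, h.2.1, h.2.2.1⟩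

/-- sequences with word length linear in the index -/
def Sh (h : ℕ → LFG) : Prop :=
  ∃ S : Set LFG, S.Finite ∧ ∃ c : ℕ, ∀ m, ∃ l : List LFG, l.length ≤ c * (m + 1) ∧
    (∀ x ∈ l, x ∈ S ∨ x⁻¹ ∈ S) ∧ l.prod = h m

lemma Sh.const (g : LFG) : Sh (fun _ => g) :=
  ⟨{g}, Set.finite_singleton g, 1, fun m => ⟨[g], by simp, by simp, by simp⟩⟩

lemma Sh.pow (g : LFG) : Sh (fun m => g ^ m) :=
  ⟨{g}, Set.finite_singleton g, 1, fun m => ⟨List.replicate m g, by simp, by simp, by simp⟩⟩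

lemma Sh.mul {a b : ℕ → LFG} (ha : Sh a) (hb : Sh b) : Sh (fun m => a m * b m) := by
  obtain ⟨S, hS, c, H⟩ := ha
  obtain ⟨S', hS', c', H'⟩ := hb
  refine ⟨S ∪ S', hS.union hS', c + c', fun m => ?_⟩
  obtain ⟨l, h1, h2, h3⟩ := H m
  obtain ⟨l', h1', h2', h3'⟩ := H' m
  refine ⟨l ++ l', by rw [List.length_append, add_mul]; omega, fun x hx => ?_, by rw [List.prod_append, h3, h3']⟩
  rcases List.mem_append.1 hx with hx | hx
  · exact (h2 x hx).imp (Or.inl) (Or.inl)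
  · exact (h2' x hx).imp (Or.inr) (Or.inr)

lemma Sh.inv {a : ℕ → LFG} (ha : Sh a) : Sh (fun m => (a m)⁻¹) := by
  obtain ⟨S, hS, c, H⟩ := ha
  refine ⟨S, hS, c, fun m => ?_⟩
  obtain ⟨l, h1, h2, h3⟩ := H m
  refine ⟨(l.map (fun x => x⁻¹)).reverse, by simpa using h1, fun x hx => ?_, by rw [← List.prod_inv_reverse, h3]⟩
  simp only [List.mem_reverse, List.mem_map] at hx
  obtain ⟨y, hy, rfl⟩ := hx
  rw [inv_inv]
  exact (h2 y hy).symm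

/-- periodic closed arcs on the line -/
def arc (a b : ℝ) : Set ℝ := {x | ∃ n : ℤ, a ≤ x - n ∧ x - n ≤ b}

def Sup (e : LFG) (A : Set ℝ) : Prop := ∀ x, x ∉ A → e.1 x = x

lemma Sup.inv {e : LFG} {A : Set ℝ} (h : Sup e A) : Sup e⁻¹ A := fun x hx => by
  have := linv1 e x
  rwa [h x hx] at this
lemma Sup.mul {e e' : LFG} {A : Set ℝ} (h : Sup e A) (h' : Sup e' A) : Sup (e * e') A := fun x hx => by
  rw [lmul, h' x hx, h x hx]
lemma Sup.mono {e : LFG} {A B : Set ℝ} (h : Sup e A) (hAB : A ⊆ B) : Sup e B := fun x hx => h x fun hx' => hx (hAB hx')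
lemma Sup.mem {e : LFG} {A : Set ℝ} (h : Sup e A) {x : ℝ} (hx : x ∈ A) : e.1 x ∈ A := by
  by_contra hc
  have := h _ hc
  have := linj e this
  rw [this] at hc; exact hc hx
lemma arc_sub {a b a' b' : ℝ} (n : ℤ) (h1 : a' ≤ a + n) (h2 : b + n ≤ b') : arc a b ⊆ arc a' b' := by
  rintro x ⟨m, h3, h4⟩
  refine ⟨m - n, ?_, ?_⟩ <;> push_cast <;> linarith

lemma conj_eq {φ W y : LFG} {A : Set ℝ} (hφ : Sup φ A) (hy : Sup y A) (hW : ∀ x ∈ A, W.1 x = φ.1 x) :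
    W * y * W⁻¹ = φ * y * φ⁻¹ := by
  apply lext
  intro z
  simp only [lmul]
  by_cases hz : z ∈ A
  · have h1 := hφ.inv.mem hz
    have h2 : (W⁻¹).1 z = (φ⁻¹).1 z := by
      apply linj W
      rw [linv2, hW _ h1, linv2]
    rw [h2]
    exact hW _ (hy.mem h1)
  · have h1 : (W⁻¹).1 z ∉ A := fun h => by
      have := hW _ h
      rw [linv2] at this
      rw [this] at hz
      exact hz (hφ.mem h)
    rw [hy _ h1, linv2, hφ.inv _ hz, hy _ hz, hφ _ hz]


def disp (e : LFG) : ℝ → ℝ := fun x => e.1 x - x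
lemma disp_sp (e : LFG) : SP (disp e) := (lfg e).sp
lemma ap_disp (e : LFG) (x : ℝ) : e.1 x = x + disp e x := by simp [disp]

lemma conj_cont (s : LFG) (K : ℕ) : ∃ C, 0 ≤ C ∧ ∀ φ : LFG, NN K (disp φ) ≤ 1 →
    NN K (disp (s * φ * s⁻¹)) ≤ C * NN K (disp φ) := by
  obtain ⟨C1, hC1, H1⟩ := NN_comp_sub K 1
  obtain ⟨C2, hC2, H2⟩ := NN_comp K (NN K (disp s⁻¹))
  have n1 := NN_nonneg (K+1) (disp s)
  refine ⟨C2 * (1 + C1 * NN (K+1) (disp s)), by positivity, fun φ hφ => ?_⟩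
  set a := disp φ
  set c := disp s
  have ha : SP a := disp_sp φ
  have hc : SP c := disp_sp s
  have hb := disp_sp s⁻¹
  have z0 : NN K (fun _ : ℝ => (0:ℝ)) ≤ 1 := by rw [NN_const]; simp
  have h1 := H1 c a (fun _ => 0) hc ha (SP.const 0) hφ z0
  simp only [add_zero, sub_zero] at h1
  have hg : SP (fun z => c (z + a z) - c z) := (hc.comp ha).sub hc
  have h2 := NN_add K ha hg
  have h3 := H2 _ _ (ha.add hg) hb le_rfl
  have e : disp (s * φ * s⁻¹) = fun x => a (x + disp s⁻¹ x) + (c (x + disp s⁻¹ x + a (x + disp s⁻¹ x)) - c (x + disp s⁻¹ x)) := by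
    funext y
    simp only [disp, lmul, a, c]
    simp only [add_sub_cancel, linv2]
    ring
  rw [e]
  refine h3.trans ?_
  rw [mul_assoc]
  apply mul_le_mul_of_nonneg_left _ hC2
  refine h2.trans ?_
  have : NN K a = NN K (fun x => a x) := rfl
  linarith

/-- the extraction argument, abstractly -/
lemma extract_abs {σ : LFG} {k a b : ℝ} (hka : k < a) (hab : a < b) (hbk : b < k + 1) (hσ : b < σ.1 a) (hσk : σ.1 (k+1) = k + 1)
    {φ : ℕ → LFG} (hφ : ∀ m, Sup (φ m) (arc a b))
    (hsm : ∀ m, NN (m+1) (disp (σ^m * φ m * (σ^m)⁻¹)) ≤ (1/2)^(m+2)) :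
    ∃ W : ℕ → LFG, Sh W ∧ ∀ m, ∀ x ∈ arc a b, (W m).1 x = (φ m).1 x := by
  set D : ℕ → ℝ → ℝ := fun m => disp (σ^m * φ m * (σ^m)⁻¹) with hD
  have hDs : ∀ m, SP (D m) := fun m => disp_sp _
  have hgs : Summable (fun m : ℕ => ((1:ℝ)/2)^(m+2)) := by
    simp_rw [pow_add]
    exact (summable_geometric_of_lt_one (by norm_num) (by norm_num)).mul_right _
  have hsum : ∀ k, Summable fun m => nrm k (D m) := fun k => by
    rw [← summable_nat_add_iff k]
    refine Summable.of_nonneg_of_le (fun m => nrm_nonneg _ _) (fun m => ?_) ((summable_nat_add_iff k).2 hgs)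
    exact (nrm_le_NN (by omega) _).trans (hsm (m + k))
  obtain ⟨hT, hTn⟩ := SP_tsum hDs hsum
  have h1 : nrm 1 (fun x => ∑' m, D m x) ≤ 1/2 := by
    refine (hTn 1).trans ?_
    have : ∑' m : ℕ, ((1:ℝ)/2)^(m+2) = 1/2 := by
      simp_rw [pow_add]
      rw [tsum_mul_right, tsum_geometric_of_lt_one (by norm_num) (by norm_num)]; norm_num
    rw [← this]
    exact (hsum 1).tsum_le_tsum (fun m => (nrm_le_NN (by omega) _).trans (hsm m)) hgs
  set Ah := mkL (LF_of_nrm hT h1)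
  have monoσ : ∀ m, StrictMono (fun x => (σ^m).1 x) := fun m => (lfg (σ^m)).mono
  have hk1 : ∀ m : ℕ, (σ^m).1 (k+1) = k+1 := fun m => by
    induction m with
    | zero => rfl
    | succ m ih => rw [pow_succ, lmul, hσk, ih]
  have hsuc : ∀ m : ℕ, (σ^m).1 b < (σ^(m+1)).1 a := fun m => by
    rw [pow_succ, lmul]; exact monoσ m hσ
  have hlt : ∀ j d : ℕ, (σ^j).1 b < (σ^(j+d+1)).1 a := fun j d => by
    induction d with
    | zero => exact hsuc j
    | succ d ih => exact ih.trans ((monoσ (j+d+1) hab).trans (hsuc (j+d+1)))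
  have hge : ∀ j : ℕ, a ≤ (σ^j).1 a := fun j => by
    rcases j with _ | j
    · exact le_rfl
    · have := hlt 0 j
      simp only [pow_zero, lone, zero_add] at this
      linarith
  have hdis : ∀ j m : ℕ, j < m → ∀ x ∈ arc a b, ∀ y ∈ arc a b, (σ^j).1 x ≠ (σ^m).1 y := by
    rintro j m hjm x ⟨n, hx1, hx2⟩ y ⟨n', hy1, hy2⟩ he
    obtain ⟨d, rfl⟩ : ∃ d, m = j + d + 1 := ⟨m - j - 1, by omega⟩
    have e1 := lint (σ^j) (x - n) n
    have e2 := lint (σ^(j+d+1)) (y - n') n'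
    rw [sub_add_cancel] at e1 e2
    have f1 := (monoσ j).monotone hx1
    have f2 := (monoσ j).monotone hx2
    have f3 := (monoσ (j+d+1)).monotone hy1
    have f4 := (monoσ (j+d+1)).monotone (hy2.trans hbk.le)
    have f4' := (monoσ (j+d+1)) (lt_of_le_of_lt hy2 hbk)
    have f5 := hlt j d
    have f6 := hge j
    have f7 := hk1 (j+d+1)
    simp only at f1 f2 f3 f4 f4'
    have g1 : (0:ℝ) < ((n - n' : ℤ) : ℝ) := by push_cast; linarith
    have g2 : ((n - n' : ℤ) : ℝ) < 1 := by push_cast; linarith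
    have g1' : (0:ℤ) < n - n' := by exact_mod_cast g1
    have g2' : n - n' < (1:ℤ) := by exact_mod_cast g2
    omega
  refine ⟨fun m => (σ^m)⁻¹ * Ah * σ^m, ((Sh.pow σ).inv.mul (Sh.const Ah)).mul (Sh.pow σ), fun m x hx => ?_⟩
  have hz : ∀ j, j ≠ m → D j ((σ^m).1 x) = 0 := fun j hj => by
    simp only [hD, disp, lmul]
    have : ((σ^j)⁻¹).1 ((σ^m).1 x) ∉ arc a b := fun hc => by
      have e : (σ^j).1 (((σ^j)⁻¹).1 ((σ^m).1 x)) = (σ^m).1 x := linv2 _ _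
      rcases lt_or_gt_of_ne hj with h | h
      · exact hdis j m h _ hc _ hx e
      · exact hdis m j h _ hx _ hc e.symm
    rw [hφ j _ this, linv2, sub_self]
  simp only [lmul]
  apply linj (σ^m)
  rw [linv2, mkL_apply, tsum_eq_single m hz]
  simp only [hD, disp, lmul, linv1]
  ring

def kap : ℝ := 1/50

def tauF : ℝ → ℝ := fun x => x + (1/8) * Real.sin (Real.pi * x) ^ 2

lemma tau_LF : LF tauF := by
  have hd : ∀ x, HasDerivAt tauF (1 + (1/8) * (2 * Real.sin (Real.pi * x) * (Real.cos (Real.pi * x) * Real.pi))) x := fun x => by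
    have h1 : HasDerivAt (fun x => Real.pi * x) Real.pi x := by simpa using (hasDerivAt_id x).const_mul Real.pi
    have h2 := (h1.sin.pow 2).const_mul (1/8 : ℝ)
    have := (hasDerivAt_id x).add h2
    exact HasDerivAt.congr_deriv (f := tauF) this (by norm_num)
  refine ⟨?_, fun x => ?_, fun x => ?_⟩
  · unfold tauF; fun_prop
  · unfold tauF
    rw [mul_add, mul_one, Real.sin_add_pi]; ring
  · rw [(hd x).deriv]
    have hp := Real.pi_lt_four
    have hp0 := Real.pi_pos
    have h1 : |2 * Real.sin (Real.pi * x) * Real.cos (Real.pi * x)| ≤ 1 := by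
      rw [← Real.sin_two_mul]; exact Real.abs_sin_le_one _
    have h2 := abs_le.1 h1
    nlinarith [h2.1]

lemma tau_iter {k a b : ℝ} (hka : k < a) (hab : a < b) (hbk : b < k + 1) :
    ∃ σ : LFG, b < σ.1 a ∧ σ.1 (k+1) = k + 1 := by
  have hsh : LF (fun x => k + tauF (x - k)) := by
    have h1 : LF (fun x => x - k) := ⟨by fun_prop, fun x => by ring, fun x => by simp⟩
    have h2 : LF (fun x => k + x) := ⟨by fun_prop, fun x => by ring, fun x => by simp⟩
    exact h2.comp (tau_LF.comp h1)
  set σ := mkL hsh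
  have hσ : ∀ x, σ.1 x = x + (1/8) * Real.sin (Real.pi * (x - k)) ^ 2 := fun x => by
    rw [mkL_apply]; simp only [tauF]; ring
  have hk : σ.1 (k+1) = k+1 := by rw [hσ]; simp
  have hkp : ∀ n : ℕ, (σ^n).1 (k+1) = k+1 := fun m => by
    induction m with
    | zero => rfl
    | succ m ih => rw [pow_succ, lmul, hk, ih]
  -- uniform progress on `[a,b]`
  obtain ⟨x0, hx0, hmin⟩ := (isCompact_Icc (a := a) (b := b)).exists_isMinOn (nonempty_Icc.2 hab.le)
    (f := fun x => (1/8) * Real.sin (Real.pi * (x - k)) ^ 2) (by fun_prop)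
  set δ := (1/8) * Real.sin (Real.pi * (x0 - k)) ^ 2 with hδ
  have hδp : 0 < δ := by
    have : 0 < Real.sin (Real.pi * (x0 - k)) := by
      apply Real.sin_pos_of_pos_of_lt_pi
      · exact mul_pos Real.pi_pos (by linarith [hx0.1])
      · have : x0 - k < 1 := by linarith [hx0.2]
        nlinarith [Real.pi_pos]
    positivity
  have hstep : ∀ x, a ≤ x → x ≤ b → x + δ ≤ σ.1 x := fun x h1 h2 => by
    rw [hσ]; have := hmin (show x ∈ Icc a b from ⟨h1, h2⟩); simp only [mem_ofPred_eq] at this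
    linarith
  by_contra hcon
  push Not at hcon
  have hle : ∀ n : ℕ, (σ^n).1 a ≤ b := fun n => by
    by_contra h
    exact hcon (σ^n) (not_le.1 h) (hkp n)
  have hgr : ∀ n : ℕ, a + n * δ ≤ (σ^n).1 a := fun n => by
    induction n with
    | zero => simp
    | succ n ih =>
      have h1 : a ≤ (σ^n).1 a := le_trans (by linarith [mul_nonneg (Nat.cast_nonneg (α := ℝ) n) hδp.le]) ih
      have := hstep _ h1 (hle n)
      rw [pow_succ', lmul, Nat.cast_succ]; linarith
  obtain ⟨n, hn⟩ := exists_nat_gt ((b - a) / δ)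
  rw [div_lt_iff₀ hδp] at hn
  linarith [hgr n, hle n]

/-- the domain of extraction at `k` -/
def AA (k : ℝ) : Set ℝ := arc (k + kap) (k + 1 - kap)

lemma extract (k : ℝ) : ∃ (K : ℕ → ℕ) (δ : ℕ → ℝ), (∀ m, 0 < δ m) ∧ ∀ φ : ℕ → LFG,
    (∀ m, Sup (φ m) (AA k)) → (∀ m, NN (K m) (disp (φ m)) ≤ δ m) →
    ∃ W : ℕ → LFG, Sh W ∧ ∀ m, ∀ x ∈ AA k, (W m).1 x = (φ m).1 x := by
  have hk : kap = 1/50 := rfl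
  obtain ⟨σ, h1, h2⟩ := tau_iter (k := k) (a := k + kap) (b := k + 1 - kap) (by linarith) (by linarith) (by linarith)
  choose C hC H using fun m : ℕ => conj_cont (σ^m) (m+1)
  refine ⟨fun m => m + 1, fun m => min 1 ((1/2)^(m+2) / (C m + 1)), fun m => ?_, fun φ hφ hs => ?_⟩
  · have := hC m; positivity
  · refine extract_abs (by linarith) (by linarith) (by linarith) h1 h2 hφ (fun m => ?_)
    refine (H m (φ m) ((hs m).trans (min_le_left _ _))).trans ?_
    have hc := hC m
    have := (hs m).trans (min_le_right _ _)
    rw [le_div_iff₀ (by positivity)] at this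
    have := NN_nonneg (m+1) (disp (φ m))
    nlinarith


lemma periodize {d : ℝ → ℝ} (hd : ContDiff ℝ (⊤ : ℕ∞) d) {α a b : ℝ} (ha : α < a) (hb : b < α + 1)
    (hs : ∀ x, x < a ∨ b < x → d x = 0) :
    ∃ P, SP P ∧ (∀ x (n : ℤ), α ≤ x → x < α + 1 → P (x + n) = d x) ∧ ∀ x, ∃ y, deriv P x = deriv d y := by
  set P : ℝ → ℝ := fun x => d (α + Int.fract (x - α)) with hP
  have hPv : ∀ x (n : ℤ), α ≤ x → x < α + 1 → P (x + n) = d x := fun x n h1 h2 => by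
    simp only [hP]
    rw [show x + n - α = (x - α) + n by ring, Int.fract_add_intCast, Int.fract_eq_self.2 ⟨by linarith, by linarith⟩]
    congr 1; ring
  have hloc : ∀ x, ∃ n : ℤ, P =ᶠ[𝓝 x] fun y => d (y - n) := fun x => by
    refine ⟨⌊x - α⌋, ?_⟩
    set n := ⌊x - α⌋
    have h1 := Int.floor_le (x - α)
    have h2 := Int.lt_floor_add_one (x - α)
    set τ := min 1 (α + 1 - b)
    have hτ : 0 < τ := lt_min one_pos (by linarith)
    have hτ1 : τ ≤ 1 := min_le_left _ _
    have hτ2 : τ ≤ α + 1 - b := min_le_right _ _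
    filter_upwards [Ioo_mem_nhds (show α + n - τ < x by linarith) (show x < α + n + 1 by linarith)] with y hy
    rcases le_or_gt (α + n) y with h | h
    · have := hPv (y - n) n (by linarith) (by linarith [hy.2])
      rwa [sub_add_cancel] at this
    · have := hPv (y - n + 1) (n - 1) (by linarith [hy.1]) (by linarith [hy.2])
      push_cast at this
      rw [show y - n + 1 + (n - 1 : ℝ) = y by ring] at this
      rw [this, hs _ (Or.inr (by linarith [hy.1])), hs _ (Or.inl (by linarith))]
  refine ⟨P, ⟨?_, fun x => ?_⟩, hPv, fun x => ?_⟩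
  · rw [contDiff_iff_contDiffAt]
    intro x
    obtain ⟨n, hn⟩ := hloc x
    exact ContDiffAt.congr_of_eventuallyEq (by fun_prop) hn
  · simp only [hP]
    rw [show x + 1 - α = (x - α) + 1 by ring, Int.fract_add_one]
  · obtain ⟨n, hn⟩ := hloc x
    refine ⟨x - n, ?_⟩
    rw [hn.deriv_eq, deriv_comp_sub_const]

lemma interp {a b p q : ℝ} (hab : a < b) (hp : 0 < p) (hT : a < p * b + q) :
    ∃ T : ℝ → ℝ, ContDiff ℝ (⊤ : ℕ∞) T ∧ (∀ x, 0 < deriv T x) ∧ (∀ x, x ≤ a → T x = x) ∧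
      ∀ x, b ≤ x → T x = p * x + q := by
  set T0 := p * b + q - a with hT0
  have hT0p : 0 < T0 := by linarith
  set τ := min ((b - a) / 3) (T0 / (2 * (1 + p))) with hτ
  have hτp : 0 < τ := lt_min (by linarith) (by positivity)
  have hτ1 : τ ≤ (b - a) / 3 := min_le_left _ _
  have hτ2 : (1 + p) * τ ≤ T0 / 2 := by
    have := min_le_right ((b - a) / 3) (T0 / (2 * (1 + p)))
    rw [← hτ, le_div_iff₀ (by positivity)] at this; linarith
  set s1 : ℝ → ℝ := fun t => Real.smoothTransition ((t - a) / τ) with hs1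
  set s2 : ℝ → ℝ := fun t => Real.smoothTransition ((t - (b - τ)) / τ) with hs2
  have c1 : ContDiff ℝ (⊤ : ℕ∞) s1 := Real.smoothTransition.contDiff.comp (by fun_prop)
  have c2 : ContDiff ℝ (⊤ : ℕ∞) s2 := Real.smoothTransition.contDiff.comp (by fun_prop)
  have k1 := c1.continuous
  have k2 := c2.continuous
  have s1n : ∀ t, 0 ≤ s1 t := fun t => Real.smoothTransition.nonneg _
  have s2n : ∀ t, 0 ≤ s2 t := fun t => Real.smoothTransition.nonneg _
  have s1l : ∀ t, s1 t ≤ 1 := fun t => Real.smoothTransition.le_one _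
  have s2l : ∀ t, s2 t ≤ 1 := fun t => Real.smoothTransition.le_one _
  have s1z : ∀ t, t ≤ a → s1 t = 0 := fun t ht =>
    Real.smoothTransition.zero_of_nonpos (div_nonpos_of_nonpos_of_nonneg (by linarith) hτp.le)
  have s2z : ∀ t, t ≤ b - τ → s2 t = 0 := fun t ht =>
    Real.smoothTransition.zero_of_nonpos (div_nonpos_of_nonpos_of_nonneg (by linarith) hτp.le)
  have s1o : ∀ t, a + τ ≤ t → s1 t = 1 := fun t ht =>
    Real.smoothTransition.one_of_one_le (by rw [le_div_iff₀ hτp]; linarith)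
  have s2o : ∀ t, b ≤ t → s2 t = 1 := fun t ht =>
    Real.smoothTransition.one_of_one_le (by rw [le_div_iff₀ hτp]; linarith)
  have ii : ∀ {f : ℝ → ℝ} (_ : Continuous f) (u v : ℝ), IntervalIntegrable f MeasureTheory.volume u v :=
    fun hf u v => hf.intervalIntegrable u v
  have I1 : ∫ t in a..b, (1 - s1 t) ≤ τ := by
    have kk : Continuous (fun t => 1 - s1 t) := by fun_prop
    rw [← intervalIntegral.integral_add_adjacent_intervals (ii kk a (a+τ)) (ii kk (a+τ) b)]
    have e1 : ∫ t in (a+τ)..b, (1 - s1 t) = 0 := by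
      rw [intervalIntegral.integral_congr (g := fun _ => 0)]
      · simp
      · intro t ht
        rw [uIcc_of_le (by linarith)] at ht
        simp only; rw [s1o t ht.1, sub_self]
    have e2 : ∫ t in a..(a+τ), (1 - s1 t) ≤ ∫ t in a..(a+τ), (1:ℝ) :=
      intervalIntegral.integral_mono_on (by linarith) (ii kk _ _) (ii continuous_const _ _) (fun t _ => by linarith [s1n t])
    rw [intervalIntegral.integral_const] at e2
    simp at e2
    linarith
  have I2 : ∫ t in a..b, s2 t ≤ τ := by
    rw [← intervalIntegral.integral_add_adjacent_intervals (ii k2 a (b-τ)) (ii k2 (b-τ) b)]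
    have e1 : ∫ t in a..(b-τ), s2 t = 0 := by
      rw [intervalIntegral.integral_congr (g := fun _ => 0)]
      · simp
      · intro t ht
        rw [uIcc_of_le (by linarith)] at ht
        simp only; rw [s2z t ht.2]
    have e2 : ∫ t in (b-τ)..b, s2 t ≤ ∫ t in (b-τ)..b, (1:ℝ) :=
      intervalIntegral.integral_mono_on (by linarith) (ii k2 _ _) (ii continuous_const _ _) (fun t _ => s2l t)
    rw [intervalIntegral.integral_const] at e2
    simp at e2
    linarith
  have I3 : 0 < ∫ t in a..b, s1 t * (1 - s2 t) := by
    refine intervalIntegral.integral_pos hab (by fun_prop) (fun t _ => mul_nonneg (s1n t) (by linarith [s2l t]))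
      ⟨(a+b)/2, ⟨by linarith, by linarith⟩, ?_⟩
    rw [s1o _ (by linarith), s2z _ (by linarith)]; norm_num
  set J1 := ∫ t in a..b, (1 - s1 t)
  set J2 := ∫ t in a..b, s2 t
  set J3 := ∫ t in a..b, s1 t * (1 - s2 t)
  set θ := (T0 - J1 - p * J2) / J3 with hθ
  have hθp : 0 < θ := by
    apply div_pos _ I3
    have := mul_le_mul_of_nonneg_left I2 hp.le
    linarith
  set ρ : ℝ → ℝ := fun t => (1 - s1 t) + p * s2 t + θ * (s1 t * (1 - s2 t)) with hρ
  have cρ : ContDiff ℝ (⊤ : ℕ∞) ρ := by fun_prop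
  have kρ := cρ.continuous
  have hρp : ∀ t, 0 < ρ t := fun t => by
    simp only [hρ]
    rcases le_or_gt t (b - τ) with h | h
    · rw [s2z t h]
      rcases (s1n t).eq_or_lt with h0 | h0
      · rw [← h0]; norm_num
      · have := s1l t
        have := mul_pos hθp h0
        linarith
    · rw [s1o t (by linarith)]
      rcases (s2n t).eq_or_lt with h0 | h0
      · rw [← h0]; linarith
      · have := mul_pos hp h0
        have := mul_nonneg hθp.le (by linarith [s2l t] : 0 ≤ 1 - s2 t)
        linarith
  set T : ℝ → ℝ := fun x => a + ∫ t in a..x, ρ t with hTd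
  have hder : ∀ x, HasDerivAt T (ρ x) x := fun x =>
    ((kρ.integral_hasStrictDerivAt a x).hasDerivAt).const_add a
  have hderiv : deriv T = ρ := funext fun x => (hder x).deriv
  have hTb : T b = p * b + q := by
    have : ∫ t in a..b, ρ t = J1 + p * J2 + θ * J3 := by
      have ka : Continuous (fun t => 1 - s1 t) := by fun_prop
      have kb : Continuous (fun t => p * s2 t) := by fun_prop
      have kc : Continuous (fun t => θ * (s1 t * (1 - s2 t))) := by fun_prop
      have kab : Continuous (fun t => 1 - s1 t + p * s2 t) := by fun_prop
      simp only [hρ]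
      rw [intervalIntegral.integral_add (ii kab _ _) (ii kc _ _), intervalIntegral.integral_add (ii ka _ _) (ii kb _ _),
        intervalIntegral.integral_const_mul, intervalIntegral.integral_const_mul]
    simp only [hTd, this, hθ]
    rw [div_mul_cancel₀ _ I3.ne']; linarith
  refine ⟨T, ?_, fun x => by rw [hderiv]; exact hρp x, fun x hx => ?_, fun x hx => ?_⟩
  · rw [contDiff_infty_iff_deriv]
    exact ⟨fun x => (hder x).differentiableAt, by rw [hderiv]; exact cρ⟩
  · simp only [hTd]
    rw [intervalIntegral.integral_congr (g := fun _ => 1)]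
    · simp
    · intro t ht
      rw [uIcc_of_ge hx] at ht
      simp only [hρ]; rw [s1z t ht.2, s2z t (by linarith [ht.2])]; ring
  · have e : T x = T b + ∫ t in b..x, ρ t := by
      simp only [hTd]
      rw [← intervalIntegral.integral_add_adjacent_intervals (ii kρ a b) (ii kρ b x)]; ring
    rw [e, hTb, intervalIntegral.integral_congr (g := fun _ => p)]
    · simp; ring
    · intro t ht
      rw [uIcc_of_le hx] at ht
      simp only [hρ]; rw [s1o t (by linarith [ht.1]), s2o t ht.1]; ring

/-- a circle diffeo which is `2x - s` on `[b,c]` and the identity outside `[a,d]` -/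
lemma gmap {a b c d s α : ℝ} (hab : a < b) (hbc : b < c) (hcd : c < d) (h1 : a < 2 * b - s) (h2 : 2 * c - s < d)
    (ha : α < a) (hd : d < α + 1) :
    ∃ g : LFG, Sup g (arc a d) ∧ ∀ x (n : ℤ), b ≤ x → x ≤ c → g.1 (x + n) = 2 * x - s + n := by
  obtain ⟨T1, c1, p1, l1, r1⟩ := interp (p := 2) (q := -s) hab (by norm_num) (by linarith)
  obtain ⟨T2, c2, p2, l2, r2⟩ := interp (a := 2 * c - s) (b := 2 * d - s) (p := 1/2) (q := s/2) (by linarith) (by norm_num) (by linarith)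
  have dT1 : Differentiable ℝ T1 := c1.differentiable (by simp)
  have dT2 : Differentiable ℝ T2 := c2.differentiable (by simp)
  set D : ℝ → ℝ := fun x => T2 (T1 x) - x with hD
  have cD : ContDiff ℝ (⊤ : ℕ∞) D := (c2.comp c1).sub contDiff_id
  have dD : ∀ x, -1 < deriv D x := fun x => by
    have e1 : HasDerivAt (fun x => T2 (T1 x)) (deriv T2 (T1 x) * deriv T1 x) x :=
      (dT2 (T1 x)).hasDerivAt.comp x (dT1 x).hasDerivAt
    have e2 := e1.sub (hasDerivAt_id x)
    have e3 : deriv D x = deriv T2 (T1 x) * deriv T1 x - 1 := e2.deriv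
    rw [e3]
    have := mul_pos (p2 (T1 x)) (p1 x)
    linarith
  have zD : ∀ x, x ≤ a ∨ d ≤ x → D x = 0 := fun x hx => by
    simp only [hD]
    rcases hx with hx | hx
    · rw [l1 x hx, l2 x (by linarith), sub_self]
    · rw [r1 x (by linarith), r2 _ (by linarith)]; ring
  obtain ⟨P, hP, hPv, hPd⟩ := periodize cD ha hd (fun x hx => zD x (hx.imp le_of_lt le_of_lt))
  have hLF : LF (fun x => x + P x) := LF_of_SP hP (fun x => by obtain ⟨y, hy⟩ := hPd x; rw [hy]; exact dD y)
  refine ⟨mkL hLF, fun x hx => ?_, fun x n hb hc => ?_⟩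
  · rw [mkL_apply]
    set n := ⌊x - α⌋
    have e1 := Int.floor_le (x - α)
    have e2 := Int.lt_floor_add_one (x - α)
    have e3 := hPv (x - n) n (by linarith) (by linarith)
    rw [sub_add_cancel] at e3
    rw [e3, zD, add_zero]
    by_contra hcon
    push Not at hcon
    exact hx ⟨n, hcon.1.le, hcon.2.le⟩
  · rw [mkL_apply, hPv x n (by linarith) (by linarith)]
    simp only [hD]
    rw [r1 x hb, l2 _ (by linarith)]; ring


def ee : ℝ := 1/100
def J1 : Set ℝ := arc (1/6 - ee) (1/2 + ee)
def J2 : Set ℝ := arc (1/2 - ee) (5/6 + ee)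
def J3 : Set ℝ := arc (-(1/6) - ee) (1/6 + ee)

def st (c : ℝ) : ℝ → ℝ := fun x => Real.smoothTransition ((x - (c - ee)) / (2 * ee))
lemma st_smooth (c : ℝ) : ContDiff ℝ (⊤ : ℕ∞) (st c) := Real.smoothTransition.contDiff.comp (by fun_prop)
lemma st_zero {c x : ℝ} (h : x ≤ c - ee) : st c x = 0 :=
  Real.smoothTransition.zero_of_nonpos (div_nonpos_of_nonpos_of_nonneg (by linarith) (by norm_num [ee]))
lemma st_one {c x : ℝ} (h : c + ee ≤ x) : st c x = 1 :=
  Real.smoothTransition.one_of_one_le (by rw [le_div_iff₀ (by norm_num [ee])]; linarith)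

lemma cutoffs : ∃ η1 η2 : ℝ → ℝ, SP η1 ∧ SP η2 ∧ (∀ x, x ∉ J1 → η1 x = 0) ∧ (∀ x, x ∉ J2 → η1 x = η2 x) ∧
    ∀ x, x ∉ J3 → η2 x = 1 := by
  have he : ee = 1/100 := rfl
  obtain ⟨P1, h1, v1, -⟩ := periodize (d := fun x => st (1/6) x * (1 - st (1/2) x)) (α := 0) (a := 1/6 - ee) (b := 1/2 + ee)
    ((st_smooth _).mul (contDiff_const.sub (st_smooth _))) (by linarith) (by linarith) (by
      rintro x (hx | hx)
      · rw [st_zero hx.le]; ring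
      · rw [st_one hx.le]; ring)
  obtain ⟨P2, h2, v2, -⟩ := periodize (d := fun x => st (1/6) x * (1 - st (5/6) x)) (α := 0) (a := 1/6 - ee) (b := 5/6 + ee)
    ((st_smooth _).mul (contDiff_const.sub (st_smooth _))) (by linarith) (by linarith) (by
      rintro x (hx | hx)
      · rw [st_zero hx.le]; ring
      · rw [st_one hx.le]; ring)
  have key : ∀ (P d : ℝ → ℝ), (∀ x (n : ℤ), 0 ≤ x → x < 0 + 1 → P (x + n) = d x) → ∀ x, P x = d (x - ⌊x⌋) := fun P d h x => by
    have e1 := Int.floor_le x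
    have e2 := Int.lt_floor_add_one x
    have := h (x - ⌊x⌋) ⌊x⌋ (by linarith) (by linarith)
    rwa [sub_add_cancel] at this
  refine ⟨P1, P2, h1, h2, fun x hx => ?_, fun x hx => ?_, fun x hx => ?_⟩
  · rw [key _ _ v1]
    rcases le_or_gt (x - ⌊x⌋) (1/6 - ee) with h | h
    · simp only [st_zero h]; ring
    · rcases le_or_gt (1/2 + ee) (x - ⌊x⌋) with h' | h'
      · simp only [st_one h']; ring
      · exact absurd ⟨⌊x⌋, h.le, h'.le⟩ hx
  · rw [key _ _ v1, key _ _ v2]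
    rcases le_or_gt (x - ⌊x⌋) (1/2 - ee) with h | h
    · simp only [st_zero h]; rw [st_zero (c := 5/6) (by linarith)]
    · rcases le_or_gt (5/6 + ee) (x - ⌊x⌋) with h' | h'
      · simp only [st_one h']; rw [st_one (c := 1/2) (by linarith)]
      · exact absurd ⟨⌊x⌋, h.le, h'.le⟩ hx
  · rw [key _ _ v2]
    have e1 := Int.floor_le x
    have e2 := Int.lt_floor_add_one x
    have a1 : 1/6 + ee < x - ⌊x⌋ := by
      by_contra hc
      exact hx ⟨⌊x⌋, by linarith, by linarith⟩
    have a2 : x - ⌊x⌋ < 5/6 - ee := by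
      by_contra hc
      exact hx ⟨⌊x⌋ + 1, by push_cast; linarith, by push_cast; linarith⟩
    simp only [st_one a1.le]; rw [st_zero (c := 5/6) (by linarith)]; ring

lemma conj_S {g φ ψ : LFG} {b c : ℝ} {s : ℤ} (hbc' : b < c) (hbc : c - b < 1/2) (hφ : Sup φ (arc b c))
    (hg : ∀ x (n : ℤ), b ≤ x → x ≤ c → g.1 (x + n) = 2 * x - s + n)
    (hψ : ∀ x, ψ.1 x = x + Sop (disp φ) x) : ψ = g * φ * g⁻¹ := by
  suffices h : ∀ x, ψ.1 (g.1 x) = g.1 (φ.1 x) by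
    apply lext
    intro z
    have := h ((g⁻¹).1 z)
    simpa using this
  have hper := (disp_sp φ).per_int
  have q0 : ∀ x, x ∉ arc b c → disp φ x = 0 := fun x hx => by simp only [disp]; rw [hφ x hx, sub_self]
  have mono : StrictMono (fun x => φ.1 x) := (lfg φ).mono
  intro x
  by_cases hx : x ∈ arc b c
  · obtain ⟨n, h1, h2⟩ := hx
    obtain ⟨x0, rfl⟩ : ∃ x0, x = x0 + n := ⟨x - n, by ring⟩
    rw [add_sub_cancel_right] at h1 h2
    have fx : ∀ y, c - 1 < y → y < b → φ.1 y = y := fun y hy hy' => hφ y (by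
      rintro ⟨m, hm1, hm2⟩
      have k1 : (m:ℝ) < 0 := by linarith
      have k2 : (-1:ℝ) < m := by linarith
      have k1' : m < 0 := by exact_mod_cast k1
      have k2' : -1 < m := by exact_mod_cast k2
      omega)
    have fy : ∀ y, c < y → y < b + 1 → φ.1 y = y := fun y hy hy' => hφ y (by
      rintro ⟨m, hm1, hm2⟩
      have k1 : (m:ℝ) < 1 := by linarith
      have k2 : (0:ℝ) < m := by linarith
      have k1' : m < 1 := by exact_mod_cast k1
      have k2' : 0 < m := by exact_mod_cast k2
      omega)
    have g1 : b ≤ φ.1 x0 := by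
      by_contra hc
      push Not at hc
      obtain ⟨y, hy1, hy2⟩ := exists_between (max_lt hc (show c - 1 < b by linarith))
      have e := fx y (lt_of_le_of_lt (le_max_right _ _) hy1) hy2
      have e2 := mono (show y < x0 by linarith)
      simp only at e2
      have := lt_of_le_of_lt (le_max_left _ _) hy1
      linarith
    have g2 : φ.1 x0 ≤ c := by
      by_contra hc
      push Not at hc
      obtain ⟨y, hy1, hy2⟩ := exists_between (lt_min hc (show c < b + 1 by linarith))
      have e := fy y hy1 (lt_of_lt_of_le hy2 (min_le_right _ _))
      have e2 := mono (show x0 < y by linarith)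
      simp only at e2
      have := lt_of_lt_of_le hy2 (min_le_left _ _)
      linarith
    rw [hψ, lint φ, hg _ n g1 g2, hg _ n h1 h2, ap_disp φ x0]
    have hz : ∀ r : ℤ, disp φ (x0 + 1/2 + r) = 0 := fun r => by
      rw [hper]
      apply q0
      rintro ⟨m, hm1, hm2⟩
      rcases le_or_gt m 0 with hm | hm
      · have : (m:ℝ) ≤ 0 := by exact_mod_cast hm
        linarith
      · have : (1:ℝ) ≤ m := by exact_mod_cast hm
        linarith
    have key : disp φ ((2 * x0 - s + n) / 2) + disp φ ((2 * x0 - s + n + 1) / 2) = disp φ x0 := by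
      rcases Int.even_or_odd' (n - s) with ⟨r, hr | hr⟩
      · have hr' : (n:ℝ) - s = 2 * r := by exact_mod_cast hr
        rw [show (2 * x0 - s + n) / 2 = x0 + r by linarith, show (2 * x0 - s + n + 1) / 2 = x0 + 1/2 + r by linarith,
          hz, hper, add_zero]
      · have hr' : (n:ℝ) - s = 2 * r + 1 := by exact_mod_cast hr
        rw [show (2 * x0 - s + n) / 2 = x0 + 1/2 + r by linarith,
          show (2 * x0 - s + n + 1) / 2 = x0 + ((r + 1 : ℤ) : ℝ) by push_cast; linarith,
          hz, hper, zero_add]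
    simp only [Sop]
    rw [key]; ring
  · rw [hφ x hx, hψ]
    have k1 : disp φ (g.1 x / 2) = 0 := by
      apply q0
      rintro ⟨m, h1, h2⟩
      apply hx
      have := hg _ (2 * m + s) h1 h2
      push_cast at this
      have e : x = g.1 x / 2 - m + ((2 * m + s : ℤ) : ℝ) := by
        apply linj g
        push_cast
        rw [this]; ring
      refine ⟨2 * m + s, ?_, ?_⟩ <;> linarith
    have k2 : disp φ ((g.1 x + 1) / 2) = 0 := by
      apply q0
      rintro ⟨m, h1, h2⟩
      apply hx
      have := hg _ (2 * m - 1 + s) h1 h2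
      push_cast at this
      have e : x = (g.1 x + 1) / 2 - m + ((2 * m - 1 + s : ℤ) : ℝ) := by
        apply linj g
        push_cast
        rw [this]; ring
      refine ⟨2 * m - 1 + s, ?_, ?_⟩ <;> linarith
    simp only [Sop]; rw [k1, k2]; ring

lemma conj_Sh (k : ℝ) : ∃ (K : ℕ → ℕ) (δ : ℕ → ℝ), (∀ m, 0 < δ m) ∧ ∀ φ : ℕ → LFG,
    (∀ m, Sup (φ m) (AA k)) → (∀ m, NN (K m) (disp (φ m)) ≤ δ m) →
    ∀ y : ℕ → LFG, Sh y → (∀ m, Sup (y m) (AA k)) → Sh (fun m => φ m * y m * (φ m)⁻¹) := by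
  obtain ⟨K, δ, h, H⟩ := extract k
  refine ⟨K, δ, h, fun φ h1 h2 y hy hy' => ?_⟩
  obtain ⟨W, hW, hW'⟩ := H φ h1 h2
  have : (fun m => φ m * y m * (φ m)⁻¹) = fun m => W m * y m * (W m)⁻¹ := by
    funext m; exact (conj_eq (h1 m) (hy' m) (hW' m)).symm
  rw [this]
  exact (hW.mul hy).mul hW.inv

lemma main_Sh : ∃ (K : ℕ → ℕ) (δ : ℕ → ℝ), (∀ m, 0 < δ m) ∧ ∀ φ1 φ2 φ3 ψ1 ψ2 ψ3 : ℕ → LFG,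
    (∀ m, Sup (φ1 m) J1) → (∀ m, Sup (φ2 m) J2) → (∀ m, Sup (φ3 m) J3) →
    (∀ m x, (ψ1 m).1 x = x + Sop (disp (φ1 m)) x) →
    (∀ m x, (ψ2 m).1 x = x + Sop (disp (φ2 m)) x) →
    (∀ m x, (ψ3 m).1 x = x + Sop (disp (φ3 m)) x) →
    (∀ m, NN (K m) (disp (φ1 m)) ≤ δ m) → (∀ m, NN (K m) (disp (φ2 m)) ≤ δ m) →
    (∀ m, NN (K m) (disp (φ3 m)) ≤ δ m) →
    Sh (fun m => φ1 m * φ2 m * φ3 m * (ψ1 m * ψ2 m * ψ3 m)⁻¹) := by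
  have he : ee = 1/100 := rfl
  have hk : kap = 1/50 := rfl
  obtain ⟨g1, s1, d1⟩ := gmap (a := 11/100) (b := 1/6 - ee) (c := 1/2 + ee) (d := 106/100) (s := ((0:ℤ):ℝ)) (α := 1/12)
    (by linarith) (by linarith) (by linarith) (by push_cast; linarith) (by push_cast; linarith) (by linarith) (by linarith)
  obtain ⟨g2, s2, d2⟩ := gmap (a := -6/100) (b := 1/2 - ee) (c := 5/6 + ee) (d := 89/100) (s := ((1:ℤ):ℝ)) (α := -1/12)
    (by linarith) (by linarith) (by linarith) (by push_cast; linarith) (by push_cast; linarith) (by linarith) (by linarith)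
  obtain ⟨g3, s3, d3⟩ := gmap (a := -37/100) (b := -(1/6) - ee) (c := 1/6 + ee) (d := 37/100) (s := ((0:ℤ):ℝ)) (α := -1/2)
    (by linarith) (by linarith) (by linarith) (by push_cast; linarith) (by push_cast; linarith) (by linarith) (by linarith)
  obtain ⟨K1, δ1, hδ1, H1⟩ := conj_Sh (1/12)
  obtain ⟨K2, δ2, hδ2, H2⟩ := conj_Sh (11/12)
  obtain ⟨K3, δ3, hδ3, H3⟩ := conj_Sh (1/2)
  obtain ⟨K4, δ4, hδ4, H4⟩ := conj_Sh (5/12)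
  obtain ⟨K5, δ5, hδ5, H5⟩ := conj_Sh (7/12)
  refine ⟨fun m => K1 m + K2 m + K3 m + K4 m + K5 m,
    fun m => min kap (min (δ1 m) (min (δ2 m) (min (δ3 m) (min (δ4 m) (δ5 m))))), fun m => ?_, ?_⟩
  · have a1 := hδ1 m
    have a2 := hδ2 m
    have a3 := hδ3 m
    have a4 := hδ4 m
    have a5 := hδ5 m
    have : 0 < kap := by rw [hk]; norm_num
    simp only [lt_min_iff]
    exact ⟨this, a1, a2, a3, a4, a5⟩
  intro φ1 φ2 φ3 ψ1 ψ2 ψ3 u1 u2 u3 p1 p2 p3 n1 n2 n3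
  simp only [le_min_iff] at n1 n2 n3
  have e1 : ∀ m, ψ1 m = g1 * φ1 m * g1⁻¹ := fun m => conj_S (s := 0) (by linarith) (by linarith) (u1 m) d1 (p1 m)
  have e2 : ∀ m, ψ2 m = g2 * φ2 m * g2⁻¹ := fun m => conj_S (s := 1) (by linarith) (by linarith) (u2 m) d2 (p2 m)
  have e3 : ∀ m, ψ3 m = g3 * φ3 m * g3⁻¹ := fun m => conj_S (s := 0) (by linarith) (by linarith) (u3 m) d3 (p3 m)
  have le := fun {i j : ℕ} (h : i ≤ j) (f : LFG) => NN_mono h (disp f)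
  -- e_j
  have E1 : Sh (fun m => φ1 m * g1 * (φ1 m)⁻¹ * g1⁻¹) :=
    (H1 φ1 (fun m => (u1 m).mono (arc_sub 0 (by push_cast; linarith) (by push_cast; linarith)))
      (fun m => (le (by omega) _).trans (n1 m).2.1) (fun _ => g1) (Sh.const g1)
      (fun m => s1.mono (arc_sub 0 (by push_cast; linarith) (by push_cast; linarith)))).mul (Sh.const g1⁻¹)
  have sg2 : Sup g2 (AA (11/12)) := s2.mono (arc_sub 1 (by push_cast; linarith) (by push_cast; linarith))
  have sf2 : ∀ m, Sup (φ2 m) (AA (11/12)) := fun m => (u2 m).mono (arc_sub 1 (by push_cast; linarith) (by push_cast; linarith))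
  have E2 : Sh (fun m => φ2 m * g2 * (φ2 m)⁻¹ * g2⁻¹) :=
    (H2 φ2 sf2 (fun m => (le (by omega) _).trans (n2 m).2.2.1) (fun _ => g2) (Sh.const g2) (fun m => sg2)).mul (Sh.const g2⁻¹)
  have E2' : Sh (fun m => φ1 m * (φ2 m * g2 * (φ2 m)⁻¹ * g2⁻¹) * (φ1 m)⁻¹) :=
    H2 φ1 (fun m => (u1 m).mono (arc_sub 1 (by push_cast; linarith) (by push_cast; linarith)))
      (fun m => (le (by omega) _).trans (n1 m).2.2.1) _ E2
      (fun m => (((sf2 m).mul sg2).mul (sf2 m).inv).mul sg2.inv)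
  have sg3 : Sup g3 (AA (1/2)) := s3.mono (arc_sub 1 (by push_cast; linarith) (by push_cast; linarith))
  have sf3 : ∀ m, Sup (φ3 m) (arc (-37/100) (37/100)) := fun m => (u3 m).mono (arc_sub 0 (by push_cast; linarith) (by push_cast; linarith))
  have E3 : Sh (fun m => φ3 m * g3 * (φ3 m)⁻¹ * g3⁻¹) :=
    (H3 φ3 (fun m => (sf3 m).mono (arc_sub 1 (by push_cast; linarith) (by push_cast; linarith)))
      (fun m => (le (by omega) _).trans (n3 m).2.2.2.1) (fun _ => g3) (Sh.const g3) (fun m => sg3)).mul (Sh.const g3⁻¹)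
  have t3 : ∀ m, Sup (φ3 m * g3 * (φ3 m)⁻¹ * g3⁻¹) (arc (-37/100) (37/100)) := fun m =>
    (((sf3 m).mul s3).mul (sf3 m).inv).mul s3.inv
  have E3' : Sh (fun m => φ2 m * (φ3 m * g3 * (φ3 m)⁻¹ * g3⁻¹) * (φ2 m)⁻¹) :=
    H4 φ2 (fun m => (u2 m).mono (arc_sub 0 (by push_cast; linarith) (by push_cast; linarith)))
      (fun m => (le (by omega) _).trans (n2 m).2.2.2.2.1) _ E3
      (fun m => (t3 m).mono (arc_sub 1 (by push_cast; linarith) (by push_cast; linarith)))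
  have t3' : ∀ m, Sup (φ2 m * (φ3 m * g3 * (φ3 m)⁻¹ * g3⁻¹) * (φ2 m)⁻¹) (arc (-39/100) (39/100)) := fun m x hx => by
    have hy : ((φ2 m)⁻¹).1 x ∉ arc (-37/100) (37/100) := by
      rintro ⟨n, h1, h2⟩
      apply hx
      have a1 := ap_disp (φ2 m) (((φ2 m)⁻¹).1 x)
      rw [linv2] at a1
      have a2 := ((disp_sp (φ2 m)).le0 (((φ2 m)⁻¹).1 x)).trans ((nrm_le_NN (Nat.zero_le _) _).trans (n2 m).1)
      have a3 := abs_le.1 a2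
      exact ⟨n, by linarith, by linarith⟩
    rw [lmul, lmul, t3 m _ hy, linv2]
  have E3'' : Sh (fun m => φ1 m * (φ2 m * (φ3 m * g3 * (φ3 m)⁻¹ * g3⁻¹) * (φ2 m)⁻¹) * (φ1 m)⁻¹) :=
    H5 φ1 (fun m => (u1 m).mono (arc_sub 1 (by push_cast; linarith) (by push_cast; linarith)))
      (fun m => (le (by omega) _).trans (n1 m).2.2.2.2.2) _ E3'
      (fun m => (t3' m).mono (arc_sub 1 (by push_cast; linarith) (by push_cast; linarith)))
  have fin := (E3''.mul E2').mul E1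
  refine (congrArg Sh ?_).mp fin
  funext m
  rw [e1, e2, e3]
  group


lemma lift_one {G : ℝ → ℝ} (h : IsLift 1 G) : ∃ n : ℤ, ∀ x, G x = x + n := by
  have h1 : ∀ x : ℝ, ∃ n : ℤ, (n : ℝ) = G x - x := fun x => by
    have h2 := h.2.2.2 x
    have h3 : ((G x - x : ℝ) : S1) = 0 := by
      rw [AddCircle.coe_sub, ← h2]; simp
    obtain ⟨n, hn⟩ := (AddCircle.coe_eq_zero_iff 1).1 h3
    exact ⟨n, by rw [← hn]; simp⟩
  choose N hN using h1
  have hc : Continuous N := by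
    rw [Int.isClosedEmbedding_coe_real.isInducing.continuous_iff]
    have : ((fun n : ℤ => (n : ℝ)) ∘ N) = fun x => G x - x := funext hN
    have h2 := h.1.continuous
    show Continuous ((fun n : ℤ => (n : ℝ)) ∘ N)
    rw [this]; fun_prop
  refine ⟨N 0, fun x => ?_⟩
  have : N x = N 0 := PreconnectedSpace.constant inferInstance hc
  rw [← this, hN]; ring

lemma NN_le_liftDist {F G : ℝ → ℝ} (hF : ContDiff ℝ (⊤ : ℕ∞) F) (hG : ContDiff ℝ (⊤ : ℕ∞) G) (K : ℕ) :
    NN K (fun x => F x - G x) ≤ (K + 1) * liftDist K F G := by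
  have e : ∀ j : ℕ, (⨆ x : ℝ, |iteratedDeriv j F x - iteratedDeriv j G x|) = nrm j (fun x => F x - G x) := fun j => by
    have : ∀ x, iteratedDeriv j F x - iteratedDeriv j G x = iteratedDeriv j (fun x => F x - G x) x := fun x => by
      have h1 : ContDiffAt ℝ j F x := (hF.of_le (by exact_mod_cast le_top)).contDiffAt
      have h2 : ContDiffAt ℝ j G x := (hG.of_le (by exact_mod_cast le_top)).contDiffAt
      exact (iteratedDeriv_fun_sub h1 h2).symm
    simp only [this]; rfl
  unfold liftDist
  simp only [e]
  have hle : ∀ j ∈ Finset.range (K+1), nrm j (fun x => F x - G x) ≤ ⨆ j : Fin (K+1), nrm j (fun x => F x - G x) := fun j hj =>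
    le_ciSup (f := fun j : Fin (K+1) => nrm j (fun x => F x - G x)) (Set.finite_range _).bddAbove ⟨j, Finset.mem_range.1 hj⟩
  have := Finset.sum_le_card_nsmul _ _ _ hle
  simp only [Finset.card_range, nsmul_eq_mul] at this
  push_cast at this
  exact this

lemma rec_lift {f : Equiv.Perm S1} (hf : HasLift f) (hrec : Recurrent f) (K : ℕ) {δ : ℝ} (hδ : 0 < δ) (N : ℕ) :
    ∃ ν, N ≤ ν ∧ ∃ e : LFG, toS e = f ^ ν ∧ NN K (disp e) ≤ δ := by
  obtain ⟨n, hn, -, hd⟩ := hrec K (δ / (K + 1)) (by positivity) N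
  obtain ⟨F0, hF0⟩ := hf
  have hp : HasLift (f ^ n) := by
    rw [← toS_of_lift hF0 hF0.lf, ← map_pow]; exact toS_HasLift _
  have h1 : HasLift 1 := by rw [← map_one toS]; exact toS_HasLift _
  obtain ⟨F1, hF1⟩ := hp
  obtain ⟨G1, hG1⟩ := h1
  have hne : {d | ∃ F G, IsLift (f^n) F ∧ IsLift 1 G ∧ d = liftDist K F G}.Nonempty :=
    ⟨_, F1, G1, hF1, hG1, rfl⟩
  unfold distC at hd
  obtain ⟨d, ⟨F, G, hF, hG, rfl⟩, hlt⟩ := exists_lt_of_csInf_lt hne hd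
  obtain ⟨p, hp⟩ := lift_one hG
  refine ⟨n, hn, (mkL hG.lf)⁻¹ * mkL hF.lf, ?_, ?_⟩
  · rw [map_mul, map_inv, toS_of_lift hG, toS_of_lift hF]; simp
  · have he : disp ((mkL hG.lf)⁻¹ * mkL hF.lf) = fun x => F x - G x := by
      funext x
      have : ((mkL hG.lf)⁻¹ * mkL hF.lf).1 x = F x - p := by
        apply linj (mkL hG.lf)
        rw [lmul, linv2, mkL_apply, mkL_apply, hp]; ring
      simp only [disp, this, hp]; ring
    rw [he]
    refine (NN_le_liftDist hF.1 hG.1 K).trans ?_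
    have h0 : (0:ℝ) < K + 1 := by positivity
    rw [lt_div_iff₀ h0] at hlt
    linarith

lemma DD_inj {a : ℝ → ℝ} (ha : SP a) (h : nrm 1 a ≤ 1/8) {x y : ℝ} (e : x + a x = y + a y) : x = y := by
  have hL := LF_of_nrm ha (h.trans (by norm_num))
  apply linj (mkL hL)
  rw [mkL_apply, mkL_apply]; exact e

lemma exists_Sh {f : Equiv.Perm S1} (hf : HasLift f) (hrec : Recurrent f) :
    ∃ (ν : ℕ → ℕ) (e : ℕ → LFG), (∀ m, (m+1)^2 ≤ ν m) ∧ (∀ m, toS (e m) = f ^ (ν m)) ∧ Sh e := by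
  obtain ⟨η1, η2, s1, s2, z1, z2, z3⟩ := cutoffs
  obtain ⟨r, ε, C, hε, hfr⟩ := frag_main s1 s2
  obtain ⟨K, δ, hδ, hSh⟩ := main_Sh
  have key : ∀ m : ℕ, ∃ (ν : ℕ) (e φ1 φ2 φ3 ψ1 ψ2 ψ3 : LFG), (m+1)^2 ≤ ν ∧ toS e = f ^ ν ∧
      Sup φ1 J1 ∧ Sup φ2 J2 ∧ Sup φ3 J3 ∧
      (∀ x, ψ1.1 x = x + Sop (disp φ1) x) ∧ (∀ x, ψ2.1 x = x + Sop (disp φ2) x) ∧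
      (∀ x, ψ3.1 x = x + Sop (disp φ3) x) ∧
      NN (K m) (disp φ1) ≤ δ m ∧ NN (K m) (disp φ2) ≤ δ m ∧ NN (K m) (disp φ3) ≤ δ m ∧
      e = φ1 * φ2 * φ3 * (ψ1 * ψ2 * ψ3)⁻¹ := by
    intro m
    have hc : 0 < |C (K m)| + 1 := by positivity
    obtain ⟨ν, hν, e, he, hN⟩ := rec_lift hf hrec (r + K m)
      (δ := min ε (min 1 (δ m / (|C (K m)| + 1))))
      (lt_min hε (lt_min one_pos (div_pos (hδ m) hc))) ((m+1)^2)
    have hN1 := hN.trans (min_le_left _ _)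
    have hN2 := (hN.trans (min_le_right _ _)).trans (min_le_left _ _)
    have hN3 := (hN.trans (min_le_right _ _)).trans (min_le_right _ _)
    obtain ⟨u, q1, q2, q3, su, ⟨t1, t2, t3⟩, ⟨n1, n2, n3⟩, k1, k2, E1, E2, E3, EU, hk⟩ :=
      hfr (disp e) (disp_sp e) ((NN_mono (by omega) _).trans hN1)
    obtain ⟨b1, b2, b3⟩ := hk (K m) hN2
    have bound : ∀ q : ℝ → ℝ, NN (r + K m) q ≤ C (K m) * NN (r + K m) (disp e) → NN (K m) q ≤ δ m := by
      intro q hq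
      refine (NN_mono (by omega) q).trans (hq.trans ?_)
      have h0 := NN_nonneg (r + K m) (disp e)
      rw [le_div_iff₀ hc] at hN3
      nlinarith [le_abs_self (C (K m))]
    have hs : ∀ q : ℝ → ℝ, SP q → nrm 1 q ≤ 1/8 → nrm 1 (Sop q) ≤ 1/2 := by
      intro q sq hq
      have := Sop_nrm 1 sq
      linarith
    have hh : ∀ q : ℝ → ℝ, nrm 1 q ≤ 1/8 → nrm 1 q ≤ 1/2 := fun q hq => by linarith
    have L1 := LF_of_nrm t1 (hh _ n1)
    have L2 := LF_of_nrm t2 (hh _ n2)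
    have L3 := LF_of_nrm t3 (hh _ n3)
    have M1 := LF_of_nrm (Sop_sp t1) (hs _ t1 n1)
    have M2 := LF_of_nrm (Sop_sp t2) (hs _ t2 n2)
    have M3 := LF_of_nrm (Sop_sp t3) (hs _ t3 n3)
    have d1 : disp (mkL L1) = q1 := by funext x; simp only [disp, mkL_apply]; ring
    have d2 : disp (mkL L2) = q2 := by funext x; simp only [disp, mkL_apply]; ring
    have d3 : disp (mkL L3) = q3 := by funext x; simp only [disp, mkL_apply]; ring
    refine ⟨ν, e, mkL L1, mkL L2, mkL L3, mkL M1, mkL M2, mkL M3, hν, he, ?_, ?_, ?_, ?_, ?_, ?_, ?_, ?_, ?_, ?_⟩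
    · intro x hx
      rw [mkL_apply, E1, z1 x hx]; ring
    · intro x hx
      rw [mkL_apply]
      refine DD_inj (s1.mul su) k1 ?_
      have := E2 x
      have h2 := z2 x hx
      rw [h2]; linarith
    · intro x hx
      rw [mkL_apply]
      refine DD_inj (s2.mul su) k2 ?_
      have := E3 x
      have h2 := z3 x hx
      rw [h2]; linarith
    · intro x; rw [d1, mkL_apply]
    · intro x; rw [d2, mkL_apply]
    · intro x; rw [d3, mkL_apply]
    · rw [d1]; exact bound _ b1
    · rw [d2]; exact bound _ b2
    · rw [d3]; exact bound _ b3
    · rw [eq_mul_inv_iff_mul_eq]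
      apply lext
      intro x
      have h := EU x
      simp only [DD] at h
      simp only [lmul, mkL_apply]
      rw [ap_disp, ← h]
      have e3 := E3 x
      have e2 := E2 (x + q3 x)
      have e1 := E1 (x + q3 x + q2 (x + q3 x))
      linarith
  choose ν e φ1 φ2 φ3 ψ1 ψ2 ψ3 h1 h2 h3 h4 h5 h6 h7 h8 h9 h10 h11 h12 using key
  refine ⟨ν, e, h1, h2, ?_⟩
  have := hSh φ1 φ2 φ3 ψ1 ψ2 ψ3 h3 h4 h5 h6 h7 h8 h9 h10 h11
  rwa [← funext h12] at this

lemma wl_le {S : Set (Equiv.Perm S1)} {g : Equiv.Perm S1} (l : List (Equiv.Perm S1))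
    (h : ∀ x ∈ l, x ∈ S ∨ x⁻¹ ∈ S) (hp : l.prod = g) : wordLength S g ≤ l.length :=
  Nat.sInf_le ⟨l, rfl, h, hp⟩

lemma wl_att {S : Set (Equiv.Perm S1)} {f : Equiv.Perm S1} (hf : f ∈ S) (n : ℕ) :
    ∃ l : List (Equiv.Perm S1), l.length = wordLength S (f^n) ∧ (∀ x ∈ l, x ∈ S ∨ x⁻¹ ∈ S) ∧ l.prod = f^n := by
  apply Nat.sInf_mem (s := {k | ∃ l : List (Equiv.Perm S1),
    l.length = k ∧ (∀ x ∈ l, x ∈ S ∨ x⁻¹ ∈ S) ∧ l.prod = f^n})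
  refine ⟨n, List.replicate n f, by simp, fun x hx => ?_, by simp⟩
  rw [List.eq_of_mem_replicate hx]; exact Or.inl hf

theorem final_dist (f : Equiv.Perm S1) (hf : HasLift f)
    (hrec : Recurrent f) : IsDistortion f := by
  obtain ⟨ν, e, hν, he, S, hS, c, hl⟩ := exists_Sh hf hrec
  have hT : (insert f (toS '' S)).Finite := (hS.image _).insert f
  set T := insert f (toS '' S) with hTd
  have hfT : f ∈ T := Set.mem_insert _ _
  refine ⟨hT.toFinset, ?_, ?_, ?_⟩
  · intro g hg
    rw [Set.Finite.mem_toFinset] at hg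
    rcases hg with rfl | ⟨a, -, rfl⟩
    · exact hf
    · exact toS_HasLift a
  · rw [Set.Finite.coe_toFinset]; exact Subgroup.subset_closure hfT
  rw [Set.Finite.coe_toFinset]
  have hsub : Subadditive (fun n : ℕ => (wordLength T (f^n) : ℝ)) := by
    intro a b
    obtain ⟨l1, g1, i1, p1⟩ := wl_att hfT a
    obtain ⟨l2, g2, i2, p2⟩ := wl_att hfT b
    have := wl_le (g := f^(a+b)) (l1 ++ l2) (fun x hx => (List.mem_append.1 hx).elim (i1 x) (i2 x))
      (by rw [List.prod_append, p1, p2, pow_add])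
    rw [List.length_append, g1, g2] at this
    beta_reduce; exact_mod_cast this
  have ht := hsub.tendsto_lim ⟨0, by rintro _ ⟨n, rfl⟩; positivity⟩
  have hνt : Tendsto ν atTop atTop :=
    tendsto_atTop_mono (fun m => (show m ≤ ν m by nlinarith [hν m])) tendsto_id
  have h2 := ht.comp hνt
  have hbd : ∀ m, (wordLength T (f^(ν m)) : ℝ) / (ν m : ℝ) ≤ c * (1 / ((m:ℝ)+1)) := by
    intro m
    obtain ⟨l, hlen, hmem, hprod⟩ := hl m
    have h3 := wl_le (S := T) (g := f^(ν m)) (l.map toS) (by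
      intro x hx
      obtain ⟨y, hy, rfl⟩ := List.mem_map.1 hx
      rcases hmem y hy with h | h
      · exact Or.inl (Or.inr ⟨y, h, rfl⟩)
      · exact Or.inr (Or.inr ⟨_, h, by simp⟩)) (by rw [← map_list_prod, hprod, he])
    rw [List.length_map] at h3
    have h4 : (wordLength T (f^(ν m)) : ℝ) ≤ c * (m+1) := by exact_mod_cast h3.trans hlen
    have h5 : ((m:ℝ)+1)^2 ≤ ν m := by exact_mod_cast hν m
    have hm : (0:ℝ) < (m:ℝ)+1 := by positivity
    calc (wordLength T (f^(ν m)) : ℝ) / (ν m : ℝ) ≤ c * (m+1) / ((m:ℝ)+1)^2 := by gcongr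
      _ = _ := by field_simp
  have h3 : Tendsto (fun m : ℕ => (c:ℝ) * (1 / ((m:ℝ)+1))) atTop (nhds 0) := by
    simpa using (tendsto_one_div_add_atTop_nhds_zero_nat (𝕜 := ℝ)).const_mul (c:ℝ)
  have h4 : Tendsto (fun m => (wordLength T (f^(ν m)) : ℝ) / (ν m : ℝ)) atTop (nhds 0) :=
    squeeze_zero (fun m => by positivity) hbd h3
  have h5 := tendsto_nhds_unique h2 h4
  rw [h5] at ht
  exact ht

/-- every recurrent smooth circle diffeomorphism is a distortion
element of Diff^∞(ℝ/ℤ). -/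
theorem recurrent_isDistortion (f : Equiv.Perm S1) (hf : HasLift f)
    (hrec : Recurrent f) : IsDistortion f := by
  exact final_dist f hf hrec

end
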